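/- Let H be a C³ Tonelli Hamiltonian on T*𝕋ⁿ that is C⁰ integrable. Then for every Borel probability measure μ on T*𝕋ⁿ that is invariant under the Hamiltonian flow (φ^H_t) and compactly supported, all Lyapunov exponents of μ are zero; equivalently, for μ-almost every point ζ and every nonzero tangent vector w ∈ ℝⁿ × ℝⁿ, lim_{t → +∞} (1/t) log ‖Dφ^H_t(ζ)·w‖ = 0 and lim_{t → +∞} (1/t) log ‖Dφ^H_{−t}(ζ)·w‖ = 0. -/

import Mathlib

open MeasureTheory Filter
open scoped NNReal

noncomputable section

abbrev E (n : ℕ) : Type := Fin n → ℝ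

/-- The vector of `ℝⁿ` whose coordinates are the integers `m i`. -/
def intVec {n : ℕ} (m : Fin n → ℤ) : E n := fun i => (m i : ℝ)

/-- A Tonelli Hamiltonian on `T*𝕋ⁿ`, identified with a `ℤⁿ`-periodic (in `x`) function
on `ℝⁿ × ℝⁿ` which is `Cᵏ`, uniformly superlinear in `p` and with positive definite
fiberwise Hessian. -/
structure IsTonelliHamiltonian (n : ℕ) (k : ℕ∞) (H : E n × E n → ℝ) : Prop where
  smooth : ContDiff ℝ k H
  periodic : ∀ (x p : E n) (m : Fin n → ℤ), H (x + intVec m, p) = H (x, p)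
  superlinear : ∀ C : ℝ, ∃ R : ℝ, ∀ (x p : E n), R ≤ ‖p‖ → C * ‖p‖ ≤ H (x, p)
  posdef : ∀ (x p w : E n), w ≠ 0 →
    0 < fderiv ℝ (fun p' => fderiv ℝ (fun p'' => H (x, p'')) p' w) p w

/-- The gradient of `H` in the fiber direction, `∂H/∂p (x, p)`, as a vector of `ℝⁿ`. -/
def gradP (n : ℕ) (H : E n × E n → ℝ) (x p : E n) : E n :=
  fun i => fderiv ℝ (fun p' => H (x, p')) p (Pi.single i 1)

/-- The gradient of `H` in the base direction, `∂H/∂x (x, p)`, as a vector of `ℝⁿ`. -/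
def gradX (n : ℕ) (H : E n × E n → ℝ) (x p : E n) : E n :=
  fun i => fderiv ℝ (fun x' => H (x', p)) x (Pi.single i 1)

/-- The Hamiltonian vector field `X_H (x, p) = (∂H/∂p, -∂H/∂x)`. -/
def hamVF (n : ℕ) (H : E n × E n → ℝ) (z : E n × E n) : E n × E n :=
  (gradP n H z.1 z.2, -gradX n H z.1 z.2)

/-- `φ` is the complete Hamiltonian flow of `H` on `ℝⁿ × ℝⁿ`. -/
def IsHamFlow (n : ℕ) (H : E n × E n → ℝ) (φ : ℝ → E n × E n → E n × E n) : Prop :=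
  (∀ z : E n × E n, φ 0 z = z) ∧
  ∀ (z : E n × E n) (t : ℝ), HasDerivAt (fun s => φ s z) (hamVF n H (φ t z)) t

/-- The flow `φ` has no conjugate points: for `t ≠ 0` the image of the vertical
subspace `{0} × ℝⁿ` under `Dφ_t(z)` meets `{0} × ℝⁿ` only in `0`. -/
def NoConjugatePoints (n : ℕ) (φ : ℝ → E n × E n → E n × E n) : Prop :=
  ∀ (z : E n × E n) (t : ℝ), t ≠ 0 → ∀ w : E n,
    (fderiv ℝ (φ t) z (0, w)).1 = 0 → w = 0

/-- The gradient of a function `u : ℝⁿ → ℝ`, as a vector of `ℝⁿ`. -/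
def gradF (n : ℕ) (u : E n → ℝ) (x : E n) : E n :=
  fun i => fderiv ℝ u x (Pi.single i 1)

/-- The euclidean pairing of two vectors of `ℝⁿ`. -/
def dotP (n : ℕ) (a b : E n) : ℝ := ∑ i, a i * b i

/-- The standard symplectic form `ω₀((a,b),(a',b')) = ⟨b, a'⟩ − ⟨a, b'⟩` on `ℝⁿ × ℝⁿ`. -/
def omega0 (n : ℕ) (w w' : E n × E n) : ℝ := dotP n w.2 w'.1 - dotP n w.1 w'.2

/-- The Jacobian matrix of a map `ψ : ℝⁿ → ℝⁿ` at `x`. -/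
def jacobian (n : ℕ) (ψ : E n → E n) (x : E n) : Matrix (Fin n) (Fin n) ℝ :=
  Matrix.of fun i j => fderiv ℝ (fun y => ψ y i) x (Pi.single j 1)

/-- `R = O(Iˢ)` near the zero section: on some neighborhood `{‖I‖ ≤ ε}` of `𝕋ⁿ × {0}`,
all mixed partial derivatives `∂_θ^a ∂_I^b R` with `b < s` are bounded by
`C_{a,b} ‖I‖^{s-b}`. -/
def BigOI (n : ℕ) (s : ℕ) (R : E n × E n → E n) : Prop :=
  ∃ ε : ℝ, 0 < ε ∧ ∀ a b : ℕ, b < s → ∃ C : ℝ, ∀ θ I : E n, ‖I‖ ≤ ε →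
    ‖iteratedFDeriv ℝ a (fun θ' => iteratedFDeriv ℝ b (fun I' => R (θ', I')) I) θ‖
      ≤ C * ‖I‖ ^ (s - b)

/-- A strongly Diophantine vector of `ℝⁿ`. -/
def StronglyDiophantine (n : ℕ) (ω : E n) : Prop :=
  ∃ γ : ℝ, 0 < γ ∧ ∃ τ : ℝ, ∀ k : Fin n → ℤ, k ≠ 0 → ∀ l : ℤ,
    γ / ‖intVec k‖ ^ τ ≤ |dotP n (intVec k) ω + (l : ℝ)|

/-- The `Cᵏ` norm of a map `ℝⁿ → ℝⁿ` (the supremum of the norms of all its iterated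
derivatives of order `≤ k`; a genuine supremum for periodic smooth maps). -/
noncomputable def CkNorm (n k : ℕ) (f : E n → E n) : ℝ :=
  ⨆ p : E n × Fin (k + 1), ‖iteratedFDeriv ℝ (p.2 : ℕ) f p.1‖

/-- `H` is `C⁰` integrable: the phase space is partitioned by invariant Lipschitz
Lagrangian graphs `{(x, c + ∇u_c x)}`, `c ∈ ℝⁿ`. -/
def C0Integrable (n : ℕ) (H : E n × E n → ℝ) (φ : ℝ → E n × E n → E n × E n) : Prop :=
  ∃ F : E n × E n → E n,
    (∀ c : E n, ∃ u : E n → ℝ, ContDiff ℝ 1 u ∧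
      (∀ (x : E n) (m : Fin n → ℤ), u (x + intVec m) = u x) ∧
      (∃ K : ℝ≥0, LipschitzWith K (gradF n u)) ∧
      ∀ x : E n, F (x, c) = c + gradF n u x) ∧
    (∀ (c : E n) (t : ℝ) (x : E n),
      (φ t (x, F (x, c))).2 = F ((φ t (x, F (x, c))).1, c)) ∧
    (∀ z : E n × E n, ∃! c : E n, z.2 = F (z.1, c))

/-- The configuration torus `𝕋ⁿ = ℝⁿ/ℤⁿ`. -/
abbrev Torus (n : ℕ) : Type := Fin n → AddCircle (1 : ℝ)

/-- The canonical projection `T*ℝⁿ → T*𝕋ⁿ`. -/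
def projT (n : ℕ) (z : E n × E n) : Torus n × E n :=
  (fun i => (z.1 i : AddCircle (1 : ℝ)), z.2)

open Classical in
/-- A weak-type estimate: the indices from which some forward average of `g` exceeds `θ`. -/
theorem card_forward_average_gt_mul_le {g : ℕ → ℝ} (hg : ∀ l, 0 ≤ g l) {θ : ℝ} (hθ : 0 < θ)
    (d : ℕ) : ∀ s : ℕ, θ * (((Finset.Ico s (s + d)).filter
      (fun j => ∃ m, j + m ≤ s + d ∧ θ * m < ∑ l ∈ Finset.Ico j (j + m), g l)).card : ℝ)
      ≤ ∑ l ∈ Finset.Ico s (s + d), g l := by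
  induction d using Nat.strong_induction_on with
  | _ d ih =>
    intro s
    rcases Nat.eq_zero_or_pos d with rfl | hd
    · simp
    have key : ∃ m, 0 < m ∧ m ≤ d ∧
        θ * (((Finset.Ico s (s + m)).filter
          (fun j => ∃ m, j + m ≤ s + d ∧ θ * m < ∑ l ∈ Finset.Ico j (j + m), g l)).card : ℝ)
          ≤ ∑ l ∈ Finset.Ico s (s + m), g l := by
      by_cases hs : ∃ m, s + m ≤ s + d ∧ θ * m < ∑ l ∈ Finset.Ico s (s + m), g l
      · obtain ⟨m, hm, hlt⟩ := hs
        refine ⟨m, ?_, by omega, ?_⟩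
        · rcases Nat.eq_zero_or_pos m with rfl | h
          · simp at hlt
          · exact h
        · refine le_trans ?_ hlt.le
          refine mul_le_mul_of_nonneg_left ?_ hθ.le
          have := Finset.card_filter_le (Finset.Ico s (s + m))
            (fun j => ∃ m, j + m ≤ s + d ∧ θ * m < ∑ l ∈ Finset.Ico j (j + m), g l)
          rw [Nat.card_Ico] at this
          exact_mod_cast (by omega)
      · refine ⟨1, one_pos, hd, ?_⟩
        have : (Finset.Ico s (s + 1)).filter
          (fun j => ∃ m, j + m ≤ s + d ∧ θ * m < ∑ l ∈ Finset.Ico j (j + m), g l) = ∅ := by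
          rw [Finset.filter_eq_empty_iff]
          intro j hj
          rw [Finset.mem_Ico] at hj
          have : j = s := by omega
          subst this
          exact hs
        rw [this]
        simp [hg]
    obtain ⟨m, hm0, hmd, hm⟩ := key
    have h1 := ih (d - m) (by omega) (s + m)
    have e : s + m + (d - m) = s + d := by omega
    rw [e] at h1
    have hu : Finset.Ico s (s + d) = Finset.Ico s (s + m) ∪ Finset.Ico (s + m) (s + d) :=
      (Finset.Ico_union_Ico_eq_Ico (by omega) (by omega)).symm
    rw [← Finset.sum_Ico_consecutive g (show s ≤ s + m by omega) (show s + m ≤ s + d by omega)]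
    have hc : ((Finset.Ico s (s + d)).filter
      (fun j => ∃ m, j + m ≤ s + d ∧ θ * m < ∑ l ∈ Finset.Ico j (j + m), g l)).card ≤
      ((Finset.Ico s (s + m)).filter
      (fun j => ∃ m, j + m ≤ s + d ∧ θ * m < ∑ l ∈ Finset.Ico j (j + m), g l)).card +
      ((Finset.Ico (s + m) (s + d)).filter
      (fun j => ∃ m, j + m ≤ s + d ∧ θ * m < ∑ l ∈ Finset.Ico j (j + m), g l)).card := by
      rw [hu, Finset.filter_union]
      exact Finset.card_union_le _ _
    have hc' := mul_le_mul_of_nonneg_left (Nat.cast_le (α := ℝ).2 hc) hθ.le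
    push_cast at hc'
    linarith

open Classical in
/-- The reversed form of `card_forward_average_gt_mul_le`. -/
theorem card_backward_average_gt_mul_le {g : ℕ → ℝ} (hg : ∀ l, 0 ≤ g l) {θ : ℝ} (hθ : 0 < θ)
    (N : ℕ) : θ * (((Finset.Ioc 0 N).filter
      (fun j => ∃ m, m ≤ j ∧ θ * m < ∑ l ∈ Finset.Ico (j - m) j, g l)).card : ℝ)
      ≤ ∑ l ∈ Finset.Ico 0 N, g l := by
  induction N using Nat.strong_induction_on with
  | _ N ih =>
    rcases Nat.eq_zero_or_pos N with rfl | hd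
    · simp
    have key : ∃ m, 0 < m ∧ m ≤ N ∧
        θ * (((Finset.Ioc (N - m) N).filter
          (fun j => ∃ m, m ≤ j ∧ θ * m < ∑ l ∈ Finset.Ico (j - m) j, g l)).card : ℝ)
          ≤ ∑ l ∈ Finset.Ico (N - m) N, g l := by
      by_cases hs : ∃ m, m ≤ N ∧ θ * m < ∑ l ∈ Finset.Ico (N - m) N, g l
      · obtain ⟨m, hm, hlt⟩ := hs
        refine ⟨m, ?_, by omega, ?_⟩
        · rcases Nat.eq_zero_or_pos m with rfl | h
          · simp at hlt
          · exact h
        · refine le_trans ?_ hlt.le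
          refine mul_le_mul_of_nonneg_left ?_ hθ.le
          have := Finset.card_filter_le (Finset.Ioc (N - m) N)
            (fun j => ∃ m, m ≤ j ∧ θ * m < ∑ l ∈ Finset.Ico (j - m) j, g l)
          rw [Nat.card_Ioc] at this
          exact_mod_cast (by omega)
      · refine ⟨1, one_pos, hd, ?_⟩
        have : (Finset.Ioc (N - 1) N).filter
          (fun j => ∃ m, m ≤ j ∧ θ * m < ∑ l ∈ Finset.Ico (j - m) j, g l) = ∅ := by
          rw [Finset.filter_eq_empty_iff]
          intro j hj
          rw [Finset.mem_Ioc] at hj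
          have : j = N := by omega
          subst this
          exact hs
        rw [this]
        simpa using Finset.sum_nonneg (fun i _ => hg i)
    obtain ⟨m, hm0, hmd, hm⟩ := key
    have h1 := ih (N - m) (by omega)
    have hu : Finset.Ioc 0 N = Finset.Ioc 0 (N - m) ∪ Finset.Ioc (N - m) N :=
      (Finset.Ioc_union_Ioc_eq_Ioc (by omega) (by omega)).symm
    rw [← Finset.sum_Ico_consecutive g (show 0 ≤ N - m by omega) (show N - m ≤ N by omega)]
    have hc : ((Finset.Ioc 0 N).filter
      (fun j => ∃ m, m ≤ j ∧ θ * m < ∑ l ∈ Finset.Ico (j - m) j, g l)).card ≤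
      ((Finset.Ioc 0 (N - m)).filter
      (fun j => ∃ m, m ≤ j ∧ θ * m < ∑ l ∈ Finset.Ico (j - m) j, g l)).card +
      ((Finset.Ioc (N - m) N).filter
      (fun j => ∃ m, m ≤ j ∧ θ * m < ∑ l ∈ Finset.Ico (j - m) j, g l)).card := by
      rw [hu, Finset.filter_union]
      exact Finset.card_union_le _ _
    have hc' := mul_le_mul_of_nonneg_left (Nat.cast_le (α := ℝ).2 hc) hθ.le
    push_cast at hc'
    linarith

/-- If the total mass of `g ≥ 0` is small, then there is a central index around which all forward
and backward averages of `g` are small. -/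
theorem exists_central_index {g : ℕ → ℝ} (hg : ∀ l, 0 ≤ g l) {θ : ℝ} (hθ : 0 < θ) {N K : ℕ}
    (hK : 1 ≤ K) (hN : 8 * K ≤ N) (hsum : ∑ l ∈ Finset.Ico 0 N, g l ≤ θ * N / 8) :
    ∃ j, K ≤ j ∧ j + K ≤ N ∧
      (∀ m, j + m ≤ N → ∑ l ∈ Finset.Ico j (j + m), g l ≤ θ * m) ∧
      (∀ m, m ≤ j → ∑ l ∈ Finset.Ico (j - m) j, g l ≤ θ * m) := by
  classical
  by_contra! hcon
  have h1 := card_forward_average_gt_mul_le hg hθ N 0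
  have h2 := card_backward_average_gt_mul_le hg hθ N
  simp only [Nat.zero_add] at h1
  set S1 := (Finset.Ico 0 N).filter
      (fun j => ∃ m, j + m ≤ N ∧ θ * m < ∑ l ∈ Finset.Ico j (j + m), g l)
  set S2 := (Finset.Ioc 0 N).filter
      (fun j => ∃ m, m ≤ j ∧ θ * m < ∑ l ∈ Finset.Ico (j - m) j, g l)
  have hsub : Finset.Icc K (N - K) ⊆ S1 ∪ S2 := by
    intro j hj
    rw [Finset.mem_Icc] at hj
    rw [Finset.mem_union]
    by_cases hf : ∀ m, j + m ≤ N → ∑ l ∈ Finset.Ico j (j + m), g l ≤ θ * m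
    · right
      obtain ⟨m, hm, hlt⟩ := hcon j hj.1 (by omega) hf
      exact Finset.mem_filter.2 ⟨Finset.mem_Ioc.2 ⟨by omega, by omega⟩, m, hm, hlt⟩
    · left
      push Not at hf
      obtain ⟨m, hm, hlt⟩ := hf
      exact Finset.mem_filter.2 ⟨Finset.mem_Ico.2 ⟨by omega, by omega⟩, m, hm, hlt⟩
  have hcard := (Finset.card_le_card hsub).trans (Finset.card_union_le _ _)
  rw [Nat.card_Icc] at hcard
  have hc1 : (S1.card : ℝ) ≤ N / 8 := by
    have := h1.trans hsum
    by_contra! h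
    nlinarith
  have hc2 : (S2.card : ℝ) ≤ N / 8 := by
    have := h2.trans hsum
    by_contra! h
    nlinarith
  have h3 : ((N + 1 : ℕ) : ℝ) ≤ S1.card + S2.card + 2 * K := by
    exact_mod_cast (by omega)
  have h4 : (8 * K : ℝ) ≤ N := by exact_mod_cast hN
  have h5 : (1:ℝ) ≤ K := by exact_mod_cast hK
  push_cast at h3
  linarith

theorem finiteDimensional_continuousAlternatingMap {W : Type*} [NormedAddCommGroup W]
    [NormedSpace ℝ W] [FiniteDimensional ℝ W] (k : ℕ) :
    FiniteDimensional ℝ (W [⋀^Fin k]→L[ℝ] ℝ) := by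
  let b := Module.finBasis ℝ W
  let ev : (W [⋀^Fin k]→L[ℝ] ℝ) →ₗ[ℝ] ((Fin k → Fin (Module.finrank ℝ W)) → ℝ) :=
    { toFun := fun f v => f (fun i => b (v i))
      map_add' := fun f g => by ext; simp
      map_smul' := fun c f => by ext; simp }
  refine FiniteDimensional.of_injective ev ?_
  intro f g hfg
  apply ContinuousAlternatingMap.toAlternatingMap_injective
  refine b.ext_alternating fun v _ => ?_
  exact congrFun hfg v

theorem continuousAlternatingMap_eq_zero_of_finrank_lt {W : Type*} [NormedAddCommGroup W]
    [NormedSpace ℝ W] [FiniteDimensional ℝ W] {k : ℕ} (hk : Module.finrank ℝ W < k)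
    (f : W [⋀^Fin k]→L[ℝ] ℝ) : f = 0 := by
  let b := Module.finBasis ℝ W
  apply ContinuousAlternatingMap.toAlternatingMap_injective
  refine b.ext_alternating fun v hv => ?_
  have := Fintype.card_le_of_injective v hv
  simp at this
  omega

/-- An index around which the growth of a contravariant cocycle is almost maximal on a window of
length `K`. -/
theorem exists_recentered_window {X V : Type*} [NormedAddCommGroup V] [NormedSpace ℝ V]
    {T : ℤ → X → X} {M : ℤ → X → V →L[ℝ] V} {S : Set X}
    (hT0 : ∀ z, T 0 z = z) (hTadd : ∀ i j z, T (i + j) z = T i (T j z))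
    (hTS : ∀ i, ∀ z ∈ S, T i z ∈ S)
    (hM0 : ∀ z, M 0 z = ContinuousLinearMap.id ℝ V)
    (hMadd : ∀ i j z, M (i + j) z = (M j z).comp (M i (T j z)))
    {a d θ : ℝ} (hd : 0 ≤ d) (hθ : 0 < θ) (hdθ : 32 * d ≤ θ)
    (h1 : ∀ z ∈ S, ‖M 1 z‖ ≤ Real.exp (a + d))
    (h2 : ∀ N₀ : ℕ, ∃ N : ℕ, N₀ ≤ N ∧ ∃ z ∈ S, ∃ α : V,
      Real.exp ((a - d) * N) * ‖α‖ < ‖M N z α‖) (K : ℕ) :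
    ∃ z ∈ S, ∃ α : V, ∃ ξ : V →L[ℝ] ℝ, ‖α‖ = 1 ∧ ‖ξ‖ = 1 ∧ ∀ i : ℕ, i ≤ K →
      ‖M (-i) (T i z) α‖ ≤ Real.exp (-(a - θ) * i) ∧
      ‖ξ.comp (M (-i) z)‖ ≤ Real.exp (-(a - θ) * i) ∧
      Real.exp ((a - θ) * i) ≤ ‖ξ.comp (M i z)‖ := by
  obtain ⟨N, hN, z, hz, α, hα⟩ := h2 (8 * (K + 1))
  have hinv : ∀ i z v, M i z (M (-i) (T i z) v) = v := by
    intro i z v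
    have := hMadd (-i) i z
    rw [neg_add_cancel, hM0] at this
    exact (congrArg (fun f => f v) this).symm
  have hinj : ∀ i z v, M i z v = 0 → v = 0 := by
    intro i z v h
    have := hMadd i (-i) (T i z)
    rw [add_neg_cancel, hM0, ← hTadd, neg_add_cancel, hT0] at this
    have h3 := congrArg (fun f => f v) this
    simp only [ContinuousLinearMap.comp_apply, ContinuousLinearMap.id_apply, h, map_zero] at h3
    exact h3
  have hα0 : α ≠ 0 := by
    rintro rfl
    simp at hα
  obtain ⟨ξ, hξ1, hξ⟩ :=
    exists_dual_vector ℝ (M N z α) (norm_ne_zero_iff.2 fun h => hα0 (hinj _ _ _ h))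
  set β : ℕ → V := fun j => M (N - j) (T j z) α with hβ
  set η : ℕ → V →L[ℝ] ℝ := fun j => ξ.comp (M j z) with hη
  have hβ0 : ∀ j, 0 < ‖β j‖ := fun j => norm_pos_iff.2 fun h => hα0 (hinj _ _ _ h)
  have hη0 : ∀ j, 0 < ‖η j‖ := by
    intro j
    rw [norm_pos_iff]
    intro h
    have h3 : ξ = 0 := by
      ext v
      have := congrArg (fun f => f (M (-j) (T j z) v)) h
      simpa [hη, hinv] using this
    rw [h3] at hξ1
    simp at hξ1
  have hβm : ∀ j m : ℕ, β j = M m (T j z) (β (j + m)) := by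
    intro j m
    have := hMadd (N - (j + m)) m (T j z)
    rw [← hTadd, show ((N:ℤ) - (j + m) + m) = N - j by ring, add_comm (m:ℤ) j] at this
    simp only [hβ]
    rw [this]
    rfl
  have hηm : ∀ (j : ℕ) (m : ℤ), ξ.comp (M (m + j) z) = (η j).comp (M m (T j z)) := by
    intro j m
    rw [hMadd]
    rfl
  have hfβ : ∀ l, Real.log ‖β l‖ - Real.log ‖β (l + 1)‖ ≤ a + d := by
    intro l
    rw [← Real.log_div (hβ0 l).ne' (hβ0 _).ne', Real.log_le_iff_le_exp (div_pos (hβ0 _) (hβ0 _)),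
      div_le_iff₀ (hβ0 _), hβm l 1]
    exact (M _ _).le_of_opNorm_le (h1 _ (hTS _ _ hz)) _
  have hfη : ∀ l, Real.log ‖η (l + 1)‖ - Real.log ‖η l‖ ≤ a + d := by
    intro l
    rw [← Real.log_div (hη0 _).ne' (hη0 _).ne', Real.log_le_iff_le_exp (div_pos (hη0 _) (hη0 _)),
      div_le_iff₀ (hη0 _)]
    have := hηm l 1
    rw [add_comm] at this
    calc ‖η (l + 1)‖ = ‖(η l).comp (M 1 (T l z))‖ := by rw [← this]; rfl
      _ ≤ ‖η l‖ * ‖M 1 (T l z)‖ := ContinuousLinearMap.opNorm_comp_le _ _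
      _ ≤ Real.exp (a + d) * ‖η l‖ := by
        rw [mul_comm]
        exact mul_le_mul_of_nonneg_right (h1 _ (hTS _ _ hz)) (norm_nonneg _)
  set g : ℕ → ℝ := fun l => (a + d - (Real.log ‖β l‖ - Real.log ‖β (l + 1)‖)) +
    (a + d - (Real.log ‖η (l + 1)‖ - Real.log ‖η l‖)) with hg
  have hg0 : ∀ l, 0 ≤ g l := fun l => by
    have := hfβ l
    have := hfη l
    simp only [hg]
    linarith
  have hgsum : ∀ s t, s ≤ t → ∑ l ∈ Finset.Ico s t, g l =
      ((a + d) * (t - s) - (Real.log ‖β s‖ - Real.log ‖β t‖)) +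
      ((a + d) * (t - s) - (Real.log ‖η t‖ - Real.log ‖η s‖)) := by
    intro s t hst
    induction t, hst using Nat.le_induction with
    | base => simp
    | succ t hst ih =>
      rw [Finset.sum_Ico_succ_top hst, ih]
      simp only [hg]
      push_cast
      ring
  have hpart : ∀ s t, s ≤ t → (0 ≤ (a + d) * (t - s) - (Real.log ‖β s‖ - Real.log ‖β t‖)) ∧
      0 ≤ ((a + d) * (t - s) - (Real.log ‖η t‖ - Real.log ‖η s‖)) := by
    intro s t hst
    induction t, hst using Nat.le_induction with
    | base => simp
    | succ t hst ih =>
      have := hfβ t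
      have := hfη t
      push_cast
      constructor <;> linarith [ih.1, ih.2]
  have hαn := norm_pos_iff.2 hα0
  have hlog : (a - d) * N + Real.log ‖α‖ ≤ Real.log ‖M N z α‖ := by
    rw [← Real.log_exp ((a - d) * N), ← Real.log_mul (Real.exp_pos _).ne' hαn.ne']
    exact Real.log_le_log (by positivity) hα.le
  have hβ00 : β 0 = M N z α := by simp [hβ, hT0]
  have hβN : β N = α := by simp [hβ, hM0]
  have hη00 : ‖η 0‖ = 1 := by
    have : η 0 = ξ := by ext v; simp [hη, hM0]
    rw [this, hξ1]
  have hηN : Real.log ‖M N z α‖ - Real.log ‖α‖ ≤ Real.log ‖η N‖ := by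
    rw [sub_le_iff_le_add, ← Real.log_mul (hη0 _).ne' hαn.ne']
    refine Real.log_le_log (norm_pos_iff.2 fun h => hα0 (hinj _ _ _ h)) ?_
    have := (η N).le_opNorm α
    simp only [hη, ContinuousLinearMap.comp_apply] at this ⊢
    rw [hξ] at this
    simpa using this
  have htot : ∑ l ∈ Finset.Ico 0 N, g l ≤ θ * N / 8 := by
    rw [hgsum 0 N (Nat.zero_le _), hβ00, hβN, hη00, Real.log_one]
    have hN0 : (0:ℝ) ≤ N := Nat.cast_nonneg _
    have : 32 * d * N ≤ θ * N := mul_le_mul_of_nonneg_right hdθ hN0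
    push_cast
    linarith
  obtain ⟨j, hj1, hj2, hfwd, hbwd⟩ := exists_central_index hg0 hθ (Nat.le_add_left 1 K) hN htot
  refine ⟨T j z, hTS _ _ hz, ‖β j‖⁻¹ • β j, ‖η j‖⁻¹ • η j, ?_, ?_, ?_⟩
  · rw [norm_smul, norm_inv, norm_norm, inv_mul_cancel₀ (hβ0 j).ne']
  · rw [norm_smul, norm_inv, norm_norm, inv_mul_cancel₀ (hη0 j).ne']
  intro i hi
  have hf := hfwd i (by omega)
  rw [hgsum _ _ (Nat.le_add_right _ _)] at hf
  have hf' := hpart j (j + i) (Nat.le_add_right _ _)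
  have hb := hbwd i (by omega)
  rw [hgsum _ _ (Nat.sub_le _ _)] at hb
  have hb' := hpart (j - i) j (Nat.sub_le _ _)
  have hij : ((j - i : ℕ) : ℝ) = j - i := Nat.cast_sub (by omega)
  rw [hij] at hb hb'
  push_cast at hf hf'
  have hdi : 0 ≤ d * i := by positivity
  refine ⟨?_, ?_, ?_⟩
  · have : M (-i) (T i (T j z)) (β j) = β (j + i) := by
      have h4 := hMadd i (-i) (T i (T j z))
      rw [add_neg_cancel, hM0, ← hTadd, ← hTadd, neg_add_cancel_left] at h4
      have h5 := congrArg (fun f => f (β (j + i))) h4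
      simp only [ContinuousLinearMap.comp_apply, ContinuousLinearMap.id_apply] at h5
      rw [hβm j i, ← hTadd]
      exact h5.symm
    rw [map_smul, this, norm_smul, norm_inv, norm_norm, inv_mul_le_iff₀ (hβ0 j),
      ← Real.log_le_log_iff (hβ0 _) (mul_pos (hβ0 _) (Real.exp_pos _)),
      Real.log_mul (hβ0 _).ne' (Real.exp_pos _).ne', Real.log_exp]
    linarith
  · have : (η j).comp (M (-i) (T j z)) = η (j - i) := by
      rw [← hηm]
      simp only [hη]
      rw [Nat.cast_sub (by omega), neg_add_eq_sub]
    rw [ContinuousLinearMap.smul_comp, this, norm_smul, norm_inv, norm_norm,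
      inv_mul_le_iff₀ (hη0 j), ← Real.log_le_log_iff (hη0 _) (mul_pos (hη0 _) (Real.exp_pos _)),
      Real.log_mul (hη0 _).ne' (Real.exp_pos _).ne', Real.log_exp]
    linarith
  · have : (η j).comp (M i (T j z)) = η (j + i) := by
      rw [← hηm]
      simp only [hη]
      rw [add_comm (i:ℤ)]
      push_cast
      rfl
    rw [ContinuousLinearMap.smul_comp, this, norm_smul, norm_inv, norm_norm,
      le_inv_mul_iff₀ (hη0 j), ← Real.log_le_log_iff (mul_pos (hη0 _) (Real.exp_pos _)) (hη0 _),
      Real.log_mul (hη0 _).ne' (Real.exp_pos _).ne', Real.log_exp]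
    linarith

/-- Passing to the limit in `exists_recentered_window`. -/
theorem exists_recentered_limit {X V : Type*} [NormedAddCommGroup V] [NormedSpace ℝ V]
    [FiniteDimensional ℝ V]
    {T : ℤ → X → X} {M : ℤ → X → V →L[ℝ] V} {S : Set X}
    (hT0 : ∀ z, T 0 z = z) (hTadd : ∀ i j z, T (i + j) z = T i (T j z))
    (hTS : ∀ i, ∀ z ∈ S, T i z ∈ S)
    (hM0 : ∀ z, M 0 z = ContinuousLinearMap.id ℝ V)
    (hMadd : ∀ i j z, M (i + j) z = (M j z).comp (M i (T j z)))
    (hcpt : ∀ z : ℕ → X, (∀ N, z N ∈ S) → ∃ ζ ∈ S, ∃ s : ℕ → ℕ, StrictMono s ∧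
      ∀ i j, Tendsto (fun N => M i (T j (z (s N)))) atTop (nhds (M i (T j ζ))))
    {a d θ : ℝ} (hd : 0 ≤ d) (hθ : 0 < θ) (hdθ : 32 * d ≤ θ)
    (h1 : ∀ z ∈ S, ‖M 1 z‖ ≤ Real.exp (a + d))
    (h2 : ∀ N₀ : ℕ, ∃ N : ℕ, N₀ ≤ N ∧ ∃ z ∈ S, ∃ α : V,
      Real.exp ((a - d) * N) * ‖α‖ < ‖M N z α‖) :
    ∃ z ∈ S, ∃ α : V, ∃ ξ : V →L[ℝ] ℝ, ‖α‖ = 1 ∧ ‖ξ‖ = 1 ∧ ∀ i : ℕ,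
      ‖M (-i) (T i z) α‖ ≤ Real.exp (-(a - θ) * i) ∧
      ‖ξ.comp (M (-i) z)‖ ≤ Real.exp (-(a - θ) * i) ∧
      Real.exp ((a - θ) * i) ≤ ‖ξ.comp (M i z)‖ := by
  choose z hz α ξ hα hξ hw using
    exists_recentered_window hT0 hTadd hTS hM0 hMadd hd hθ hdθ h1 h2
  obtain ⟨ζ, hζ, s, hs, hlim⟩ := hcpt z hz
  have : ProperSpace V := FiniteDimensional.proper_real V
  have : ProperSpace (V →L[ℝ] ℝ) := FiniteDimensional.proper_real _
  obtain ⟨p, hp, r, hr, hlim2⟩ := ((isCompact_sphere (0 : V) 1).prod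
    (isCompact_sphere (0 : V →L[ℝ] ℝ) 1)).tendsto_subseq (x := fun N => (α (s N), ξ (s N)))
    (fun N => by simp [hα, hξ])
  have hp1 : ‖p.1‖ = 1 := by simpa using hp.1
  have hp2 : ‖p.2‖ = 1 := by simpa using hp.2
  have l1 : Tendsto (fun N => α (s (r N))) atTop (nhds p.1) :=
    (continuous_fst.tendsto p).comp hlim2
  have l2 : Tendsto (fun N => ξ (s (r N))) atTop (nhds p.2) :=
    (continuous_snd.tendsto p).comp hlim2
  have lM : ∀ i j, Tendsto (fun N => M i (T j (z (s (r N))))) atTop (nhds (M i (T j ζ))) :=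
    fun i j => (hlim i j).comp hr.tendsto_atTop
  have hev : ∀ i : ℕ, ∀ᶠ N in atTop, i ≤ s (r N) := fun i =>
    (hs.tendsto_atTop.comp hr.tendsto_atTop).eventually_ge_atTop i
  have cap : Continuous fun q : (V →L[ℝ] V) × V => q.1 q.2 :=
    continuous_fst.clm_apply continuous_snd
  have ccomp : Continuous fun q : (V →L[ℝ] ℝ) × (V →L[ℝ] V) => q.1.comp q.2 :=
    continuous_fst.clm_comp continuous_snd
  refine ⟨ζ, hζ, p.1, p.2, hp1, hp2, fun i => ⟨?_, ?_, ?_⟩⟩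
  · refine le_of_tendsto ((cap.tendsto _).comp ((lM (-i) i).prodMk_nhds l1)).norm ?_
    filter_upwards [hev i] with N hN using (hw _ i hN).1
  · have := lM (-i) 0
    simp only [hT0] at this
    refine le_of_tendsto ((ccomp.tendsto _).comp (l2.prodMk_nhds this)).norm ?_
    filter_upwards [hev i] with N hN using (hw _ i hN).2.1
  · have := lM i 0
    simp only [hT0] at this
    refine ge_of_tendsto ((ccomp.tendsto _).comp (l2.prodMk_nhds this)).norm ?_
    filter_upwards [hev i] with N hN using (hw _ i hN).2.2

theorem le_of_forall_exp_mul_le {x y D : ℝ}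
    (h : ∀ i : ℕ, Real.exp (x * i) ≤ D * Real.exp (y * i)) : x ≤ y := by
  by_contra! hxy
  have h1 : Tendsto (fun i : ℕ => (x - y) * (i:ℝ)) atTop atTop :=
    tendsto_natCast_atTop_atTop.const_mul_atTop (sub_pos.2 hxy)
  have h2 := (Real.tendsto_exp_atTop.comp h1).eventually_gt_atTop D
  obtain ⟨i, hi⟩ := h2.exists
  have h3 := h i
  simp only [Function.comp] at hi
  have h4 : Real.exp (x * i) = Real.exp ((x - y) * i) * Real.exp (y * i) := by
    rw [← Real.exp_add]; ring_nf
  rw [h4] at h3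
  have := le_of_mul_le_mul_right h3 (Real.exp_pos _)
  linarith

section Wedge

variable {W : Type*} [NormedAddCommGroup W] [NormedSpace ℝ W]

/-- The exterior product of a covector and an alternating form. -/
def covectorWedge {m : ℕ} (τ : W →L[ℝ] ℝ) (β : W [⋀^Fin m]→L[ℝ] ℝ) :
    W [⋀^Fin (m + 1)]→L[ℝ] ℝ :=
  ContinuousAlternatingMap.alternatizeUncurryFin (τ.smulRight β)

theorem covectorWedge_apply {m : ℕ} (τ : W →L[ℝ] ℝ) (β : W [⋀^Fin m]→L[ℝ] ℝ)
    (v : Fin (m + 1) → W) :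
    covectorWedge τ β v = ∑ i : Fin (m + 1), (-1) ^ (i : ℕ) • (τ (v i) * β (i.removeNth v)) := by
  simp [covectorWedge, ContinuousAlternatingMap.alternatizeUncurryFin_apply]

theorem norm_covectorWedge_le {m : ℕ} (τ : W →L[ℝ] ℝ) (β : W [⋀^Fin m]→L[ℝ] ℝ) :
    ‖covectorWedge τ β‖ ≤ (m + 1) * (‖τ‖ * ‖β‖) := by
  have := ContinuousAlternatingMap.norm_alternatizeUncurryFin_le (τ.smulRight β)
  rwa [ContinuousLinearMap.norm_smulRight_apply] at this

theorem covectorWedge_comp {m : ℕ} (τ : W →L[ℝ] ℝ) (β : W [⋀^Fin m]→L[ℝ] ℝ) (A : W →L[ℝ] W) :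
    (covectorWedge τ β).compContinuousLinearMap A =
      covectorWedge (τ.comp A) (β.compContinuousLinearMap A) := by
  ext v
  rw [ContinuousAlternatingMap.compContinuousLinearMap_apply, covectorWedge_apply,
    covectorWedge_apply]
  rfl

theorem covectorWedge_sum_smul {m : ℕ} {ι : Type*} (s : Finset ι) (c : ι → ℝ)
    (τ : ι → W →L[ℝ] ℝ) (β : W [⋀^Fin m]→L[ℝ] ℝ) :
    covectorWedge (∑ j ∈ s, c j • τ j) β = ∑ j ∈ s, c j • covectorWedge (τ j) β := by
  ext v
  simp only [covectorWedge_apply, ContinuousAlternatingMap.sum_apply,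
    ContinuousAlternatingMap.smul_apply, _root_.sum_apply,
    _root_.smul_apply, Finset.smul_sum, Finset.sum_mul]
  rw [Finset.sum_comm]
  refine Finset.sum_congr rfl fun i _ => Finset.sum_congr rfl fun j _ => ?_
  simp only [smul_eq_mul, zsmul_eq_mul]
  ring

variable [FiniteDimensional ℝ W]

theorem sum_covectorWedge_curryLeft {m : ℕ} (ψ : W [⋀^Fin (m + 1)]→L[ℝ] ℝ)
    {ι : Type*} [Fintype ι] (b : Module.Basis ι ℝ W) :
    ∑ j, covectorWedge (LinearMap.toContinuousLinearMap (b.coord j)) (ψ.curryLeft (b j))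
      = ((m : ℝ) + 1) • ψ := by
  have h1 : ψ.curryLeft = ∑ j, (LinearMap.toContinuousLinearMap (b.coord j)).smulRight
      (ψ.curryLeft (b j)) := by
    ext1 v
    conv_lhs => rw [← b.sum_repr v, map_sum]
    simp
  have h2 := ContinuousAlternatingMap.alternatizeUncurryFin_curryLeft ψ
  rw [h1, ← ContinuousAlternatingMap.alternatizeUncurryFinCLM_apply, map_sum] at h2
  simp only [ContinuousAlternatingMap.alternatizeUncurryFinCLM_apply] at h2
  simp only [covectorWedge]
  rw [h2, ← Nat.cast_smul_eq_nsmul ℝ]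
  push_cast
  rfl

/-- The interior product of a functional on `(m + 1)`-forms with an `m`-form. -/
theorem exists_interior_product {m : ℕ} (ξ : (W [⋀^Fin (m + 1)]→L[ℝ] ℝ) →L[ℝ] ℝ)
    (β : W [⋀^Fin m]→L[ℝ] ℝ) : ∃ u : W, ∀ τ : W →L[ℝ] ℝ, τ u = ξ (covectorWedge τ β) := by
  let b := Module.finBasis ℝ W
  refine ⟨∑ j, ξ (covectorWedge (LinearMap.toContinuousLinearMap (b.coord j)) β) • b j,
    fun τ => ?_⟩
  have h1 : τ = ∑ j, τ (b j) • LinearMap.toContinuousLinearMap (b.coord j) := by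
    ext v
    conv_lhs => rw [← b.sum_repr v, map_sum]
    simp [mul_comm]
  conv_rhs => rw [h1]
  rw [covectorWedge_sum_smul]
  simp [mul_comm]

end Wedge

theorem neg_cocycle_comp {X W : Type*} [NormedAddCommGroup W] [NormedSpace ℝ W]
    {T : ℤ → X → X} {A : ℤ → X → W →L[ℝ] W}
    (hA0 : ∀ z, A 0 z = ContinuousLinearMap.id ℝ W)
    (hAadd : ∀ i j z, A (i + j) z = (A i (T j z)).comp (A j z)) (i : ℤ) (z : X) :
    (A (-i) (T i z)).comp (A i z) = ContinuousLinearMap.id ℝ W := by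
  rw [← hAadd, neg_add_cancel, hA0]

theorem compContinuousLinearMap_comp_assoc {W : Type*} [NormedAddCommGroup W] [NormedSpace ℝ W]
    {k : ℕ} (f : W [⋀^Fin k]→L[ℝ] ℝ) (A B : W →L[ℝ] W) :
    (f.compContinuousLinearMap A).compContinuousLinearMap B =
      f.compContinuousLinearMap (A.comp B) := rfl

/-- If some `(m + 1)`-form and some functional grow almost maximally along an orbit while
`(m + 2)`-forms grow strictly slower than expected, then there are a covector and a vector which
contract at a definite rate in opposite time directions and pair nontrivially. -/
theorem exists_contracting_pair {X W : Type*} [NormedAddCommGroup W] [NormedSpace ℝ W]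
    [FiniteDimensional ℝ W]
    {T : ℤ → X → X} {A : ℤ → X → W →L[ℝ] W} {S : Set X}
    (hTS : ∀ i, ∀ z ∈ S, T i z ∈ S)
    (hA0 : ∀ z, A 0 z = ContinuousLinearMap.id ℝ W)
    (hAadd : ∀ i j z, A (i + j) z = (A i (T j z)).comp (A j z))
    {m : ℕ} {C b c r : ℝ} (hC : 0 ≤ C)
    (hgrow : ∀ z ∈ S, ∀ i : ℕ, ‖A i z‖ ≤ C * Real.exp (b * i))
    (hgap : ∀ z ∈ S, ∀ i : ℕ, ∀ ψ : W [⋀^Fin (m + 2)]→L[ℝ] ℝ,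
      ‖ψ.compContinuousLinearMap (A i z)‖ ≤ C * Real.exp (c * i) * ‖ψ‖)
    {ζ : X} (hζ : ζ ∈ S) {α : W [⋀^Fin (m + 1)]→L[ℝ] ℝ} (hα0 : α ≠ 0)
    {ξ : (W [⋀^Fin (m + 1)]→L[ℝ] ℝ) →L[ℝ] ℝ}
    (hα : ∀ i : ℕ, ‖α.compContinuousLinearMap (A (-i) (T i ζ))‖ ≤ Real.exp (-r * i))
    (hξ : ∀ i : ℕ, ‖ξ.comp (ContinuousAlternatingMap.compContinuousLinearMapCLM (A (-i) ζ))‖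
      ≤ Real.exp (-r * i))
    (hξ' : ∀ i : ℕ, Real.exp (r * i) ≤
      ‖ξ.comp (ContinuousAlternatingMap.compContinuousLinearMapCLM (A i ζ))‖)
    (hcr : c + m * b < 2 * r) :
    ∃ (η : W →L[ℝ] ℝ) (u : W) (D : ℝ), η u ≠ 0 ∧ ∀ i : ℕ,
      ‖η.comp (A (-i) (T i ζ))‖ ≤ D * Real.exp (-(r - m * b) * i) ∧
      ‖A (-i) ζ u‖ ≤ D * Real.exp (-(r - m * b) * i) := by
  have hpow : ∀ z ∈ S, ∀ i : ℕ, ∀ β : W [⋀^Fin m]→L[ℝ] ℝ,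
      ‖β.compContinuousLinearMap (A i z)‖ ≤ C ^ m * Real.exp (m * b * i) * ‖β‖ := by
    intro z hz i β
    refine (β.norm_compContinuousLinearMap_le _).trans ?_
    rw [Fintype.card_fin, mul_comm]
    refine mul_le_mul_of_nonneg_right ?_ (norm_nonneg _)
    refine (pow_le_pow_left₀ (norm_nonneg _) (hgrow z hz i) m).trans_eq ?_
    rw [mul_pow, ← Real.exp_nat_mul, mul_assoc]
  -- the interior products contract in backward time
  have hu : ∀ (β : W [⋀^Fin m]→L[ℝ] ℝ) (u : W), (∀ τ : W →L[ℝ] ℝ, τ u = ξ (covectorWedge τ β)) →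
      ∀ i : ℕ, ‖A (-i) ζ u‖ ≤ ((m + 1) * C ^ m * ‖β‖) * Real.exp (-(r - m * b) * i) := by
    intro β u hu i
    refine NormedSpace.norm_le_dual_bound ℝ _ (by positivity) fun τ => ?_
    have h1 : τ (A (-i) ζ u) = ξ (covectorWedge (τ.comp (A (-i) ζ)) β) := hu (τ.comp (A (-i) ζ))
    have h2 : covectorWedge (τ.comp (A (-i) ζ)) β = (covectorWedge τ
        (β.compContinuousLinearMap (A i (T (-i) ζ)))).compContinuousLinearMap (A (-i) ζ) := by
      rw [covectorWedge_comp, compContinuousLinearMap_comp_assoc]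
      have := neg_cocycle_comp hA0 hAadd (-i) ζ
      rw [neg_neg] at this
      rw [this]
      rfl
    rw [h1, h2]
    have h3 := (ξ.comp (ContinuousAlternatingMap.compContinuousLinearMapCLM (A (-i) ζ))).le_opNorm
      (covectorWedge τ (β.compContinuousLinearMap (A i (T (-i) ζ))))
    refine h3.trans ?_
    have h4 := hpow _ (hTS (-i) ζ hζ) i β
    calc _ ≤ Real.exp (-r * i) * ((m + 1) * (‖τ‖ * (C ^ m * Real.exp (m * b * i) * ‖β‖))) := by
          refine mul_le_mul (hξ i) ((norm_covectorWedge_le _ _).trans ?_) (norm_nonneg _)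
            (Real.exp_pos _).le
          gcongr
      _ = _ := by
          rw [show -(r - m * b) * (i:ℝ) = -r * i + m * b * i by ring, Real.exp_add]
          ring
  -- contraction of the covectors
  have hη : ∀ (w : Fin m → W) (η : W →L[ℝ] ℝ), (∀ v, η v = α (Matrix.vecCons v w)) →
      ∀ i : ℕ, ‖η.comp (A (-i) (T i ζ))‖ ≤
        (C ^ m * ∏ j, ‖w j‖) * Real.exp (-(r - m * b) * i) := by
    intro w η hη i
    refine ContinuousLinearMap.opNorm_le_bound _ (by positivity) fun v => ?_
    have h1 : η.comp (A (-i) (T i ζ)) v = (α.compContinuousLinearMap (A (-i) (T i ζ)))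
        (Matrix.vecCons v (fun j => A i ζ (w j))) := by
      rw [ContinuousLinearMap.comp_apply, hη, ContinuousAlternatingMap.compContinuousLinearMap_apply]
      congr 1
      ext j
      refine Fin.cases rfl (fun j => ?_) j
      have := congrArg (fun f => f (w j)) (neg_cocycle_comp hA0 hAadd i ζ)
      simpa using this.symm
    rw [h1]
    refine ((α.compContinuousLinearMap (A (-i) (T i ζ))).le_opNorm _).trans ?_
    rw [Fin.prod_univ_succ]
    simp only [Matrix.cons_val_zero, Matrix.cons_val_succ]
    have h2 : ∏ j, ‖A i ζ (w j)‖ ≤ C ^ m * Real.exp (m * b * i) * ∏ j, ‖w j‖ := by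
      calc ∏ j, ‖A i ζ (w j)‖ ≤ ∏ j, (C * Real.exp (b * i) * ‖w j‖) :=
            Finset.prod_le_prod (fun _ _ => norm_nonneg _)
              fun j _ => (A i ζ).le_of_opNorm_le (hgrow ζ hζ i) _
        _ = _ := by
            rw [Finset.prod_mul_distrib, Finset.prod_const, Finset.card_univ, Fintype.card_fin,
              mul_pow, ← Real.exp_nat_mul, mul_assoc (m:ℝ)]
    calc _ ≤ Real.exp (-r * i) * (‖v‖ * (C ^ m * Real.exp (m * b * i) * ∏ j, ‖w j‖)) := by
          gcongr
          exact hα i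
      _ = _ := by
          rw [show -(r - m * b) * (i:ℝ) = -r * i + m * b * i by ring, Real.exp_add]
          ring
  choose U hU using exists_interior_product ξ
  by_contra hcon
  have hkill : ∀ β w, α (Matrix.vecCons (U β) w) = 0 := by
    intro β w
    by_contra hne
    let η : W →L[ℝ] ℝ := LinearMap.toContinuousLinearMap
      { toFun := fun v => α (Matrix.vecCons v w)
        map_add' := fun x y => congrArg (fun f => f w) (map_add α.curryLeft x y)
        map_smul' := fun x y => congrArg (fun f => f w) (map_smul α.curryLeft x y) }
    have h1 := hη w η (fun v => rfl)
    have h2 := hu β (U β) (hU β)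
    refine hcon ⟨η, U β, max (C ^ m * ∏ j, ‖w j‖) ((m + 1) * C ^ m * ‖β‖), hne, fun i => ⟨?_, ?_⟩⟩
    · exact (h1 i).trans (mul_le_mul_of_nonneg_right (le_max_left _ _) (Real.exp_pos _).le)
    · exact (h2 i).trans (mul_le_mul_of_nonneg_right (le_max_right _ _) (Real.exp_pos _).le)
  obtain ⟨v₀, hv₀⟩ : ∃ v, α v ≠ 0 := by
    by_contra! h
    exact hα0 (ContinuousAlternatingMap.ext h)
  -- vectors killing `α` grow slowly
  have hslow : ∀ β, ∀ i : ℕ, ‖A i ζ (U β)‖ ≤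
      (|α v₀|⁻¹ * C * (m + 2) * ∏ j, ‖v₀ j‖) * Real.exp ((c - r) * i) * ‖U β‖ := by
    intro β i
    refine NormedSpace.norm_le_dual_bound ℝ _ (by positivity) fun τ => ?_
    set ψ := covectorWedge τ (α.compContinuousLinearMap (A (-i) (T i ζ))) with hψ
    have h1 : ψ.compContinuousLinearMap (A i ζ) = covectorWedge (τ.comp (A i ζ)) α := by
      rw [hψ, covectorWedge_comp, compContinuousLinearMap_comp_assoc,
        neg_cocycle_comp hA0 hAadd]
      rfl
    have h2 : covectorWedge (τ.comp (A i ζ)) α (Matrix.vecCons (U β) v₀) =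
        τ (A i ζ (U β)) * α v₀ := by
      rw [covectorWedge_apply, Fin.sum_univ_succ, Finset.sum_eq_zero, add_zero]
      · simp only [Fin.val_zero, pow_zero, one_smul, Matrix.cons_val_zero]
        congr 1
      · intro j _
        have : (j.succ).removeNth (Matrix.vecCons (U β) v₀) =
            Matrix.vecCons (U β) (j.removeNth v₀) := by
          ext k
          refine Fin.cases ?_ (fun k => ?_) k <;> simp [Fin.removeNth]
        rw [this, hkill]
        simp
    have h3 := (ψ.compContinuousLinearMap (A i ζ)).le_opNorm (Matrix.vecCons (U β) v₀)
    rw [h1, h2, Fin.prod_univ_succ] at h3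
    simp only [Matrix.cons_val_zero, Matrix.cons_val_succ] at h3
    rw [norm_mul, ← h1] at h3
    have h4 : ‖ψ‖ ≤ (m + 2) * (‖τ‖ * Real.exp (-r * i)) := by
      refine (norm_covectorWedge_le _ _).trans ?_
      push_cast
      rw [show (m:ℝ) + 1 + 1 = m + 2 by ring]
      gcongr
      exact hα i
    have h5 : ‖ψ.compContinuousLinearMap (A i ζ)‖ ≤
        C * Real.exp (c * i) * ((m + 2) * (‖τ‖ * Real.exp (-r * i))) :=
      (hgap ζ hζ i ψ).trans (by gcongr)
    have h6 : ‖τ (A i ζ (U β))‖ * ‖α v₀‖ ≤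
        C * Real.exp (c * i) * ((m + 2) * (‖τ‖ * Real.exp (-r * i))) *
          (‖U β‖ * ∏ j, ‖v₀ j‖) := h3.trans (by gcongr)
    have h7 : 0 < ‖α v₀‖ := norm_pos_iff.2 hv₀
    rw [← le_div_iff₀ h7] at h6
    refine h6.trans_eq ?_
    rw [show (c - r) * (i:ℝ) = c * i + -r * i by ring, Real.exp_add, Real.norm_eq_abs]
    ring
  let B := Module.finBasis ℝ W
  set D₁ := (|α v₀|⁻¹ * C * (m + 2) * ∏ j, ‖v₀ j‖) with hD₁
  have hD₁0 : 0 ≤ D₁ := by positivity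
  have hUn : ∀ β, ‖U β‖ ≤ (m + 1) * ‖ξ‖ * ‖β‖ := by
    intro β
    refine NormedSpace.norm_le_dual_bound ℝ _ (by positivity) fun τ => ?_
    rw [hU]
    refine (ξ.le_opNorm _).trans ?_
    calc _ ≤ ‖ξ‖ * ((m + 1) * (‖τ‖ * ‖β‖)) := by
          gcongr
          exact norm_covectorWedge_le _ _
      _ = _ := by ring
  set D₂ := ∑ j, ‖LinearMap.toContinuousLinearMap (B.coord j)‖ *
    (D₁ * ((m + 1) * ‖ξ‖ * (C ^ m * ‖B j‖))) with hD₂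
  have hfinal : ∀ i : ℕ, Real.exp (r * i) ≤ D₂ * Real.exp ((c - r + m * b) * i) := by
    intro i
    refine (hξ' i).trans ?_
    refine ContinuousLinearMap.opNorm_le_bound _ ?_ fun ψ => ?_
    · refine mul_nonneg (Finset.sum_nonneg fun j _ => ?_) (Real.exp_pos _).le
      positivity
    have h1 : ((m:ℝ) + 1) * ξ (ψ.compContinuousLinearMap (A i ζ)) =
        ∑ j, LinearMap.toContinuousLinearMap (B.coord j)
          (A i ζ (U ((ψ.curryLeft (B j)).compContinuousLinearMap (A i ζ)))) := by
      have h2 := congrArg (fun f => ξ (ContinuousAlternatingMap.compContinuousLinearMapCLM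
        (A i ζ) f)) (sum_covectorWedge_curryLeft ψ B)
      simp only [map_sum, map_smul] at h2
      rw [smul_eq_mul] at h2
      refine h2.symm.trans (Finset.sum_congr rfl fun j _ => ?_)
      have h3 := hU ((ψ.curryLeft (B j)).compContinuousLinearMap (A i ζ))
        ((LinearMap.toContinuousLinearMap (B.coord j)).comp (A i ζ))
      rw [← covectorWedge_comp] at h3
      exact h3.symm
    have h2 : ‖((m:ℝ) + 1) * ξ (ψ.compContinuousLinearMap (A i ζ))‖ ≤
        D₂ * Real.exp ((c - r + m * b) * i) * ‖ψ‖ := by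
      rw [h1, hD₂, Finset.sum_mul, Finset.sum_mul]
      refine norm_sum_le_of_le _ fun j _ => ?_
      refine (ContinuousLinearMap.le_opNorm _ _).trans ?_
      have h5 : ‖ψ.curryLeft (B j)‖ ≤ ‖ψ‖ * ‖B j‖ := by
        have := ψ.curryLeft.le_opNorm (B j)
        rwa [ContinuousAlternatingMap.norm_curryLeft] at this
      calc _ ≤ ‖LinearMap.toContinuousLinearMap (B.coord j)‖ * (D₁ * Real.exp ((c - r) * i) *
            ((m + 1) * ‖ξ‖ * (C ^ m * Real.exp (m * b * i) * (‖ψ‖ * ‖B j‖)))) := by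
            refine mul_le_mul_of_nonneg_left ?_ (norm_nonneg _)
            refine (hslow _ i).trans ?_
            refine mul_le_mul_of_nonneg_left ?_ (by positivity)
            refine (hUn _).trans ?_
            refine mul_le_mul_of_nonneg_left ?_ (by positivity)
            refine (hpow ζ hζ i _).trans ?_
            gcongr
        _ = _ := by
            rw [show (c - r + m * b) * (i:ℝ) = (c - r) * i + m * b * i by ring, Real.exp_add]
            ring
    refine le_trans ?_ h2
    rw [norm_mul]
    have h3 : (1:ℝ) ≤ ‖(m:ℝ) + 1‖ := by
      rw [Real.norm_of_nonneg (by positivity)]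
      have : (0:ℝ) ≤ m := Nat.cast_nonneg _
      linarith
    exact le_mul_of_one_le_left (norm_nonneg _) h3
  have := le_of_forall_exp_mul_le hfinal
  linarith

/-- A compact linear cocycle over a `ℤ`-action whose optimal uniform exponential growth rate is
`Λ > 0` admits, at some point, a covector and a vector with nonzero pairing which contract in
opposite time directions at almost the rate `Λ`. -/
theorem exists_contracting_pair_of_growth {X W : Type*} [NormedAddCommGroup W] [NormedSpace ℝ W]
    [FiniteDimensional ℝ W]
    {T : ℤ → X → X} {A : ℤ → X → W →L[ℝ] W} {S : Set X}
    (hT0 : ∀ z, T 0 z = z) (hTadd : ∀ i j z, T (i + j) z = T i (T j z))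
    (hTS : ∀ i, ∀ z ∈ S, T i z ∈ S)
    (hA0 : ∀ z, A 0 z = ContinuousLinearMap.id ℝ W)
    (hAadd : ∀ i j z, A (i + j) z = (A i (T j z)).comp (A j z))
    (hcpt : ∀ z : ℕ → X, (∀ N, z N ∈ S) → ∃ ζ ∈ S, ∃ s : ℕ → ℕ, StrictMono s ∧
      ∀ i j, Tendsto (fun N => A i (T j (z (s N)))) atTop (nhds (A i (T j ζ))))
    {Λ ρ : ℝ} (hΛ : 0 < Λ) (hρ : ρ < Λ)
    (hup : ∀ ε > 0, ∃ C, ∀ z ∈ S, ∀ i : ℕ, ‖A i z‖ ≤ C * Real.exp ((Λ + ε) * i))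
    (hlow : ∀ ε > 0, ¬ ∃ C, ∀ z ∈ S, ∀ i : ℕ, ‖A i z‖ ≤ C * Real.exp ((Λ - ε) * i)) :
    ∃ τ : ℕ, 1 ≤ τ ∧ ∃ ζ ∈ S, ∃ (η : W →L[ℝ] ℝ) (u : W) (D : ℝ), η u ≠ 0 ∧ ∀ i : ℕ,
      ‖η.comp (A (-(τ * i)) (T (τ * i) ζ))‖ ≤ D * Real.exp (-(ρ * τ) * i) ∧
      ‖A (-(τ * i)) ζ u‖ ≤ D * Real.exp (-(ρ * τ) * i) := by
  classical
  have hP : ∃ m : ℕ, ∃ γ > 0, ∃ C, ∀ z ∈ S, ∀ i : ℕ, ∀ ψ : W [⋀^Fin (m + 2)]→L[ℝ] ℝ,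
      ‖ψ.compContinuousLinearMap (A i z)‖ ≤ C * Real.exp (((m + 2) * Λ - γ) * i) * ‖ψ‖ := by
    refine ⟨Module.finrank ℝ W, 1, one_pos, 1, fun z _ i ψ => ?_⟩
    have h0 : ψ = 0 := continuousAlternatingMap_eq_zero_of_finrank_lt (by omega) ψ
    have h1 : ψ.compContinuousLinearMap (A i z) = 0 :=
      continuousAlternatingMap_eq_zero_of_finrank_lt (by omega) _
    rw [h1, h0]
    simp
  set m := Nat.find hP with hm
  obtain ⟨γ, hγ, Cg, hgap⟩ := Nat.find_spec hP
  rw [← hm] at hgap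
  have hmin : ∀ γ > 0, ∀ C, ∃ z ∈ S, ∃ i : ℕ, ∃ ψ : W [⋀^Fin (m + 1)]→L[ℝ] ℝ,
      C * Real.exp (((m + 1) * Λ - γ) * i) * ‖ψ‖ < ‖ψ.compContinuousLinearMap (A i z)‖ := by
    intro γ hγ C
    by_contra! hcon
    rcases Nat.eq_zero_or_pos m with h0 | h0
    · refine hlow γ hγ ⟨max C 0, fun z hz i => ?_⟩
      refine ContinuousLinearMap.opNorm_le_bound _ (by positivity) fun v => ?_
      refine NormedSpace.norm_le_dual_bound ℝ _ (by positivity) fun τ => ?_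
      clear_value m
      subst h0
      have h1 := hcon z hz i (ContinuousAlternatingMap.ofSubsingleton ℝ W ℝ (0 : Fin 1) τ)
      have h2 := (((ContinuousAlternatingMap.ofSubsingleton ℝ W ℝ
        (0 : Fin 1) τ)).compContinuousLinearMap (A i z)).le_of_opNorm_le h1 (fun _ => v)
      have h3 : ‖ContinuousAlternatingMap.ofSubsingleton ℝ W ℝ (0 : Fin 1) τ‖ = ‖τ‖ :=
        ContinuousAlternatingMap.norm_ofSubsingleton ..
      rw [h3] at h2
      simp only [CharP.cast_eq_zero, zero_add, one_mul, Finset.univ_unique, Finset.prod_const,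
        Finset.card_singleton, pow_one] at h2
      refine (show ‖τ (A i z v)‖ ≤ _ from h2).trans ?_
      have h4 : C * Real.exp ((Λ - γ) * i) ≤ max C 0 * Real.exp ((Λ - γ) * i) := by
        gcongr
        exact le_max_left _ _
      calc _ ≤ max C 0 * Real.exp ((Λ - γ) * i) * ‖τ‖ * ‖v‖ := by gcongr
        _ = _ := by ring
    · refine Nat.find_min hP (m := m - 1) (by omega) ⟨γ, hγ, C, fun z hz i => ?_⟩
      obtain ⟨q, hq⟩ : ∃ q, m = q + 1 := ⟨m - 1, by omega⟩
      clear_value m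
      subst hq
      intro ψ
      have := hcon z hz i ψ
      push_cast at this
      simp only [Nat.add_sub_cancel]
      rwa [show (q:ℝ) + 1 + 1 = q + 2 by ring] at this
  clear_value m
  clear hm hP
  set δ := min γ (Λ - ρ) / (66 * (m + 1)) with hδ
  have hm1 : (0:ℝ) < m + 1 := by positivity
  have hδ0 : 0 < δ := div_pos (lt_min hγ (sub_pos.2 hρ)) (by positivity)
  have hδm : 66 * (m + 1) * δ = min γ (Λ - ρ) := by
    rw [hδ]; field_simp
  have hδγ : 66 * (m + 1) * δ ≤ γ := hδm.trans_le (min_le_left _ _)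
  have hδρ : 66 * (m + 1) * δ ≤ Λ - ρ := hδm.trans_le (min_le_right _ _)
  obtain ⟨C₀, hC₀⟩ := hup (δ / 2) (half_pos hδ0)
  set C₁ := max C₀ 1 with hC₁
  have hC₁1 : 1 ≤ C₁ := le_max_right _ _
  have hC₁g : ∀ z ∈ S, ∀ i : ℕ, ‖A i z‖ ≤ C₁ * Real.exp ((Λ + δ / 2) * i) := fun z hz i =>
    (hC₀ z hz i).trans (mul_le_mul_of_nonneg_right (le_max_left _ _) (Real.exp_pos _).le)
  have hpull : ∀ z ∈ S, ∀ i : ℕ, ∀ ψ : W [⋀^Fin (m + 1)]→L[ℝ] ℝ,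
      ‖ψ.compContinuousLinearMap (A i z)‖ ≤
        (C₁ * Real.exp ((Λ + δ / 2) * i)) ^ (m + 1) * ‖ψ‖ := by
    intro z hz i ψ
    refine (ψ.norm_compContinuousLinearMap_le _).trans ?_
    rw [Fintype.card_fin, mul_comm]
    gcongr
    exact hC₁g z hz i
  obtain ⟨τ, hτ1, hτ⟩ : ∃ τ : ℕ, 1 ≤ τ ∧ C₁ ≤ Real.exp (δ / 2 * τ) := by
    have h1 : Tendsto (fun i : ℕ => Real.exp (δ / 2 * (i:ℝ))) atTop atTop :=
      Real.tendsto_exp_atTop.comp (tendsto_natCast_atTop_atTop.const_mul_atTop (half_pos hδ0))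
    obtain ⟨τ, h⟩ := ((h1.eventually_ge_atTop C₁).and (eventually_ge_atTop 1)).exists
    exact ⟨τ, h.2, h.1⟩
  have hτ0 : (0:ℝ) < τ := by exact_mod_cast hτ1
  let M : ℤ → X → (W [⋀^Fin (m + 1)]→L[ℝ] ℝ) →L[ℝ] (W [⋀^Fin (m + 1)]→L[ℝ] ℝ) :=
    fun i z => ContinuousAlternatingMap.compContinuousLinearMapCLM (A (τ * i) z)
  have : FiniteDimensional ℝ (W [⋀^Fin (m + 1)]→L[ℝ] ℝ) :=
    finiteDimensional_continuousAlternatingMap _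
  set a := (m + 1) * Λ * τ with ha
  set d := (m + 1) * δ * τ with hd
  have hd0 : 0 < d := by positivity
  have hbig : ∀ N₀ : ℕ, ∃ N : ℕ, N₀ ≤ N ∧ ∃ z ∈ S, ∃ α : W [⋀^Fin (m + 1)]→L[ℝ] ℝ,
      Real.exp ((a - d) * N) * ‖α‖ < ‖M N z α‖ := by
    intro N₀
    set x := (m + 1) * Λ - (m + 1) * δ with hx
    set c₂ := (C₁ * Real.exp ((Λ + δ / 2) * (τ * (N₀ + 1)))) ^ (m + 1) with hc₂
    have hc₂0 : 0 < c₂ := by positivity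
    obtain ⟨z, hz, i, ψ, hψ⟩ := hmin ((m + 1) * δ) (by positivity)
      (c₂ * Real.exp (|x| * (τ * (N₀ + 1))))
    rw [← hx] at hψ
    have hbd : ∀ q : ℕ, q ≤ τ * (N₀ + 1) → ∀ z ∈ S, ∀ ψ : W [⋀^Fin (m + 1)]→L[ℝ] ℝ,
        ‖ψ.compContinuousLinearMap (A q z)‖ ≤ c₂ * ‖ψ‖ := by
      intro q hq z hz ψ
      refine (hpull z hz q ψ).trans ?_
      rw [hc₂]
      have : (q:ℝ) ≤ τ * (N₀ + 1) := by exact_mod_cast hq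
      gcongr
    have hex : ∀ q : ℕ, q ≤ τ * (N₀ + 1) → 1 ≤ Real.exp (|x| * (τ * (N₀ + 1))) *
        Real.exp (x * q) := by
      intro q hq
      rw [← Real.exp_add]
      apply Real.one_le_exp
      have h1 : (q:ℝ) ≤ τ * (N₀ + 1) := by exact_mod_cast hq
      have h2 : |x| * q ≤ |x| * (τ * (N₀ + 1)) := by gcongr
      have h3 : -|x| * q ≤ x * q := by
        gcongr
        exact neg_abs_le x
      linarith
    have hi : τ * (N₀ + 1) < i := by
      by_contra! hi
      have h1 := hbd i hi z hz ψ
      have h2 : c₂ * ‖ψ‖ * 1 ≤ c₂ * ‖ψ‖ * (Real.exp (|x| * (τ * (N₀ + 1))) * Real.exp (x * i)) :=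
        mul_le_mul_of_nonneg_left (hex i hi) (by positivity)
      linarith
    refine ⟨i / τ, ?_, z, hz, ψ.compContinuousLinearMap (A (i % τ : ℕ) (T (τ * (i / τ : ℕ)) z)), ?_⟩
    · rw [Nat.le_div_iff_mul_le (by omega)]
      nlinarith
    have hq : i % τ ≤ τ * (N₀ + 1) := by
      have := Nat.mod_lt i (show 0 < τ by omega)
      nlinarith
    have hmod : ((i % τ : ℕ) : ℤ) + τ * (i / τ : ℕ) = i := by exact_mod_cast Nat.mod_add_div i τ
    have hmodR : ((i % τ : ℕ) : ℝ) + τ * (i / τ : ℕ) = i := by exact_mod_cast Nat.mod_add_div i τ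
    have h1 : M (i / τ : ℕ) z (ψ.compContinuousLinearMap (A (i % τ : ℕ) (T (τ * (i / τ : ℕ)) z))) =
        ψ.compContinuousLinearMap (A i z) := by
      have := hAadd (i % τ : ℕ) (τ * (i / τ : ℕ)) z
      rw [hmod] at this
      rw [this]
      rfl
    rw [h1]
    refine lt_of_le_of_lt ?_ hψ
    have h2 := hbd _ hq (T (τ * (i / τ : ℕ)) z) (hTS _ _ hz) ψ
    calc _ ≤ Real.exp ((a - d) * (i / τ : ℕ)) * (c₂ * ‖ψ‖) :=
          mul_le_mul_of_nonneg_left h2 (Real.exp_pos _).le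
      _ ≤ Real.exp ((a - d) * (i / τ : ℕ)) * (c₂ * ‖ψ‖) *
          (Real.exp (|x| * (τ * (N₀ + 1))) * Real.exp (x * (i % τ : ℕ))) :=
          le_mul_of_one_le_right (by positivity) (hex _ hq)
      _ = _ := by
          have : x * (i:ℝ) = (a - d) * (i / τ : ℕ) + x * (i % τ : ℕ) := by
            rw [← hmodR, hx, ha, hd]
            ring
          rw [this, Real.exp_add]
          ring
  have hM1 : ∀ z ∈ S, ‖M 1 z‖ ≤ Real.exp (a + d) := by
    intro z hz
    refine ContinuousLinearMap.opNorm_le_bound _ (Real.exp_pos _).le fun ψ => ?_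
    have h1 := hpull z hz τ ψ
    have h2 : M 1 z ψ = ψ.compContinuousLinearMap (A τ z) := by
      simp only [M, mul_one]
      rfl
    rw [h2]
    refine h1.trans ?_
    refine mul_le_mul_of_nonneg_right ?_ (norm_nonneg _)
    calc _ ≤ (Real.exp (δ / 2 * τ) * Real.exp ((Λ + δ / 2) * τ)) ^ (m + 1) := by gcongr
      _ = _ := by
        rw [← Real.exp_add, ← Real.exp_nat_mul, ha, hd]
        congr 1
        push_cast
        ring
  obtain ⟨ζ, hζ, α, ξ, hα, hξ, hall⟩ := exists_recentered_limit (T := fun i => T (τ * i)) (M := M)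
    (S := S) (a := a) (d := d) (θ := 32 * d)
    (by simpa using hT0) (fun i j z => by simp only [mul_add, hTadd]) (fun i => hTS _)
    (fun z => by
      simp only [M, mul_zero, hA0]
      rfl)
    (fun i j z => by
      simp only [M, mul_add, hAadd]
      rfl)
    (fun z hz => by
      obtain ⟨ζ, hζ, s, hs, hlim⟩ := hcpt z hz
      exact ⟨ζ, hζ, s, hs, fun i j =>
        (ContinuousAlternatingMap.continuous_compContinuousLinearMapCLM.tendsto _).comp
          (hlim _ _)⟩)
    hd0.le (by positivity) le_rfl hM1 hbig
  obtain ⟨η, u, D, hηu, hD⟩ := exists_contracting_pair (T := fun i => T (τ * i))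
    (A := fun i => A (τ * i)) (S := S) (fun i => hTS _) (by simpa using hA0)
    (fun i j z => by simp only [mul_add, hAadd]) (m := m) (C := max C₁ Cg)
    (b := (Λ + δ / 2) * τ) (c := ((m + 2) * Λ - γ) * τ) (r := a - 32 * d)
    (le_max_of_le_left (by positivity))
    (fun z hz i => by
      have := hC₁g z hz (τ * i)
      push_cast at this
      refine this.trans ?_
      rw [mul_assoc (Λ + δ / 2)]
      gcongr
      exact le_max_left _ _)
    (fun z hz i ψ => by
      have := hgap z hz (τ * i) ψ
      push_cast at this
      refine this.trans ?_
      rw [mul_assoc ((m + 2) * Λ - γ)]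
      gcongr
      exact le_max_right _ _)
    hζ (fun h => by simp [h] at hα) (fun i => (hall i).1) (fun i => (hall i).2.1)
    (fun i => (hall i).2.2)
    (by
      have h1 : (m:ℝ) * (δ / 2) * τ + 64 * d < γ * τ := by
        have h2 : (m * (δ / 2) + 64 * ((m + 1) * δ)) * (τ:ℝ) < γ * τ := by
          refine mul_lt_mul_of_pos_right ?_ hτ0
          nlinarith
        rw [hd]
        linarith
      rw [ha]
      linarith)
  refine ⟨τ, hτ1, ζ, hζ, η, u, max D 0, hηu, fun i => ?_⟩
  have hrate : Real.exp (-(a - 32 * d - m * ((Λ + δ / 2) * τ)) * i) ≤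
      Real.exp (-(ρ * τ) * i) := by
    apply Real.exp_le_exp.2
    refine mul_le_mul_of_nonneg_right ?_ (Nat.cast_nonneg _)
    have h2 : ρ * τ ≤ (Λ - 32 * ((m + 1) * δ) - m * (δ / 2)) * (τ:ℝ) := by
      refine mul_le_mul_of_nonneg_right ?_ hτ0.le
      nlinarith
    rw [ha, hd]
    linarith
  have hfin : D * Real.exp (-(a - 32 * d - m * ((Λ + δ / 2) * τ)) * i) ≤
      max D 0 * Real.exp (-(ρ * τ) * i) :=
    mul_le_mul (le_max_left _ _) hrate (Real.exp_pos _).le (le_max_right _ _)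
  have hDi := hD i
  simp only [mul_neg] at hDi
  exact ⟨hDi.1.trans hfin, hDi.2.trans hfin⟩

theorem gronwallBound_le {δ K ε x : ℝ} (hK : 0 ≤ K) (hε : 0 ≤ ε) :
    gronwallBound δ K ε x ≤ (δ + ε * x) * Real.exp (K * x) := by
  rcases hK.eq_or_lt with rfl | hK
  · simp [gronwallBound_K0]
  · rw [gronwallBound_of_K_ne_0 hK.ne']
    have h1 : Real.exp (K * x) - 1 ≤ K * x * Real.exp (K * x) := by
      have h2 := Real.add_one_le_exp (-(K * x))
      have h3 : Real.exp (-(K * x)) * Real.exp (K * x) = 1 := by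
        rw [← Real.exp_add]; simp
      nlinarith [Real.exp_pos (K * x)]
    have h2 : ε / K * (Real.exp (K * x) - 1) ≤ ε / K * (K * x * Real.exp (K * x)) := by
      gcongr
    have h3 : ε / K * (K * x * Real.exp (K * x)) = ε * x * Real.exp (K * x) := by
      field_simp
    simp only
    linarith

/-- A two-sided Grönwall inequality. -/
theorem norm_le_of_norm_deriv_le {V : Type*} [NormedAddCommGroup V] [NormedSpace ℝ V]
    {y y' : ℝ → V} {L ε T : ℝ} (hL : 0 ≤ L) (hε : 0 ≤ ε)
    (hy : ∀ t, HasDerivAt y (y' t) t) (hb : ∀ t, |t| ≤ T → ‖y' t‖ ≤ L * ‖y t‖ + ε) {t : ℝ}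
    (ht : |t| ≤ T) : ‖y t‖ ≤ (‖y 0‖ + ε * T) * Real.exp (L * T) := by
  have key : ∀ (y y' : ℝ → V), (∀ t, HasDerivAt y (y' t) t) →
      (∀ t, |t| ≤ T → ‖y' t‖ ≤ L * ‖y t‖ + ε) → ∀ t, 0 ≤ t → t ≤ T →
      ‖y t‖ ≤ (‖y 0‖ + ε * T) * Real.exp (L * T) := by
    intro y y' hy hb t h0 hT
    have h1 := norm_le_gronwallBound_of_norm_deriv_right_le (f := y) (f' := y') (a := 0) (b := T)
      (δ := ‖y 0‖) (K := L) (ε := ε)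
      (fun s _ => (hy s).continuousAt.continuousWithinAt) (fun s _ => (hy s).hasDerivWithinAt)
      le_rfl (fun s hs => hb s (by rw [abs_of_nonneg hs.1]; exact hs.2.le)) t ⟨h0, hT⟩
    rw [sub_zero] at h1
    have hT0 : 0 ≤ T := h0.trans hT
    refine h1.trans ((gronwallBound_le hL hε).trans ?_)
    gcongr
  rcases le_total 0 t with h | h
  · exact key y y' hy hb t h (by rwa [abs_of_nonneg h] at ht)
  · have h1 := key (fun s => y (-s)) (fun s => -y' (-s))
      (fun s => by
        have := (hy (-s)).scomp s (hasDerivAt_neg s)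
        simpa [Function.comp_def] using this)
      (fun s hs => by rw [norm_neg]; exact hb (-s) (by rwa [abs_neg])) (-t) (by linarith)
      (by rwa [abs_of_nonpos h] at ht)
    simpa using h1

/-- Uniform first and second order bounds of a map on a region. -/
structure FieldBounds {V G : Type*} [NormedAddCommGroup V] [NormedSpace ℝ V]
    [NormedAddCommGroup G] [NormedSpace ℝ G] (f : V → G)
    (Df : V → V →L[ℝ] G) (S : Set V) (L M : ℝ) : Prop where
  L_nonneg : 0 ≤ L
  M_nonneg : 0 ≤ M
  lip : ∀ a ∈ S, ∀ b ∈ S, ‖f b - f a‖ ≤ L * ‖b - a‖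
  norm_le : ∀ a ∈ S, ‖Df a‖ ≤ L
  quad : ∀ a ∈ S, ∀ b ∈ S, ‖f b - f a - Df a (b - a)‖ ≤ M * ‖b - a‖ ^ 2

section Trajectories

variable {V : Type*} [NormedAddCommGroup V] [NormedSpace ℝ V] {f : V → V}
  {Df : V → V →L[ℝ] V} {S : Set V} {L M : ℝ}

theorem FieldBounds.norm_sub_le (h : FieldBounds f Df S L M) {γ₁ γ₂ : ℝ → V}
    (h₁ : ∀ t, HasDerivAt γ₁ (f (γ₁ t)) t) (h₂ : ∀ t, HasDerivAt γ₂ (f (γ₂ t)) t)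
    (hS₁ : ∀ t, γ₁ t ∈ S) (hS₂ : ∀ t, γ₂ t ∈ S) {t T : ℝ} (ht : |t| ≤ T) :
    ‖γ₁ t - γ₂ t‖ ≤ ‖γ₁ 0 - γ₂ 0‖ * Real.exp (L * T) := by
  have := norm_le_of_norm_deriv_le h.L_nonneg le_rfl (fun t => (h₁ t).sub (h₂ t))
    (T := T) (fun s _ => by
      simpa using h.lip _ (hS₂ s) _ (hS₁ s)) ht
  simpa using this

theorem FieldBounds.norm_comb_le (h : FieldBounds f Df S L M) {γ₀ γ₁ γ₂ γ₃ : ℝ → V}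
    (h₀ : ∀ t, HasDerivAt γ₀ (f (γ₀ t)) t)
    (h₁ : ∀ t, HasDerivAt γ₁ (f (γ₁ t)) t) (h₂ : ∀ t, HasDerivAt γ₂ (f (γ₂ t)) t)
    (h₃ : ∀ t, HasDerivAt γ₃ (f (γ₃ t)) t) (hS₀ : ∀ t, γ₀ t ∈ S)
    (hS₁ : ∀ t, γ₁ t ∈ S) (hS₂ : ∀ t, γ₂ t ∈ S) (hS₃ : ∀ t, γ₃ t ∈ S) {a b c : ℝ}
    (hz : a • (γ₁ 0 - γ₀ 0) + b • (γ₂ 0 - γ₀ 0) + c • (γ₃ 0 - γ₀ 0) = 0) {t T : ℝ}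
    (ht : |t| ≤ T) :
    ‖a • (γ₁ t - γ₀ t) + b • (γ₂ t - γ₀ t) + c • (γ₃ t - γ₀ t)‖ ≤
      (M * Real.exp (L * T) ^ 2 * T * Real.exp (L * T)) * (|a| * ‖γ₁ 0 - γ₀ 0‖ ^ 2 +
        |b| * ‖γ₂ 0 - γ₀ 0‖ ^ 2 + |c| * ‖γ₃ 0 - γ₀ 0‖ ^ 2) := by
  set Q := |a| * ‖γ₁ 0 - γ₀ 0‖ ^ 2 + |b| * ‖γ₂ 0 - γ₀ 0‖ ^ 2 + |c| * ‖γ₃ 0 - γ₀ 0‖ ^ 2 with hQ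
  have hM := h.M_nonneg
  have hQ0 : 0 ≤ Q := by positivity
  have one : ∀ γ : ℝ → V, (∀ t, HasDerivAt γ (f (γ t)) t) → (∀ t, γ t ∈ S) → ∀ s, |s| ≤ T →
      ‖f (γ s) - f (γ₀ s) - Df (γ₀ s) (γ s - γ₀ s)‖ ≤
        M * Real.exp (L * T) ^ 2 * ‖γ 0 - γ₀ 0‖ ^ 2 := by
    intro γ hγ hγS s hs
    refine (h.quad _ (hS₀ s) _ (hγS s)).trans ?_
    have := h.norm_sub_le hγ h₀ hγS hS₀ hs
    calc M * ‖γ s - γ₀ s‖ ^ 2 ≤ M * (‖γ 0 - γ₀ 0‖ * Real.exp (L * T)) ^ 2 := by gcongr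
      _ = _ := by ring
  have := norm_le_of_norm_deriv_le (ε := M * Real.exp (L * T) ^ 2 * Q) h.L_nonneg (by positivity)
    (fun t => ((((h₁ t).sub (h₀ t)).const_smul a).add
      (((h₂ t).sub (h₀ t)).const_smul b)).add (((h₃ t).sub (h₀ t)).const_smul c))
    (T := T) (fun s hs => by
      simp only [Pi.add_apply, Pi.sub_apply, Pi.smul_apply]
      have e : a • (f (γ₁ s) - f (γ₀ s)) + b • (f (γ₂ s) - f (γ₀ s)) + c • (f (γ₃ s) - f (γ₀ s))
          = Df (γ₀ s) (a • (γ₁ s - γ₀ s) + b • (γ₂ s - γ₀ s) + c • (γ₃ s - γ₀ s)) +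
            (a • (f (γ₁ s) - f (γ₀ s) - Df (γ₀ s) (γ₁ s - γ₀ s)) +
            b • (f (γ₂ s) - f (γ₀ s) - Df (γ₀ s) (γ₂ s - γ₀ s)) +
            c • (f (γ₃ s) - f (γ₀ s) - Df (γ₀ s) (γ₃ s - γ₀ s))) := by
        rw [map_add, map_add, map_smul, map_smul, map_smul]
        module
      rw [e]
      refine (norm_add_le _ _).trans (add_le_add ?_ ?_)
      · exact (ContinuousLinearMap.le_opNorm _ _).trans (by gcongr; exact h.norm_le _ (hS₀ s))
      · refine norm_add₃_le.trans ?_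
        simp only [norm_smul, Real.norm_eq_abs]
        rw [hQ, mul_add, mul_add]
        refine add_le_add (add_le_add ?_ ?_) ?_
        · have := one γ₁ h₁ hS₁ s hs
          calc _ ≤ |a| * (M * Real.exp (L * T) ^ 2 * ‖γ₁ 0 - γ₀ 0‖ ^ 2) := by gcongr
            _ = _ := by ring
        · have := one γ₂ h₂ hS₂ s hs
          calc _ ≤ |b| * (M * Real.exp (L * T) ^ 2 * ‖γ₂ 0 - γ₀ 0‖ ^ 2) := by gcongr
            _ = _ := by ring
        · have := one γ₃ h₃ hS₃ s hs
          calc _ ≤ |c| * (M * Real.exp (L * T) ^ 2 * ‖γ₃ 0 - γ₀ 0‖ ^ 2) := by gcongr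
            _ = _ := by ring) ht
  simp only [Pi.add_apply, Pi.sub_apply, Pi.smul_apply] at this
  rw [hz, norm_zero, zero_add] at this
  refine this.trans (le_of_eq ?_)
  ring

end Trajectories

/-- A map which is linear up to quadratic errors is approximated by a linear map up to a
quadratic error. -/
theorem exists_linear_approx {V W : Type*} [NormedAddCommGroup V] [NormedSpace ℝ V]
    [FiniteDimensional ℝ V] [NormedAddCommGroup W] [NormedSpace ℝ W] [FiniteDimensional ℝ W]
    {Δ : V → W} {C K : ℝ} (hlip : ∀ v, ‖v‖ ≤ 1 → ‖Δ v‖ ≤ K * ‖v‖)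
    (hlin : ∀ (a b c : ℝ) (u v w : V), ‖u‖ ≤ 1 → ‖v‖ ≤ 1 → ‖w‖ ≤ 1 →
      a • u + b • v + c • w = 0 → ‖a • Δ u + b • Δ v + c • Δ w‖ ≤
        C * (|a| * ‖u‖ ^ 2 + |b| * ‖v‖ ^ 2 + |c| * ‖w‖ ^ 2)) :
    ∃ A : V →L[ℝ] W, ∀ v, ‖v‖ ≤ 1 → ‖Δ v - A v‖ ≤ C * ‖v‖ ^ 2 := by
  have : ProperSpace W := FiniteDimensional.proper ℝ W
  have small : ∀ v : V, ∀ᶠ s in nhdsWithin (0 : ℝ) (Set.Ioi 0), ‖s • v‖ ≤ 1 := by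
    intro v
    have h1 : Tendsto (fun s : ℝ => ‖s • v‖) (nhdsWithin (0 : ℝ) (Set.Ioi 0)) (nhds 0) := by
      have : Continuous fun s : ℝ => ‖s • v‖ := by fun_prop
      have h2 := this.tendsto 0
      simp only [zero_smul, norm_zero] at h2
      exact h2.mono_left nhdsWithin_le_nhds
    exact (h1.eventually (gt_mem_nhds (zero_lt_one' ℝ))).mono fun s hs => hs.le
  let 𝒰 : Ultrafilter ℝ := Ultrafilter.of (nhdsWithin (0 : ℝ) (Set.Ioi 0))
  have hU : (𝒰 : Filter ℝ) ≤ nhdsWithin (0 : ℝ) (Set.Ioi 0) := Ultrafilter.of_le _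
  have hpos : ∀ᶠ s in (𝒰 : Filter ℝ), 0 < s := hU self_mem_nhdsWithin
  have hs0 : Tendsto (fun s : ℝ => s) (𝒰 : Filter ℝ) (nhds 0) :=
    hU.trans nhdsWithin_le_nhds
  have ex : ∀ v : V, ∃ w : W, Tendsto (fun s : ℝ => s⁻¹ • Δ (s • v)) (𝒰 : Filter ℝ) (nhds w) := by
    intro v
    have h1 : ∀ᶠ s in (𝒰 : Filter ℝ), s⁻¹ • Δ (s • v) ∈ Metric.closedBall (0 : W) (K * ‖v‖) := by
      filter_upwards [hpos, hU (small v)] with s hs hv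
      rw [mem_closedBall_zero_iff, norm_smul, norm_inv, Real.norm_of_nonneg hs.le]
      have := hlip _ hv
      rw [norm_smul, Real.norm_of_nonneg hs.le] at this
      calc s⁻¹ * ‖Δ (s • v)‖ ≤ s⁻¹ * (K * (s * ‖v‖)) := by gcongr
        _ = K * ‖v‖ := by field_simp
    obtain ⟨w, -, hw⟩ := (isCompact_closedBall (0 : W) (K * ‖v‖)).ultrafilter_le_nhds
      (𝒰.map fun s : ℝ => s⁻¹ • Δ (s • v)) (by rw [le_principal_iff]; exact h1)
    exact ⟨w, hw⟩
  choose A hA using ex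
  have comb : ∀ (a b c : ℝ) (u v w : V), a • u + b • v + c • w = 0 →
      a • A u + b • A v + c • A w = 0 := by
    intro a b c u v w h
    have h1 : Tendsto (fun s : ℝ => a • s⁻¹ • Δ (s • u) + b • s⁻¹ • Δ (s • v) +
        c • s⁻¹ • Δ (s • w)) (𝒰 : Filter ℝ) (nhds (a • A u + b • A v + c • A w)) :=
      (((hA u).const_smul a).add ((hA v).const_smul b)).add ((hA w).const_smul c)
    have h2 : Tendsto (fun s : ℝ => a • s⁻¹ • Δ (s • u) + b • s⁻¹ • Δ (s • v) +
        c • s⁻¹ • Δ (s • w)) (𝒰 : Filter ℝ) (nhds 0) := by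
      refine squeeze_zero_norm' (a := fun s => s * (C * (|a| * ‖u‖ ^ 2 + |b| * ‖v‖ ^ 2 +
        |c| * ‖w‖ ^ 2))) ?_ (by simpa using hs0.mul_const _)
      filter_upwards [hpos, hU (small u), hU (small v), hU (small w)] with s hs hu hv hw
      have h3 := hlin a b c (s • u) (s • v) (s • w) hu hv hw (by
        rw [smul_comm a, smul_comm b, smul_comm c, ← smul_add, ← smul_add, h, smul_zero])
      have h4 : a • s⁻¹ • Δ (s • u) + b • s⁻¹ • Δ (s • v) + c • s⁻¹ • Δ (s • w) =
          s⁻¹ • (a • Δ (s • u) + b • Δ (s • v) + c • Δ (s • w)) := by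
        rw [smul_comm a, smul_comm b, smul_comm c, ← smul_add, ← smul_add]
      rw [h4, norm_smul, norm_inv, Real.norm_of_nonneg hs.le]
      simp only [norm_smul, Real.norm_of_nonneg hs.le] at h3
      calc _ ≤ s⁻¹ * (C * (|a| * (s * ‖u‖) ^ 2 + |b| * (s * ‖v‖) ^ 2 + |c| * (s * ‖w‖) ^ 2)) := by
            gcongr
        _ = _ := by field_simp
    exact tendsto_nhds_unique h1 h2
  have approx : ∀ v, ‖v‖ ≤ 1 → ‖Δ v - A v‖ ≤ C * ‖v‖ ^ 2 := by
    intro v hv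
    have h1 : Tendsto (fun s : ℝ => ‖Δ v - s⁻¹ • Δ (s • v)‖) (𝒰 : Filter ℝ)
        (nhds ‖Δ v - A v‖) := (tendsto_const_nhds.sub (hA v)).norm
    have h2 : Tendsto (fun s : ℝ => C * (‖v‖ ^ 2 + s * ‖v‖ ^ 2)) (𝒰 : Filter ℝ)
        (nhds (C * ‖v‖ ^ 2)) := by
      simpa using (((hs0.mul_const (‖v‖ ^ 2)).const_add (‖v‖ ^ 2)).const_mul C)
    refine le_of_tendsto_of_tendsto h1 h2 ?_
    filter_upwards [hpos, hU (small v)] with s hs hs1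
    have h3 := hlin 1 (-s⁻¹) 0 v (s • v) 0 hv hs1 (by simp) (by simp [smul_smul, hs.ne'])
    simp only [one_smul, zero_smul, add_zero, neg_smul, ← sub_eq_add_neg, abs_one, one_mul,
      abs_neg, abs_inv, abs_of_pos hs, abs_zero, zero_mul, norm_smul, Real.norm_of_nonneg hs.le]
      at h3
    refine h3.trans (le_of_eq ?_)
    field_simp
  let Al : V →ₗ[ℝ] W :=
    { toFun := A
      map_add' := fun u v => by
        have := comb 1 1 (-1) u v (u + v) (by module)
        simp only [one_smul, neg_smul] at this
        exact (eq_of_sub_eq_zero (by rw [sub_eq_add_neg]; exact this)).symm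
      map_smul' := fun r v => by
        have := comb r (-1) 0 v (r • v) 0 (by simp)
        simp only [one_smul, neg_smul, zero_smul, add_zero] at this
        exact (eq_of_sub_eq_zero (by rw [sub_eq_add_neg]; exact this)).symm }
  exact ⟨LinearMap.toContinuousLinearMap Al, fun v hv => approx v hv⟩

theorem hasFDerivAt_of_quadratic {V W : Type*} [NormedAddCommGroup V] [NormedSpace ℝ V]
    [NormedAddCommGroup W] [NormedSpace ℝ W] {g : V → W} {A : V →L[ℝ] W} {z : V} {C : ℝ}
    (h : ∀ v, ‖v‖ ≤ 1 → ‖g (z + v) - g z - A v‖ ≤ C * ‖v‖ ^ 2) : HasFDerivAt g A z := by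
  rw [hasFDerivAt_iff_isLittleO_nhds_zero]
  refine Asymptotics.IsBigO.trans_isLittleO (g := fun v : V => ‖v‖ ^ 2) ?_ ?_
  · refine Asymptotics.IsBigO.of_bound C ?_
    filter_upwards [Metric.ball_mem_nhds (0 : V) one_pos] with v hv
    rw [mem_ball_zero_iff] at hv
    simpa using h v hv.le
  · exact Asymptotics.isLittleO_norm_pow_id one_lt_two

section

variable {n : ℕ}

/-- The euclidean pairing as a continuous bilinear map. -/
def dotL (n : ℕ) : E n →L[ℝ] E n →L[ℝ] ℝ :=
  ∑ i, ContinuousLinearMap.smulRight (ContinuousLinearMap.proj (R := ℝ) (φ := fun _ => ℝ) i)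
    (ContinuousLinearMap.proj (R := ℝ) (φ := fun _ : Fin n => ℝ) i)

@[simp] theorem dotL_apply (a b : E n) : dotL n a b = dotP n a b := by
  simp [dotL, dotP, _root_.sum_apply]

/-- The standard symplectic form as a continuous bilinear map. -/
def omegaL (n : ℕ) : (E n × E n) →L[ℝ] (E n × E n) →L[ℝ] ℝ :=
  (dotL n).bilinearComp (ContinuousLinearMap.snd ℝ (E n) (E n))
      (ContinuousLinearMap.fst ℝ (E n) (E n)) -
    (dotL n).bilinearComp (ContinuousLinearMap.fst ℝ (E n) (E n))
      (ContinuousLinearMap.snd ℝ (E n) (E n))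

@[simp] theorem omegaL_apply (v w : E n × E n) : omegaL n v w = omega0 n v w := by
  simp [omegaL, omega0]

theorem dotP_comm (a b : E n) : dotP n a b = dotP n b a := by
  simp [dotP, mul_comm]

theorem omega0_swap (v w : E n × E n) : omega0 n v w = -omega0 n w v := by
  simp only [omega0, dotP_comm w.1, dotP_comm w.2]; ring

theorem omega0_self (v : E n × E n) : omega0 n v v = 0 := by
  have := omega0_swap v v
  linarith

theorem clm_eq_dotP (ℓ : E n →L[ℝ] ℝ) (a : E n) :
    ℓ a = dotP n (fun i => ℓ (Pi.single i 1)) a := by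
  conv_lhs => rw [← Finset.univ_sum_single a]
  rw [map_sum]
  refine Finset.sum_congr rfl fun i _ => ?_
  have : (Pi.single i (a i) : E n) = a i • (Pi.single i 1 : E n) := by
    rw [← Pi.single_smul, smul_eq_mul, mul_one]
  rw [this, map_smul, smul_eq_mul, mul_comm]

/-- The isomorphism from covectors to vectors given by the symplectic form. -/
def sharp (n : ℕ) : ((E n × E n) →L[ℝ] ℝ) →L[ℝ] E n × E n :=
  (ContinuousLinearMap.pi fun i =>
      ContinuousLinearMap.apply ℝ ℝ ((0, Pi.single i 1) : E n × E n)).prod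
    (-ContinuousLinearMap.pi fun i =>
      ContinuousLinearMap.apply ℝ ℝ ((Pi.single i 1, 0) : E n × E n))

theorem omega0_sharp (ℓ : (E n × E n) →L[ℝ] ℝ) (v : E n × E n) :
    omega0 n v (sharp n ℓ) = ℓ v := by
  have h : v = (v.1, 0) + (0, v.2) := by simp
  have h1 := clm_eq_dotP (ℓ.comp (ContinuousLinearMap.inl ℝ (E n) (E n))) v.1
  have h2 := clm_eq_dotP (ℓ.comp (ContinuousLinearMap.inr ℝ (E n) (E n))) v.2
  conv_rhs => rw [h, map_add]
  simp only [ContinuousLinearMap.comp_apply, ContinuousLinearMap.inl_apply,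
    ContinuousLinearMap.inr_apply] at h1 h2
  rw [h1, h2]
  simp only [omega0, sharp, dotP, ContinuousLinearMap.prod_apply, ContinuousLinearMap.coe_pi',
    ContinuousLinearMap.apply_apply, neg_apply, Pi.neg_apply, mul_neg, Finset.sum_neg_distrib]
  simp only [mul_comm]
  ring

theorem omega0_nondeg {v w : E n × E n} (h : ∀ u, omega0 n u v = omega0 n u w) : v = w := by
  have h1 : ∀ i, v.1 i = w.1 i := fun i => by
    have := h (0, Pi.single i 1)
    simpa [omega0, dotP, Pi.single_apply] using this
  have h2 : ∀ i, v.2 i = w.2 i := fun i => by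
    have := h (Pi.single i 1, 0)
    simpa [omega0, dotP, Pi.single_apply] using this
  exact Prod.ext (funext h1) (funext h2)

/-! ### Periodicity and compactness -/

theorem exists_intVec_add_mem (x : E n) : ∃ m : Fin n → ℤ, ‖x + intVec m‖ ≤ 1 := by
  refine ⟨fun i => -⌊x i⌋, ?_⟩
  rw [pi_norm_le_iff_of_nonneg zero_le_one]
  intro i
  have h0 := Int.floor_le (x i)
  have h1 := Int.lt_floor_add_one (x i)
  simp only [Pi.add_apply, intVec, Int.cast_neg, Real.norm_eq_abs, abs_le]
  constructor <;> linarith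

/-- Invariance under integral translations of the base. -/
def Periodic {G : Type*} (g : E n × E n → G) : Prop :=
  ∀ (z : E n × E n) (m : Fin n → ℤ), g (z + (intVec m, 0)) = g z

theorem Periodic.fderiv {G : Type*} [NormedAddCommGroup G] [NormedSpace ℝ G]
    {g : E n × E n → G} (hg : Periodic g) : Periodic (fderiv ℝ g) := by
  intro z m
  rw [← fderiv_comp_add_right]
  congr 1
  ext1 w
  exact hg w m

/-- The region of momenta bounded by `R`. -/
def slab (n : ℕ) (R : ℝ) : Set (E n × E n) := {z | ‖z.2‖ ≤ R}

theorem convex_slab (R : ℝ) : Convex ℝ (slab n R) := by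
  have h : slab n R = LinearMap.snd ℝ (E n) (E n) ⁻¹' Metric.closedBall 0 R := by
    ext z; simp [slab]
  rw [h]
  exact (convex_closedBall _ _).linear_preimage _

theorem exists_translate_mem (z : E n × E n) {R : ℝ} (hz : z ∈ slab n R) :
    ∃ m : Fin n → ℤ, z + (intVec m, 0) ∈
      (Metric.closedBall 0 1 ×ˢ Metric.closedBall 0 R : Set (E n × E n)) := by
  obtain ⟨m, hm⟩ := exists_intVec_add_mem z.1
  exact ⟨m, by simpa using hm, by simpa [slab] using hz⟩

theorem isCompact_box (R : ℝ) : IsCompact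
    (Metric.closedBall 0 1 ×ˢ Metric.closedBall 0 R : Set (E n × E n)) :=
  (isCompact_closedBall _ _).prod (isCompact_closedBall _ _)

theorem Periodic.exists_bound {G : Type*} [SeminormedAddCommGroup G] {g : E n × E n → G}
    (hg : Periodic g) (hc : Continuous g) (R : ℝ) : ∃ C, 0 ≤ C ∧ ∀ z ∈ slab n R, ‖g z‖ ≤ C := by
  obtain ⟨C, hC⟩ := (isCompact_box (n := n) R).exists_bound_of_continuousOn hc.continuousOn
  refine ⟨max C 0, le_max_right _ _, fun z hz => ?_⟩
  obtain ⟨m, hm⟩ := exists_translate_mem z hz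
  rw [← hg z m]
  exact (hC _ hm).trans (le_max_left _ _)

theorem exists_tendsto_translate {R : ℝ} {z : ℕ → E n × E n} (hz : ∀ k, z k ∈ slab n R) :
    ∃ ζ ∈ slab n R, ∃ m : ℕ → Fin n → ℤ, ∃ s : ℕ → ℕ, StrictMono s ∧
      Tendsto (fun k => z (s k) + (intVec (m (s k)), 0)) atTop (nhds ζ) := by
  choose m hm using fun k => exists_translate_mem (z k) (hz k)
  obtain ⟨ζ, hζ, s, hs, ht⟩ := (isCompact_box (n := n) R).tendsto_subseq hm
  exact ⟨ζ, by simpa [slab] using hζ.2, m, s, hs, ht⟩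

theorem Periodic.exists_fieldBounds {G : Type*} [NormedAddCommGroup G] [NormedSpace ℝ G]
    {g : E n × E n → G} (hg : Periodic g)
    (hc : ContDiff ℝ 2 g) (R : ℝ) :
    ∃ L M, FieldBounds g (_root_.fderiv ℝ g) (slab n R) L M := by
  have hd : Differentiable ℝ g := hc.differentiable (by norm_num)
  have hc1 : ContDiff ℝ 1 (_root_.fderiv ℝ g) := hc.fderiv_right (by norm_num)
  have hd1 : Differentiable ℝ (_root_.fderiv ℝ g) := hc1.differentiable (by norm_num)
  obtain ⟨L, hL0, hL⟩ := hg.fderiv.exists_bound hc1.continuous R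
  obtain ⟨M, hM0, hM⟩ := hg.fderiv.fderiv.exists_bound
    (hc1.continuous_fderiv (by norm_num)) R
  refine ⟨L, M, hL0, hM0, fun a ha b hb => ?_, hL, fun a ha b hb => ?_⟩
  · exact (convex_slab R).norm_image_sub_le_of_norm_fderiv_le (fun x _ => hd x) hL ha hb
  · have hs : segment ℝ a b ⊆ slab n R := (convex_slab R).segment_subset ha hb
    have h1 : ∀ x ∈ segment ℝ a b, ‖_root_.fderiv ℝ g x - _root_.fderiv ℝ g a‖ ≤ M * ‖b - a‖ := by
      intro x hx
      refine ((convex_slab R).norm_image_sub_le_of_norm_fderiv_le (fun x _ => hd1 x) hM ha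
        (hs hx)).trans ?_
      gcongr
      obtain ⟨θ, hθ, rfl⟩ := (segment_eq_image' ℝ a b) ▸ hx
      simp only [add_sub_cancel_left, norm_smul, Real.norm_of_nonneg hθ.1]
      exact mul_le_of_le_one_left (norm_nonneg _) hθ.2
    have := (convex_segment a b).norm_image_sub_le_of_norm_fderiv_le' (fun x _ => hd x) h1
      (left_mem_segment ℝ a b) (right_mem_segment ℝ a b)
    calc _ ≤ _ := this
      _ = _ := by ring

end

section

variable {n : ℕ} {k : ℕ∞} {H : E n × E n → ℝ} {φ : ℝ → E n × E n → E n × E n}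

theorem gradP_eq (hd : Differentiable ℝ H) (x p : E n) :
    gradP n H x p = fun i => fderiv ℝ H (x, p) (0, Pi.single i 1) := by
  funext i
  have h1 : HasFDerivAt (fun p' => H (x, p')) ((fderiv ℝ H (x, p)).comp
      (ContinuousLinearMap.inr ℝ (E n) (E n))) p :=
    (hd (x, p)).hasFDerivAt.comp p (hasFDerivAt_prodMk_right x p)
  rw [gradP, h1.fderiv]
  simp

theorem gradX_eq (hd : Differentiable ℝ H) (x p : E n) :
    gradX n H x p = fun i => fderiv ℝ H (x, p) (Pi.single i 1, 0) := by
  funext i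
  have h1 : HasFDerivAt (fun x' => H (x', p)) ((fderiv ℝ H (x, p)).comp
      (ContinuousLinearMap.inl ℝ (E n) (E n))) x :=
    (hd (x, p)).hasFDerivAt.comp x (hasFDerivAt_prodMk_left x p)
  rw [gradX, h1.fderiv]
  simp

theorem hamVF_eq (hd : Differentiable ℝ H) (z : E n × E n) :
    hamVF n H z = sharp n (fderiv ℝ H z) := by
  rw [hamVF, gradP_eq hd, gradX_eq hd]
  rfl

theorem fderiv_eq_omega0 (hd : Differentiable ℝ H) (z v : E n × E n) :
    fderiv ℝ H z v = omega0 n v (hamVF n H z) := by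
  rw [hamVF_eq hd, omega0_sharp]

namespace IsTonelliHamiltonian

theorem periodic' (hH : IsTonelliHamiltonian n k H) : Periodic H := by
  intro z m
  have := hH.periodic z.1 z.2 m
  rwa [show z + (intVec m, 0) = (z.1 + intVec m, z.2) by ext <;> simp]

theorem differentiable (hH : IsTonelliHamiltonian n 3 H) : Differentiable ℝ H :=
  hH.smooth.differentiable (by norm_num)

theorem hamVF_eq_comp (hH : IsTonelliHamiltonian n 3 H) :
    hamVF n H = fun z => sharp n (fderiv ℝ H z) :=
  funext fun z => hamVF_eq hH.differentiable z

theorem contDiff_hamVF (hH : IsTonelliHamiltonian n 3 H) : ContDiff ℝ 2 (hamVF n H) := by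
  rw [hH.hamVF_eq_comp]
  exact (sharp n).contDiff.comp (hH.smooth.fderiv_right (by norm_num))

theorem periodic_hamVF (hH : IsTonelliHamiltonian n 3 H) : Periodic (hamVF n H) := by
  intro z m
  rw [hH.hamVF_eq_comp]
  simp only [hH.periodic'.fderiv z m]

theorem fderiv_hamVF_symm (hH : IsTonelliHamiltonian n 3 H) (z u v : E n × E n) :
    omega0 n u (fderiv ℝ (hamVF n H) z v) = omega0 n v (fderiv ℝ (hamVF n H) z u) := by
  have h1 : ContDiff ℝ 2 (fderiv ℝ H) := hH.smooth.fderiv_right (by norm_num)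
  have h2 : ∀ v, fderiv ℝ (hamVF n H) z v = sharp n (fderiv ℝ (fderiv ℝ H) z v) := by
    intro v
    rw [hH.hamVF_eq_comp]
    have := (sharp n).hasFDerivAt.comp z
      ((h1.differentiable (by norm_num)) z).hasFDerivAt
    rw [show (fun z => sharp n (fderiv ℝ H z)) = sharp n ∘ fderiv ℝ H from rfl, this.fderiv]
    rfl
  rw [h2, h2, omega0_sharp, omega0_sharp]
  have h3 : IsSymmSndFDerivAt ℝ H z :=
    hH.smooth.contDiffAt.isSymmSndFDerivAt (by
      simp only [minSmoothness_of_isRCLikeNormedField]; norm_num)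
  exact h3 v u

theorem sublevel_subset_slab (hH : IsTonelliHamiltonian n 3 H) (h : ℝ) :
    ∃ R, 0 ≤ R ∧ ∀ z, H z ≤ h → z ∈ slab n R := by
  obtain ⟨R, hR⟩ := hH.superlinear 1
  refine ⟨max R (max h 0), by simp, fun z hz => ?_⟩
  by_contra hc
  simp only [slab, Set.mem_ofPred_eq, not_le, max_lt_iff] at hc
  have := hR z.1 z.2 hc.1.le
  simp only [one_mul, Prod.mk.eta] at this
  linarith [hc.2.1]

theorem slab_subset_sublevel (hH : IsTonelliHamiltonian n 3 H) (R : ℝ) :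
    ∃ h, ∀ z ∈ slab n R, H z ≤ h := by
  obtain ⟨C, -, hC⟩ := hH.periodic'.exists_bound hH.smooth.continuous R
  exact ⟨C, fun z hz => (le_abs_self _).trans (hC z hz)⟩

theorem energy_const (hH : IsTonelliHamiltonian n 3 H) {γ : ℝ → E n × E n}
    (hγ : ∀ t, HasDerivAt γ (hamVF n H (γ t)) t) (t : ℝ) : H (γ t) = H (γ 0) := by
  have h1 : ∀ t, HasDerivAt (fun s => H (γ s)) 0 t := fun t => by
    have := (hH.differentiable (γ t)).hasFDerivAt.comp_hasDerivAt t (hγ t)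
    rwa [fderiv_eq_omega0 hH.differentiable, omega0_self] at this
  exact is_const_of_deriv_eq_zero (fun s => (h1 s).differentiableAt) (fun s => (h1 s).deriv) t 0

theorem curve_unique (hH : IsTonelliHamiltonian n 3 H) {γ₁ γ₂ : ℝ → E n × E n}
    (h₁ : ∀ t, HasDerivAt γ₁ (hamVF n H (γ₁ t)) t)
    (h₂ : ∀ t, HasDerivAt γ₂ (hamVF n H (γ₂ t)) t) (h : γ₁ 0 = γ₂ 0) (t : ℝ) :
    γ₁ t = γ₂ t := by
  obtain ⟨R, -, hR⟩ := hH.sublevel_subset_slab (H (γ₁ 0))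
  obtain ⟨L, M, hLM⟩ := hH.periodic_hamVF.exists_fieldBounds hH.contDiff_hamVF R
  have := hLM.norm_sub_le h₁ h₂ (fun s => hR _ (hH.energy_const h₁ s).le)
    (fun s => hR _ (by rw [hH.energy_const h₂ s, h])) (t := t) le_rfl
  rw [h, sub_self, norm_zero, zero_mul] at this
  exact eq_of_sub_eq_zero (norm_le_zero_iff.mp this)

end IsTonelliHamiltonian

namespace IsHamFlow

theorem energy (hH : IsTonelliHamiltonian n 3 H) (hφ : IsHamFlow n H φ) (t : ℝ)
    (z : E n × E n) : H (φ t z) = H z := by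
  have := hH.energy_const (hφ.2 z) t
  rwa [hφ.1] at this

theorem add (hH : IsTonelliHamiltonian n 3 H) (hφ : IsHamFlow n H φ) (s t : ℝ)
    (z : E n × E n) : φ (s + t) z = φ s (φ t z) := by
  refine hH.curve_unique (γ₁ := fun s => φ (s + t) z) (γ₂ := fun s => φ s (φ t z))
    (fun r => ?_) (hφ.2 _) (by simp [hφ.1]) s
  have := (hφ.2 z (r + t)).scomp r ((hasDerivAt_id r).add_const t)
  simpa [Function.comp_def] using this

theorem translate (hH : IsTonelliHamiltonian n 3 H) (hφ : IsHamFlow n H φ) (t : ℝ)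
    (z : E n × E n) (m : Fin n → ℤ) : φ t (z + (intVec m, 0)) = φ t z + (intVec m, 0) := by
  refine hH.curve_unique (γ₁ := fun t => φ t (z + (intVec m, 0)))
    (γ₂ := fun t => φ t z + (intVec m, 0)) (hφ.2 _) (fun r => ?_) (by simp [hφ.1]) t
  rw [hH.periodic_hamVF]
  exact (hφ.2 z r).add_const _

/-- Uniform second order expansion of the flow. -/
theorem exists_expansion (hH : IsTonelliHamiltonian n 3 H) (hφ : IsHamFlow n H φ) (h T : ℝ) :
    ∃ C, 0 ≤ C ∧ ∀ z, H z ≤ h → ∀ t, |t| ≤ T →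
      HasFDerivAt (φ t) (fderiv ℝ (φ t) z) z ∧ ‖fderiv ℝ (φ t) z‖ ≤ C ∧
      ∀ v, ‖v‖ ≤ 1 → ‖φ t (z + v) - φ t z‖ ≤ C * ‖v‖ ∧
        ‖φ t (z + v) - φ t z - fderiv ℝ (φ t) z v‖ ≤ C * ‖v‖ ^ 2 := by
  obtain ⟨R, hR0, hR⟩ := hH.sublevel_subset_slab h
  obtain ⟨h', hh'⟩ := hH.slab_subset_sublevel (R + 1)
  obtain ⟨R', -, hR'⟩ := hH.sublevel_subset_slab h'
  obtain ⟨L, M, hLM⟩ := hH.periodic_hamVF.exists_fieldBounds hH.contDiff_hamVF R'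
  rcases lt_or_ge T 0 with hT | hT
  · exact ⟨0, le_rfl, fun z _ t ht => absurd ht (not_le.mpr (hT.trans_le (abs_nonneg _)))⟩
  have hL0 := hLM.L_nonneg
  have hM0 := hLM.M_nonneg
  have inS : ∀ z, H z ≤ h → ∀ v, ‖v‖ ≤ 1 → ∀ t, φ t (z + v) ∈ slab n R' := by
    intro z hz v hv t
    refine hR' _ ?_
    rw [energy hH hφ]
    refine hh' _ ?_
    have h1 : ‖z.2‖ ≤ R := hR z hz
    have h2 : ‖v.2‖ ≤ 1 := (norm_snd_le v).trans hv
    simp only [slab, Set.mem_ofPred_eq, Prod.snd_add]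
    exact (norm_add_le _ _).trans (add_le_add h1 h2)
  set K := Real.exp (L * T) with hK
  set C := M * K ^ 2 * T * K with hC
  have hK0 : 0 < K := Real.exp_pos _
  have hC0 : 0 ≤ C := by positivity
  refine ⟨K + C, by positivity, fun z hz t ht => ?_⟩
  have hzS : ∀ t, φ t z ∈ slab n R' := fun t => by simpa using inS z hz 0 (by simp) t
  have hlip : ∀ v : E n × E n, ‖v‖ ≤ 1 → ‖φ t (z + v) - φ t z‖ ≤ K * ‖v‖ := by
    intro v hv
    have := hLM.norm_sub_le (hφ.2 (z + v)) (hφ.2 z) (inS z hz v hv) hzS ht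
    rwa [hφ.1, hφ.1, add_sub_cancel_left, mul_comm] at this
  obtain ⟨A, hA⟩ := exists_linear_approx (Δ := fun v => φ t (z + v) - φ t z) (C := C) hlip (by
    intro a b c u v w hu hv hw huvw
    have := hLM.norm_comb_le (hφ.2 z) (hφ.2 (z + u)) (hφ.2 (z + v)) (hφ.2 (z + w)) hzS
      (inS z hz u hu) (inS z hz v hv) (inS z hz w hw) (a := a) (b := b) (c := c)
      (by simpa [hφ.1] using huvw) ht
    simpa only [hφ.1, add_sub_cancel_left] using this)
  have hfd : HasFDerivAt (φ t) A z := hasFDerivAt_of_quadratic hA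
  rw [hfd.fderiv]
  refine ⟨hfd, ?_, fun v hv => ⟨(hlip v hv).trans ?_, (hA v hv).trans ?_⟩⟩
  · refine ContinuousLinearMap.opNorm_le_of_unit_norm (by positivity) fun v hv => ?_
    have h1 := hlip v hv.le
    have h2 := hA v hv.le
    rw [hv, mul_one] at h1
    rw [hv, one_pow, mul_one] at h2
    have h3 : A v = (φ t (z + v) - φ t z) - (φ t (z + v) - φ t z - A v) := by abel
    rw [h3]
    exact (norm_sub_le _ _).trans (add_le_add h1 h2)
  · gcongr; linarith
  · gcongr; linarith

theorem hasFDerivAt (hH : IsTonelliHamiltonian n 3 H) (hφ : IsHamFlow n H φ) (t : ℝ)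
    (z : E n × E n) : HasFDerivAt (φ t) (fderiv ℝ (φ t) z) z := by
  obtain ⟨C, -, hC⟩ := exists_expansion hH hφ (H z) |t|
  exact (hC z le_rfl t le_rfl).1

theorem continuous (hH : IsTonelliHamiltonian n 3 H) (hφ : IsHamFlow n H φ) (t : ℝ) :
    Continuous (φ t) :=
  continuous_iff_continuousAt.mpr fun z => (hφ.hasFDerivAt hH t z).continuousAt

theorem fderiv_zero (hφ : IsHamFlow n H φ) (z : E n × E n) :
    fderiv ℝ (φ 0) z = ContinuousLinearMap.id ℝ _ := by
  rw [show φ 0 = id from funext hφ.1]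
  exact fderiv_id

theorem fderiv_add (hH : IsTonelliHamiltonian n 3 H) (hφ : IsHamFlow n H φ) (s t : ℝ)
    (z : E n × E n) :
    fderiv ℝ (φ (s + t)) z = (fderiv ℝ (φ s) (φ t z)).comp (fderiv ℝ (φ t) z) := by
  rw [show φ (s + t) = φ s ∘ φ t from funext (hφ.add hH s t)]
  exact ((hφ.hasFDerivAt hH s (φ t z)).comp z (hφ.hasFDerivAt hH t z)).fderiv

theorem fderiv_neg_apply (hH : IsTonelliHamiltonian n 3 H) (hφ : IsHamFlow n H φ) (t : ℝ)
    (z w : E n × E n) : fderiv ℝ (φ (-t)) (φ t z) (fderiv ℝ (φ t) z w) = w := by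
  have := hφ.fderiv_add hH (-t) t z
  rw [neg_add_cancel, hφ.fderiv_zero] at this
  exact (DFunLike.congr_fun this w).symm

theorem periodic_fderiv (hH : IsTonelliHamiltonian n 3 H) (hφ : IsHamFlow n H φ) (t : ℝ) :
    Periodic (fderiv ℝ (φ t)) := by
  intro z m
  rw [← fderiv_comp_add_right]
  simp only [hφ.translate hH]
  exact fderiv_add_const _

theorem continuous_fderiv (hH : IsTonelliHamiltonian n 3 H) (hφ : IsHamFlow n H φ) (t : ℝ) :
    Continuous (fderiv ℝ (φ t)) := by
  refine continuous_iff_continuousAt.mpr fun z => ?_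
  obtain ⟨C, hC0, hC⟩ := exists_expansion hH hφ (H z + 1) |t|
  have hev : ∀ᶠ y in nhds z, H y ≤ H z + 1 :=
    (hH.smooth.continuous.tendsto z).eventually (ge_mem_nhds (by linarith))
  have hev2 : ∀ᶠ y in nhds z, ‖y - z‖ ≤ 1 / 2 := by
    filter_upwards [Metric.ball_mem_nhds z (ε := 1 / 2) (by norm_num)] with y hy
    rw [mem_ball_iff_norm] at hy
    exact hy.le
  have key : ∀ᶠ y in nhds z, ‖fderiv ℝ (φ t) y - fderiv ℝ (φ t) z‖ ≤ 6 * C * ‖y - z‖ := by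
    filter_upwards [hev, hev2] with y hy hy2
    rcases eq_or_ne y z with rfl | hne
    · simp
    set v := y - z with hv
    have hyv : y = z + v := by rw [hv]; abel
    have hr : 0 < ‖v‖ := norm_pos_iff.mpr (sub_ne_zero.mpr hne)
    refine ContinuousLinearMap.opNorm_le_of_unit_norm (by positivity) fun e he => ?_
    set w := ‖v‖ • e with hw
    have hwn : ‖w‖ = ‖v‖ := by rw [hw, norm_smul, he, mul_one, norm_norm]
    have hvw : ‖v + w‖ ≤ 2 * ‖v‖ := (norm_add_le _ _).trans (by rw [hwn]; linarith)
    have h1 := ((hC z (by linarith) t le_rfl).2.2 (v + w) (by linarith)).2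
    have h2 := ((hC z (by linarith) t le_rfl).2.2 v (by linarith)).2
    have h3 := ((hC y hy t le_rfl).2.2 w (by linarith)).2
    have e1 : ‖v‖ • (fderiv ℝ (φ t) y - fderiv ℝ (φ t) z) e =
        (φ t (z + (v + w)) - φ t z - fderiv ℝ (φ t) z (v + w)) -
        (φ t (z + v) - φ t z - fderiv ℝ (φ t) z v) -
        (φ t (y + w) - φ t y - fderiv ℝ (φ t) y w) := by
      have : ‖v‖ • (fderiv ℝ (φ t) y - fderiv ℝ (φ t) z) e =
        fderiv ℝ (φ t) y w - fderiv ℝ (φ t) z w := by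
        rw [hw, map_smul, map_smul, ← smul_sub]; rfl
      rw [this, map_add, hyv, add_assoc]
      abel
    have h4 : ‖v‖ * ‖(fderiv ℝ (φ t) y - fderiv ℝ (φ t) z) e‖ ≤ ‖v‖ * (6 * C * ‖v‖) := by
      calc _ = ‖‖v‖ • (fderiv ℝ (φ t) y - fderiv ℝ (φ t) z) e‖ := by
            rw [norm_smul, norm_norm]
        _ ≤ C * ‖v + w‖ ^ 2 + C * ‖v‖ ^ 2 + C * ‖w‖ ^ 2 := by
            rw [e1]
            exact (norm_sub_le _ _).trans (add_le_add ((norm_sub_le _ _).trans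
              (add_le_add h1 h2)) h3)
        _ ≤ C * (2 * ‖v‖) ^ 2 + C * ‖v‖ ^ 2 + C * ‖v‖ ^ 2 := by rw [hwn]; gcongr
        _ = _ := by ring
    exact le_of_mul_le_mul_left h4 hr
  rw [ContinuousAt, tendsto_iff_norm_sub_tendsto_zero]
  refine squeeze_zero' (Eventually.of_forall fun _ => norm_nonneg _) key ?_
  have : Continuous fun y => 6 * C * ‖y - z‖ := by fun_prop
  simpa using this.tendsto z

/-- The derivative of the flow is symplectic. -/
theorem omega0_fderiv (hH : IsTonelliHamiltonian n 3 H) (hφ : IsHamFlow n H φ) (t : ℝ)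
    (z a b : E n × E n) :
    omega0 n (fderiv ℝ (φ t) z a) (fderiv ℝ (φ t) z b) = omega0 n a b := by
  obtain ⟨C, hC0, hC⟩ := exists_expansion hH hφ (H z) |t|
  obtain ⟨R, hR0, hR⟩ := hH.sublevel_subset_slab (H z)
  obtain ⟨h', hh'⟩ := hH.slab_subset_sublevel (R + 1)
  obtain ⟨R', -, hR'⟩ := hH.sublevel_subset_slab h'
  obtain ⟨L, M, hLM⟩ := hH.periodic_hamVF.exists_fieldBounds hH.contDiff_hamVF R'
  have hM0 := hLM.M_nonneg
  have inS : ∀ v : E n × E n, ‖v‖ ≤ 1 → ∀ t, φ t (z + v) ∈ slab n R' := by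
    intro v hv t
    refine hR' _ ?_
    rw [energy hH hφ]
    refine hh' _ ?_
    have h1 : ‖z.2‖ ≤ R := hR z le_rfl
    have h2 : ‖v.2‖ ≤ 1 := (norm_snd_le v).trans hv
    simp only [slab, Set.mem_ofPred_eq, Prod.snd_add]
    exact (norm_add_le _ _).trans (add_le_add h1 h2)
  set B := ‖omegaL n‖ with hB
  have hω : ∀ v w, |omega0 n v w| ≤ B * ‖v‖ * ‖w‖ := fun v w => by
    have := (omegaL n).le_opNorm₂ v w
    rwa [omegaL_apply] at this
  have hB0 : 0 ≤ B := by rw [hB]; exact norm_nonneg (omegaL n)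
  obtain ⟨N, hN0, hNa, hNb⟩ : ∃ N : ℝ, 0 < N ∧ ‖a‖ ≤ N ∧ ‖b‖ ≤ N :=
    ⟨1 + ‖a‖ + ‖b‖, by positivity, by linarith [norm_nonneg b], by linarith [norm_nonneg a]⟩
  -- the symplectic product of two finite differences is almost constant
  have step : ∀ s : ℝ, 0 < s → s * N ≤ 1 →
      |omega0 n (φ t (z + s • a) - φ t z) (φ t (z + s • b) - φ t z) - omega0 n (s • a) (s • b)|
        ≤ (2 * B * M * C ^ 3 * N ^ 3 * |t|) * s ^ 3 := by
    intro s hs hsN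
    have na : ‖s • a‖ ≤ s * N := by rw [norm_smul, Real.norm_of_nonneg hs.le]; gcongr
    have nb : ‖s • b‖ ≤ s * N := by rw [norm_smul, Real.norm_of_nonneg hs.le]; gcongr
    let y : ℝ → ℝ := fun r => omegaL n (φ r (z + s • a) - φ r z) (φ r (z + s • b) - φ r z)
    have hy : ∀ r, HasDerivAt y
        (omegaL n (φ r (z + s • a) - φ r z) (hamVF n H (φ r (z + s • b)) - hamVF n H (φ r z)) +
         omegaL n (hamVF n H (φ r (z + s • a)) - hamVF n H (φ r z))
          (φ r (z + s • b) - φ r z)) r := fun r =>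
      (omegaL n).hasDerivAt_of_bilinear
        (fun _ => (hφ.2 (z + s • a) r).sub (hφ.2 z r))
        (fun _ => (hφ.2 (z + s • b) r).sub (hφ.2 z r))
    have bound : ∀ r ∈ Set.uIcc 0 t, ‖omegaL n (φ r (z + s • a) - φ r z)
          (hamVF n H (φ r (z + s • b)) - hamVF n H (φ r z)) +
         omegaL n (hamVF n H (φ r (z + s • a)) - hamVF n H (φ r z))
          (φ r (z + s • b) - φ r z)‖ ≤ (2 * B * M * C ^ 3 * N ^ 3) * s ^ 3 := by
      intro r hr
      have hrt : |r| ≤ |t| := by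
        rcases Set.mem_uIcc.mp hr with ⟨h1, h2⟩ | ⟨h1, h2⟩
        · rw [abs_of_nonneg h1, abs_of_nonneg (h1.trans h2)]; exact h2
        · rw [abs_of_nonpos h2, abs_of_nonpos (h1.trans h2)]; linarith
      have hz0 : φ r z ∈ slab n R' := by simpa using inS 0 (by simp) r
      have ha := ((hC z le_rfl r hrt).2.2 (s • a) (na.trans hsN)).1
      have hb := ((hC z le_rfl r hrt).2.2 (s • b) (nb.trans hsN)).1
      have qa := hLM.quad _ hz0 _ (inS (s • a) (na.trans hsN) r)
      have qb := hLM.quad _ hz0 _ (inS (s • b) (nb.trans hsN) r)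
      set da := φ r (z + s • a) - φ r z
      set db := φ r (z + s • b) - φ r z
      set ea := hamVF n H (φ r (z + s • a)) - hamVF n H (φ r z) - fderiv ℝ (hamVF n H) (φ r z) da
        with hea
      set eb := hamVF n H (φ r (z + s • b)) - hamVF n H (φ r z) - fderiv ℝ (hamVF n H) (φ r z) db
        with heb
      have e1 : hamVF n H (φ r (z + s • a)) - hamVF n H (φ r z) =
        fderiv ℝ (hamVF n H) (φ r z) da + ea := by rw [hea]; abel
      have e2 : hamVF n H (φ r (z + s • b)) - hamVF n H (φ r z) =
        fderiv ℝ (hamVF n H) (φ r z) db + eb := by rw [heb]; abel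
      have e3 : omegaL n da (fderiv ℝ (hamVF n H) (φ r z) db + eb) +
          omegaL n (fderiv ℝ (hamVF n H) (φ r z) da + ea) db =
          omega0 n da eb + omega0 n ea db := by
        rw [map_add, map_add, _root_.add_apply]
        simp only [omegaL_apply]
        rw [hH.fderiv_hamVF_symm, omega0_swap (fderiv ℝ (hamVF n H) (φ r z) da) db]
        ring
      have da' : ‖da‖ ≤ C * (s * N) := ha.trans (by gcongr)
      have db' : ‖db‖ ≤ C * (s * N) := hb.trans (by gcongr)
      rw [e1, e2, e3]
      calc ‖omega0 n da eb + omega0 n ea db‖ ≤ B * ‖da‖ * ‖eb‖ + B * ‖ea‖ * ‖db‖ :=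
            (norm_add_le _ _).trans (add_le_add (hω _ _) (hω _ _))
        _ ≤ B * (C * (s * N)) * (M * (C * (s * N)) ^ 2) +
            B * (M * (C * (s * N)) ^ 2) * (C * (s * N)) := by
            have ea' : ‖ea‖ ≤ M * (C * (s * N)) ^ 2 := qa.trans (by gcongr)
            have eb' : ‖eb‖ ≤ M * (C * (s * N)) ^ 2 := qb.trans (by gcongr)
            gcongr
        _ = _ := by ring
    have := (convex_uIcc 0 t).norm_image_sub_le_of_norm_hasDerivWithin_le
      (fun r _ => (hy r).hasDerivWithinAt) bound Set.left_mem_uIcc Set.right_mem_uIcc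
    simp only [y, hφ.1, add_sub_cancel_left, omegaL_apply, sub_zero, Real.norm_eq_abs] at this
    calc _ ≤ _ := this
      _ = _ := by ring
  have step2 : ∀ s : ℝ, 0 < s → s * N ≤ 1 →
      |omega0 n (fderiv ℝ (φ t) z a) (fderiv ℝ (φ t) z b) - omega0 n a b| ≤
        (2 * B * M * C ^ 3 * N ^ 3 * |t| + 2 * B * C ^ 2 * N ^ 3) * s := by
    intro s hs hsN
    have na : ‖s • a‖ ≤ s * N := by rw [norm_smul, Real.norm_of_nonneg hs.le]; gcongr
    have nb : ‖s • b‖ ≤ s * N := by rw [norm_smul, Real.norm_of_nonneg hs.le]; gcongr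
    obtain ⟨-, hAn, hCz⟩ := hC z le_rfl t le_rfl
    obtain ⟨la, qa⟩ := hCz (s • a) (na.trans hsN)
    obtain ⟨lb, qb⟩ := hCz (s • b) (nb.trans hsN)
    have h1 := step s hs hsN
    set A := fderiv ℝ (φ t) z
    set da := φ t (z + s • a) - φ t z
    set db := φ t (z + s • b) - φ t z
    have e1 : omega0 n (A (s • a)) (A (s • b)) = omega0 n da db -
        omega0 n (da - A (s • a)) db - omega0 n (A (s • a)) (db - A (s • b)) := by
      simp only [← omegaL_apply, map_sub, _root_.sub_apply]
      ring
    have e2 : omega0 n (A (s • a)) (A (s • b)) = s ^ 2 * omega0 n (A a) (A b) := by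
      simp only [← omegaL_apply, map_smul, _root_.smul_apply, smul_eq_mul]
      ring
    have e3 : omega0 n (s • a) (s • b) = s ^ 2 * omega0 n a b := by
      simp only [← omegaL_apply, map_smul, _root_.smul_apply, smul_eq_mul]
      ring
    have nA : ‖A (s • a)‖ ≤ C * (s * N) := (A.le_opNorm _).trans (by gcongr)
    have b1 : |omega0 n (da - A (s • a)) db| ≤ B * (C * (s * N) ^ 2) * (C * (s * N)) :=
      (hω _ _).trans (by
        have := qa.trans (show _ ≤ C * (s * N) ^ 2 by gcongr)
        have := lb.trans (show _ ≤ C * (s * N) by gcongr)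
        gcongr)
    have b2 : |omega0 n (A (s • a)) (db - A (s • b))| ≤ B * (C * (s * N)) * (C * (s * N) ^ 2) :=
      (hω _ _).trans (by
        have := qb.trans (show _ ≤ C * (s * N) ^ 2 by gcongr)
        gcongr)
    have h2 : s ^ 2 * |omega0 n (A a) (A b) - omega0 n a b| ≤ s ^ 2 *
        ((2 * B * M * C ^ 3 * N ^ 3 * |t| + 2 * B * C ^ 2 * N ^ 3) * s) := by
      calc _ = |s ^ 2 * omega0 n (A a) (A b) - s ^ 2 * omega0 n a b| := by
            rw [← mul_sub, abs_mul, abs_of_nonneg (sq_nonneg s)]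
        _ = |(omega0 n da db - omega0 n (s • a) (s • b)) -
              omega0 n (da - A (s • a)) db - omega0 n (A (s • a)) (db - A (s • b))| := by
            rw [← e2, ← e3, e1]; congr 1; ring
        _ ≤ (2 * B * M * C ^ 3 * N ^ 3 * |t|) * s ^ 3 + B * (C * (s * N) ^ 2) * (C * (s * N)) +
              B * (C * (s * N)) * (C * (s * N) ^ 2) :=
            (abs_sub _ _).trans (add_le_add ((abs_sub _ _).trans (add_le_add h1 b1)) b2)
        _ = _ := by ring
    exact le_of_mul_le_mul_left h2 (by positivity)
  have lim : Tendsto (fun s : ℝ => (2 * B * M * C ^ 3 * N ^ 3 * |t| + 2 * B * C ^ 2 * N ^ 3) * s)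
      (nhdsWithin 0 (Set.Ioi 0)) (nhds 0) := by
    have : Continuous fun s : ℝ =>
      (2 * B * M * C ^ 3 * N ^ 3 * |t| + 2 * B * C ^ 2 * N ^ 3) * s := by fun_prop
    simpa using (this.tendsto 0).mono_left nhdsWithin_le_nhds
  have h0 : |omega0 n (fderiv ℝ (φ t) z a) (fderiv ℝ (φ t) z b) - omega0 n a b| ≤ 0 := by
    refine ge_of_tendsto lim ?_
    filter_upwards [self_mem_nhdsWithin, mem_nhdsWithin_of_mem_nhds
      (Iio_mem_nhds (show (0 : ℝ) < 1 / N by positivity))] with s hs hs'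
    refine step2 s hs ?_
    have : s < 1 / N := hs'
    rw [lt_div_iff₀ hN0] at this
    exact this.le
  exact sub_eq_zero.mp (abs_nonpos_iff.mp h0)

end IsHamFlow

end

section

variable {n : ℕ} {k : ℕ∞} {H : E n × E n → ℝ} {φ : ℝ → E n × E n → E n × E n}

theorem abs_dotP_le (a b : E n) : |dotP n a b| ≤ n * ‖a‖ * ‖b‖ := by
  unfold dotP
  refine (Finset.abs_sum_le_sum_abs _ _).trans ?_
  calc ∑ i, |a i * b i| ≤ ∑ _i : Fin n, ‖a‖ * ‖b‖ := by
        refine Finset.sum_le_sum fun i _ => ?_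
        rw [abs_mul]
        have h1 : |a i| ≤ ‖a‖ := norm_le_pi_norm a i
        have h2 : |b i| ≤ ‖b‖ := norm_le_pi_norm b i
        gcongr
    _ = n * ‖a‖ * ‖b‖ := by simp [mul_assoc]

theorem dotP_sub (a b c : E n) : dotP n a (b - c) = dotP n a b - dotP n a c := by
  simp only [← dotL_apply, map_sub]

theorem dotP_smul (a b : E n) (r : ℝ) : dotP n a (r • b) = r * dotP n a b := by
  simp only [← dotL_apply, map_smul, smul_eq_mul]

theorem add_dotP (a b c : E n) : dotP n (a + b) c = dotP n a c + dotP n b c := by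
  simp only [← dotL_apply, map_add, _root_.add_apply]

theorem sub_dotP (a b c : E n) : dotP n (a - b) c = dotP n a c - dotP n b c := by
  simp only [← dotL_apply, map_sub, _root_.sub_apply]

theorem smul_dotP (a b : E n) (r : ℝ) : dotP n (r • a) b = r * dotP n a b := by
  simp only [← dotL_apply, map_smul, _root_.smul_apply, smul_eq_mul]

theorem HasDerivAt.dotP {a b : ℝ → E n} {a' b' : E n} {t : ℝ} (ha : HasDerivAt a a' t)
    (hb : HasDerivAt b b' t) :
    HasDerivAt (fun s => dotP n (a s) (b s)) (dotP n (a t) b' + dotP n a' (b t)) t := by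
  simpa only [dotL_apply] using (dotL n).hasDerivAt_of_bilinear (fun _ => ha) (fun _ => hb)

theorem Continuous.dotP {X : Type*} [TopologicalSpace X] {a b : X → E n} (ha : Continuous a)
    (hb : Continuous b) : Continuous fun x => dotP n (a x) (b x) := by
  simp only [← dotL_apply]
  fun_prop

namespace IsTonelliHamiltonian

/-- Strict convexity in the momentum. -/
theorem lt_of_ne (hH : IsTonelliHamiltonian n 3 H) (x : E n) {p q : E n} (hpq : q ≠ p) :
    H (x, p) + dotP n (q - p) (hamVF n H (x, p)).1 < H (x, q) := by
  set w := q - p with hw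
  have hw0 : w ≠ 0 := sub_ne_zero.mpr hpq
  set K : E n → ℝ := fun p' => H (x, p') with hK
  have hKs : ContDiff ℝ 3 K := hH.smooth.comp (contDiff_prodMk_right x)
  have hKd : Differentiable ℝ K := hKs.differentiable (by norm_num)
  have hK1 : Differentiable ℝ (fun p' => fderiv ℝ K p' w) := by
    have : ContDiff ℝ 2 (fderiv ℝ K) := hKs.fderiv_right (by norm_num)
    exact ((this.differentiable (by norm_num)).clm_apply (differentiable_const w))
  have hline : ∀ s : ℝ, HasDerivAt (fun s : ℝ => p + s • w) w s := fun s => by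
    simpa using ((hasDerivAt_id s).smul_const w).const_add p
  have h1 : ∀ s : ℝ, HasDerivAt (fun s : ℝ => K (p + s • w)) (fderiv ℝ K (p + s • w) w) s :=
    fun s => (hKd _).hasFDerivAt.comp_hasDerivAt s (hline s)
  have h2 : ∀ s : ℝ, HasDerivAt (fun s : ℝ => fderiv ℝ K (p + s • w) w)
      (fderiv ℝ (fun p' => fderiv ℝ K p' w) (p + s • w) w) s :=
    fun s => (hK1 _).hasFDerivAt.comp_hasDerivAt s (hline s)
  have hmono : StrictMono (fun s : ℝ => fderiv ℝ K (p + s • w) w) :=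
    strictMono_of_deriv_pos fun s => by
      rw [(h2 s).deriv]
      exact hH.posdef x _ w hw0
  obtain ⟨ξ, hξ, hs⟩ := exists_hasDerivAt_eq_slope (fun s : ℝ => K (p + s • w)) _
    zero_lt_one (fun s _ => (h1 s).continuousAt.continuousWithinAt) (fun s _ => h1 s)
  have h3 := hmono hξ.1
  simp only [zero_smul, add_zero, one_smul, sub_zero, div_one] at h3 hs
  have h4 : fderiv ℝ K p w = dotP n w (hamVF n H (x, p)).1 := by
    rw [dotP_comm]
    exact clm_eq_dotP _ _
  have h5 : p + w = q := by rw [hw]; abel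
  rw [h5] at hs
  rw [h4, hs] at h3
  simp only [hK] at h3
  linarith

theorem le_of_convex (hH : IsTonelliHamiltonian n 3 H) (x p q : E n) :
    H (x, p) + dotP n (q - p) (hamVF n H (x, p)).1 ≤ H (x, q) := by
  rcases eq_or_ne q p with rfl | h
  · simp [← dotL_apply]
  · exact (hH.lt_of_ne x h).le

theorem fderiv_apply (hH : IsTonelliHamiltonian n 3 H) (z v : E n × E n) :
    fderiv ℝ H z v = dotP n v.2 (hamVF n H z).1 - dotP n v.1 (hamVF n H z).2 :=
  fderiv_eq_omega0 hH.differentiable z v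

end IsTonelliHamiltonian

/-- A partition of the phase space into invariant Lipschitz Lagrangian graphs. -/
structure IsFoliation (n : ℕ) (φ : ℝ → E n × E n → E n × E n) (F : E n × E n → E n)
    (u : E n → E n → ℝ) : Prop where
  contDiff : ∀ c, ContDiff ℝ 1 (u c)
  periodic : ∀ c x (m : Fin n → ℤ), u c (x + intVec m) = u c x
  lipschitz : ∀ c, ∃ K : ℝ≥0, LipschitzWith K (gradF n (u c))
  eq_grad : ∀ c x, F (x, c) = c + gradF n (u c) x
  invariant : ∀ c t x, (φ t (x, F (x, c))).2 = F ((φ t (x, F (x, c))).1, c)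
  existsUnique : ∀ z : E n × E n, ∃! c, z.2 = F (z.1, c)

theorem C0Integrable.exists_foliation (h : C0Integrable n H φ) :
    ∃ F u, IsFoliation n φ F u := by
  obtain ⟨F, h1, h2, h3⟩ := h
  choose u hu using h1
  exact ⟨F, u, fun c => (hu c).1, fun c => (hu c).2.1, fun c => (hu c).2.2.1,
    fun c => (hu c).2.2.2, h2, h3⟩

namespace IsFoliation

variable {F : E n × E n → E n} {u : E n → E n → ℝ}

theorem lipschitz_F (hF : IsFoliation n φ F u) (c : E n) :
    ∃ K : ℝ, 0 ≤ K ∧ ∀ x y, ‖F (y, c) - F (x, c)‖ ≤ K * ‖y - x‖ := by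
  obtain ⟨K, hK⟩ := hF.lipschitz c
  refine ⟨K, K.2, fun x y => ?_⟩
  rw [hF.eq_grad, hF.eq_grad, add_sub_add_left_eq_sub]
  exact hK.norm_sub_le y x

theorem continuous_F (hF : IsFoliation n φ F u) (c : E n) : Continuous fun x => F (x, c) := by
  obtain ⟨K, hK⟩ := hF.lipschitz c
  simp only [hF.eq_grad]
  exact continuous_const.add hK.continuous

theorem fderiv_u_periodic (hF : IsFoliation n φ F u) (c x : E n) (m : Fin n → ℤ) :
    fderiv ℝ (u c) (x + intVec m) = fderiv ℝ (u c) x := by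
  rw [← fderiv_comp_add_right]
  simp only [hF.periodic]

theorem F_periodic (hF : IsFoliation n φ F u) (c x : E n) (m : Fin n → ℤ) :
    F (x + intVec m, c) = F (x, c) := by
  rw [hF.eq_grad, hF.eq_grad]
  congr 1
  funext i
  simp only [gradF, hF.fderiv_u_periodic]

theorem exists_bound_F (hF : IsFoliation n φ F u) (c : E n) :
    ∃ R, 0 ≤ R ∧ ∀ x, ‖F (x, c)‖ ≤ R := by
  have hp : Periodic fun z : E n × E n => F (z.1, c) := fun z m => by
    simpa using hF.F_periodic c z.1 m
  obtain ⟨R, h0, hR⟩ := hp.exists_bound ((hF.continuous_F c).comp continuous_fst) 0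
  exact ⟨R, h0, fun x => hR (x, 0) (by simp [slab])⟩

/-- The primitive `x ↦ ⟨c, x⟩ + u_c x` of a leaf. -/
def primitive (n : ℕ) (u : E n → E n → ℝ) (c x : E n) : ℝ := dotP n c x + u c x

theorem hasFDerivAt_u (hF : IsFoliation n φ F u) (c x : E n) :
    HasFDerivAt (u c) (dotL n (gradF n (u c) x)) x := by
  have h := ((hF.contDiff c).differentiable (by norm_num) x).hasFDerivAt
  have e : dotL n (gradF n (u c) x) = fderiv ℝ (u c) x := ContinuousLinearMap.ext fun v => by
    rw [dotL_apply]
    exact (clm_eq_dotP _ _).symm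
  rwa [e]

theorem hasFDerivAt_primitive (hF : IsFoliation n φ F u) (c x : E n) :
    HasFDerivAt (primitive n u c) (dotL n (F (x, c))) x := by
  have h := (dotL n c).hasFDerivAt.add (hF.hasFDerivAt_u c x)
  rw [hF.eq_grad, map_add]
  refine h.congr_of_eventuallyEq (Eventually.of_forall fun y => ?_)
  simp [primitive]

theorem hasDerivAt_primitive (hF : IsFoliation n φ F u) (c : E n) {x : ℝ → E n} {x' : E n}
    {t : ℝ} (hx : HasDerivAt x x' t) :
    HasDerivAt (fun s => primitive n u c (x s)) (dotP n (F (x t, c)) x') t := by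
  have := (hF.hasFDerivAt_primitive c (x t)).comp_hasDerivAt t hx
  rwa [dotL_apply] at this

theorem primitive_quad (hF : IsFoliation n φ F u) (c : E n) :
    ∃ K : ℝ, 0 ≤ K ∧ ∀ x v, |primitive n u c (x + v) - primitive n u c x - dotP n (F (x, c)) v| ≤
      K * ‖v‖ ^ 2 := by
  obtain ⟨K, hK0, hK⟩ := hF.lipschitz_F c
  refine ⟨n * K, by positivity, fun x v => ?_⟩
  have hl : ∀ s : ℝ, HasDerivAt (fun s : ℝ => x + s • v) v s := fun s => by
    simpa using ((hasDerivAt_id s).smul_const v).const_add x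
  have hd : ∀ s : ℝ, HasDerivAt (fun s : ℝ => primitive n u c (x + s • v) - s * dotP n (F (x, c)) v)
      (dotP n (F (x + s • v, c)) v - 1 * dotP n (F (x, c)) v) s := fun s =>
    (hF.hasDerivAt_primitive c (hl s)).sub ((hasDerivAt_id s).mul_const _)
  have hb : ∀ s ∈ Set.Icc (0 : ℝ) 1,
      ‖dotP n (F (x + s • v, c)) v - 1 * dotP n (F (x, c)) v‖ ≤ n * K * ‖v‖ ^ 2 := by
    intro s hs
    rw [one_mul, ← sub_dotP]
    refine (abs_dotP_le _ _).trans ?_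
    have h1 := hK x (x + s • v)
    rw [add_sub_cancel_left, norm_smul, Real.norm_of_nonneg hs.1] at h1
    have h2 : ‖F (x + s • v, c) - F (x, c)‖ ≤ K * (1 * ‖v‖) := h1.trans (by gcongr; exact hs.2)
    calc _ ≤ n * (K * (1 * ‖v‖)) * ‖v‖ := by gcongr
      _ = _ := by ring
  have := (convex_Icc (0 : ℝ) 1).norm_image_sub_le_of_norm_hasDerivWithin_le
    (fun s _ => (hd s).hasDerivWithinAt) hb (x := 0) (y := 1) (by simp) (by simp)
  simp only [one_smul, zero_smul, add_zero, one_mul, zero_mul, sub_zero, norm_one, mul_one,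
    Real.norm_eq_abs] at this
  rwa [sub_right_comm] at this

/-- The derivative of the Bregman-type defect of a primitive between an orbit of a leaf and
another curve. -/
theorem hasDerivAt_defect (hF : IsFoliation n φ F u) (c : E n) {x y p : ℝ → E n}
    {x' y' p' : E n} {t : ℝ} (hx : HasDerivAt x x' t) (hy : HasDerivAt y y' t)
    (hp : HasDerivAt p p' t) (hpt : p t = F (x t, c)) :
    HasDerivAt (fun s => primitive n u c (y s) - primitive n u c (x s) - dotP n (p s) (y s - x s))
      (dotP n (F (y t, c) - p t) y' - dotP n p' (y t - x t)) t := by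
  have h := ((hF.hasDerivAt_primitive c hy).sub (hF.hasDerivAt_primitive c hx)).sub
    (hp.dotP (hy.sub hx))
  refine h.congr_deriv ?_
  rw [sub_dotP, dotP_sub, hpt, Pi.sub_apply]
  ring

theorem flow_mem (hF : IsFoliation n φ F u) {c : E n} {z : E n × E n} (hz : z.2 = F (z.1, c))
    (t : ℝ) : (φ t z).2 = F ((φ t z).1, c) := by
  have := hF.invariant c t z.1
  rwa [← hz] at this

/-- The Hamiltonian is constant on each leaf. -/
theorem energy_const (hH : IsTonelliHamiltonian n 3 H) (hφ : IsHamFlow n H φ)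
    (hF : IsFoliation n φ F u) (c x y : E n) : H (x, F (x, c)) = H (y, F (y, c)) := by
  obtain ⟨R, hR0, hR⟩ := hF.exists_bound_F c
  obtain ⟨K, hK0, hK⟩ := hF.lipschitz_F c
  obtain ⟨Q, hQ0, hQ⟩ := hF.primitive_quad c
  obtain ⟨L, M, hLM⟩ := hH.periodic_hamVF.exists_fieldBounds hH.contDiff_hamVF R
  obtain ⟨L', M', hLM'⟩ := hH.periodic'.exists_fieldBounds (hH.smooth.of_le (by norm_num)) R
  have hL0 := hLM.L_nonneg
  have hM0 := hLM'.M_nonneg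
  set D := (1 + K) * Real.exp (L * 1) with hD
  have hD0 : 0 < D := by positivity
  have key : ∀ x v : E n, |H (x + v, F (x + v, c)) - H (x, F (x, c))| ≤
      (2 * (Q * D ^ 2) + (n * L + M') * D ^ 2) * ‖v‖ ^ 2 := by
    intro x v
    set z : E n × E n := (x, F (x, c)) with hz
    set w : E n × E n := (x + v, F (x + v, c)) with hw
    have hzG : ∀ t, (φ t z).2 = F ((φ t z).1, c) := fun t => hF.flow_mem rfl t
    have hwG : ∀ t, (φ t w).2 = F ((φ t w).1, c) := fun t => hF.flow_mem rfl t
    have hzS : ∀ t, φ t z ∈ slab n R := fun t => by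
      change ‖(φ t z).2‖ ≤ R
      rw [hzG]; exact hR _
    have hwS : ∀ t, φ t w ∈ slab n R := fun t => by
      change ‖(φ t w).2‖ ≤ R
      rw [hwG]; exact hR _
    have h0 : ‖w - z‖ ≤ (1 + K) * ‖v‖ := by
      rw [Prod.norm_def, max_le_iff]
      have h1 := hK x (x + v)
      simp only [add_sub_cancel_left] at h1
      constructor
      · simp only [hw, hz, Prod.fst_sub, add_sub_cancel_left]
        nlinarith [norm_nonneg v]
      · simp only [hw, hz, Prod.snd_sub]
        nlinarith [norm_nonneg v]
    have hd : ∀ t, |t| ≤ 1 → ‖φ t w - φ t z‖ ≤ D * ‖v‖ := by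
      intro t ht
      have := hLM.norm_sub_le (hφ.2 w) (hφ.2 z) hwS hzS ht
      rw [hφ.1, hφ.1] at this
      calc _ ≤ _ := this
        _ ≤ (1 + K) * ‖v‖ * Real.exp (L * 1) := by gcongr
        _ = _ := by rw [hD]; ring
    let g : ℝ → ℝ := fun s => primitive n u c (φ s w).1 - primitive n u c (φ s z).1 -
      dotP n (φ s z).2 ((φ s w).1 - (φ s z).1)
    have hg : ∀ t, HasDerivAt g (dotP n (F ((φ t w).1, c) - (φ t z).2) (hamVF n H (φ t w)).1 -
        dotP n (hamVF n H (φ t z)).2 ((φ t w).1 - (φ t z).1)) t := fun t =>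
      hF.hasDerivAt_defect c (hφ.2 z t).fst (hφ.2 w t).fst (hφ.2 z t).snd (hzG t)
    have hgb : ∀ t, |t| ≤ 1 → |g t| ≤ Q * D ^ 2 * ‖v‖ ^ 2 := by
      intro t ht
      have h1 := hQ (φ t z).1 ((φ t w).1 - (φ t z).1)
      rw [add_sub_cancel, ← hzG] at h1
      refine h1.trans ?_
      have h2 : ‖(φ t w).1 - (φ t z).1‖ ≤ D * ‖v‖ := (norm_fst_le (φ t w - φ t z)).trans (hd t ht)
      calc _ ≤ Q * (D * ‖v‖) ^ 2 := by gcongr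
        _ = _ := by ring
    have hg2 : ∀ t, HasDerivAt (fun s => g s - s * (H w - H z))
        (dotP n (F ((φ t w).1, c) - (φ t z).2) (hamVF n H (φ t w)).1 -
        dotP n (hamVF n H (φ t z)).2 ((φ t w).1 - (φ t z).1) - 1 * (H w - H z)) t := fun t =>
      (hg t).sub ((hasDerivAt_id t).mul_const _)
    have hbd : ∀ t ∈ Set.Icc (0 : ℝ) 1,
        ‖dotP n (F ((φ t w).1, c) - (φ t z).2) (hamVF n H (φ t w)).1 -
        dotP n (hamVF n H (φ t z)).2 ((φ t w).1 - (φ t z).1) - 1 * (H w - H z)‖ ≤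
        (n * L + M') * D ^ 2 * ‖v‖ ^ 2 := by
      intro t ht
      have ht' : |t| ≤ 1 := by rw [abs_of_nonneg ht.1]; exact ht.2
      have h1 := hLM'.quad _ (hzS t) _ (hwS t)
      rw [hH.fderiv_apply, hφ.energy hH, hφ.energy hH] at h1
      have h2 := hLM.lip _ (hzS t) _ (hwS t)
      have h3 := hd t ht'
      rw [← hwG t]
      set a := φ t w
      set b := φ t z
      have e : dotP n (a.2 - b.2) (hamVF n H a).1 - dotP n (hamVF n H b).2 (a.1 - b.1) -
          1 * (H w - H z) = dotP n (a.2 - b.2) ((hamVF n H a - hamVF n H b).1) -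
          (H w - H z - (dotP n (a - b).2 (hamVF n H b).1 - dotP n (a - b).1 (hamVF n H b).2)) := by
        simp only [Prod.fst_sub, Prod.snd_sub, dotP_sub, sub_dotP, dotP_comm (hamVF n H b).2]
        ring
      rw [e]
      calc _ ≤ n * (D * ‖v‖) * (L * (D * ‖v‖)) + M' * (D * ‖v‖) ^ 2 := by
            refine (norm_sub_le _ _).trans (add_le_add ((abs_dotP_le _ _).trans ?_) (h1.trans ?_))
            · have := (norm_snd_le (a - b)).trans h3
              rw [Prod.snd_sub] at this
              have := (norm_fst_le (hamVF n H a - hamVF n H b)).trans (h2.trans (show _ ≤ L * (D * ‖v‖)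
                by gcongr))
              gcongr
            · gcongr
        _ = _ := by ring
    have := (convex_Icc (0 : ℝ) 1).norm_image_sub_le_of_norm_hasDerivWithin_le
      (fun s _ => (hg2 s).hasDerivWithinAt) hbd (x := 0) (y := 1) (by simp) (by simp)
    simp only [one_mul, zero_mul, sub_zero, norm_one, mul_one, Real.norm_eq_abs] at this
    have h1 := abs_le.mp (hgb 0 (by simp))
    have h2 := abs_le.mp (hgb 1 (by simp))
    have h3 := abs_le.mp this
    rw [abs_le]
    constructor <;> nlinarith
  have hder : ∀ x : E n, HasFDerivAt (fun x => H (x, F (x, c))) (0 : E n →L[ℝ] ℝ) x := fun x =>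
    hasFDerivAt_of_quadratic fun v _ => by
      simpa using key x v
  exact is_const_of_fderiv_eq_zero (fun x => (hder x).differentiableAt)
    (fun x => (hder x).fderiv) x y

end IsFoliation

end

section

variable {n : ℕ} {H : E n × E n → ℝ} {φ : ℝ → E n × E n → E n × E n}
  {F : E n × E n → E n} {u : E n → E n → ℝ}

theorem exists_max_of_periodic {g : E n → ℝ} (hc : Continuous g)
    (hg : ∀ x (m : Fin n → ℤ), g (x + intVec m) = g x) : ∃ x, ∀ y, g y ≤ g x := by
  obtain ⟨x, -, hx⟩ := (isCompact_closedBall (0 : E n) 1).exists_isMaxOn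
    ⟨0, by simp⟩ hc.continuousOn
  refine ⟨x, fun y => ?_⟩
  obtain ⟨m, hm⟩ := exists_intVec_add_mem y
  rw [← hg y m]
  exact hx (by simpa using hm)

namespace IsFoliation

theorem exists_sub_eq (hF : IsFoliation n φ F u) (c c' : E n) :
    ∃ x, F (x, c) - F (x, c') = c - c' := by
  obtain ⟨x, hx⟩ := exists_max_of_periodic (g := fun x => u c x - u c' x)
    ((hF.contDiff c).continuous.sub (hF.contDiff c').continuous)
    (fun x m => by rw [hF.periodic, hF.periodic])
  have h0 : IsLocalMax (fun x => u c x - u c' x) x := Eventually.of_forall hx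
  have h1 := h0.hasFDerivAt_eq_zero ((hF.hasFDerivAt_u c x).sub (hF.hasFDerivAt_u c' x))
  rw [← map_sub] at h1
  have h2 : gradF n (u c) x - gradF n (u c') x = 0 := by
    funext i
    have := congrArg (fun f => f (Pi.single i 1)) h1
    simpa [dotP, Pi.single_apply] using this
  refine ⟨x, ?_⟩
  rw [hF.eq_grad, hF.eq_grad, add_sub_add_comm, h2, add_zero]

theorem exists_eq_self (hF : IsFoliation n φ F u) (c : E n) : ∃ x, F (x, c) = c := by
  obtain ⟨x, hx⟩ := exists_max_of_periodic (hF.contDiff c).continuous (hF.periodic c)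
  have h0 : IsLocalMax (u c) x := Eventually.of_forall hx
  have h1 := h0.hasFDerivAt_eq_zero (hF.hasFDerivAt_u c x)
  have h2 : gradF n (u c) x = 0 := by
    funext i
    have := congrArg (fun f => f (Pi.single i 1)) h1
    simpa [dotP, Pi.single_apply] using this
  exact ⟨x, by rw [hF.eq_grad, h2, add_zero]⟩

/-- The parameter of the leaf through a point. -/
def leaf (hF : IsFoliation n φ F u) (z : E n × E n) : E n := (hF.existsUnique z).choose

theorem snd_eq (hF : IsFoliation n φ F u) (z : E n × E n) : z.2 = F (z.1, hF.leaf z) :=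
  (hF.existsUnique z).choose_spec.1

theorem leaf_eq (hF : IsFoliation n φ F u) {z : E n × E n} {c : E n} (h : z.2 = F (z.1, c)) :
    hF.leaf z = c := (hF.existsUnique z).unique (hF.snd_eq z) h

theorem leaf_flow (hF : IsFoliation n φ F u) (t : ℝ) (z : E n × E n) :
    hF.leaf (φ t z) = hF.leaf z := hF.leaf_eq (hF.flow_mem (hF.snd_eq z) t)

theorem leaf_translate (hF : IsFoliation n φ F u) (z : E n × E n) (m : Fin n → ℤ) :
    hF.leaf (z + (intVec m, 0)) = hF.leaf z := hF.leaf_eq (by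
  simp only [Prod.fst_add, Prod.snd_add, add_zero, hF.F_periodic]
  exact hF.snd_eq z)

theorem energy_leaf (hH : IsTonelliHamiltonian n 3 H) (hφ : IsHamFlow n H φ)
    (hF : IsFoliation n φ F u) (z : E n × E n) (x : E n) : H (x, F (x, hF.leaf z)) = H z := by
  rw [hF.energy_const hH hφ _ x z.1, ← hF.snd_eq]

theorem exists_bound_leaf (hH : IsTonelliHamiltonian n 3 H) (hφ : IsHamFlow n H φ)
    (hF : IsFoliation n φ F u) (h : ℝ) :
    ∃ R, 0 ≤ R ∧ ∀ z, H z ≤ h → ‖hF.leaf z‖ ≤ R ∧ ∀ x, ‖F (x, hF.leaf z)‖ ≤ R := by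
  obtain ⟨R, hR0, hR⟩ := hH.sublevel_subset_slab h
  refine ⟨R, hR0, fun z hz => ?_⟩
  have h1 : ∀ x, ‖F (x, hF.leaf z)‖ ≤ R := fun x =>
    hR (x, F (x, hF.leaf z)) (by rwa [hF.energy_leaf hH hφ])
  obtain ⟨x, hx⟩ := hF.exists_eq_self (hF.leaf z)
  refine ⟨?_, h1⟩
  have := h1 x
  rwa [hx] at this

theorem abs_u_sub_le (hF : IsFoliation n φ F u) {c : E n} {R : ℝ} (hR : ∀ x, ‖F (x, c)‖ ≤ R)
    (x y : E n) : |u c y - u c x| ≤ n * (2 * R) := by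
  have hc : ‖c‖ ≤ R := by
    obtain ⟨x, hx⟩ := hF.exists_eq_self c
    have := hR x
    rwa [hx] at this
  have hR0 : 0 ≤ R := (norm_nonneg _).trans hc
  have hb : ∀ x ∈ (Set.univ : Set (E n)), ‖dotL n (gradF n (u c) x)‖ ≤ n * (2 * R) := by
    intro x _
    refine ContinuousLinearMap.opNorm_le_bound _ (by positivity) fun v => ?_
    rw [dotL_apply]
    refine (abs_dotP_le _ _).trans ?_
    have h1 : gradF n (u c) x = F (x, c) - c := by rw [hF.eq_grad, add_sub_cancel_left]
    have h2 : ‖gradF n (u c) x‖ ≤ 2 * R := by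
      rw [h1]
      exact (norm_sub_le _ _).trans (by linarith [hR x])
    gcongr
  obtain ⟨m, hm⟩ := exists_intVec_add_mem (y - x)
  have h := convex_univ.norm_image_sub_le_of_norm_hasFDerivWithin_le
    (fun x _ => (hF.hasFDerivAt_u c x).hasFDerivWithinAt) hb (Set.mem_univ x)
    (Set.mem_univ (y + intVec m))
  rw [hF.periodic] at h
  refine h.trans ?_
  rw [add_sub_right_comm]
  exact mul_le_of_le_one_right (by positivity) hm

end IsFoliation

end

section

variable {n : ℕ} {H : E n × E n → ℝ} {φ : ℝ → E n × E n → E n × E n}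
  {F : E n × E n → E n} {u : E n → E n → ℝ}

namespace IsFoliation

/-- Strict convexity defect of `H` between a point and the leaf `c` above it. -/
def defect (H : E n × E n → ℝ) (F : E n × E n → E n) (c : E n) (z : E n × E n) : ℝ :=
  H (z.1, F (z.1, c)) - H z - dotP n (F (z.1, c) - z.2) (hamVF n H z).1

theorem defect_nonneg (hH : IsTonelliHamiltonian n 3 H) (c : E n) (z : E n × E n) :
    0 ≤ defect H F c z := by
  have := hH.le_of_convex z.1 z.2 (F (z.1, c))
  simp only [defect]
  linarith

theorem eq_of_defect_eq_zero (hH : IsTonelliHamiltonian n 3 H) {c : E n} {z : E n × E n}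
    (h : defect H F c z = 0) : z.2 = F (z.1, c) := by
  by_contra hne
  have := hH.lt_of_ne z.1 (p := z.2) (q := F (z.1, c)) (Ne.symm hne)
  simp only [defect] at h
  linarith

theorem continuous_defect (hH : IsTonelliHamiltonian n 3 H) (hF : IsFoliation n φ F u) (c : E n) :
    Continuous (defect H F c) := by
  have h1 : Continuous fun z : E n × E n => F (z.1, c) :=
    (hF.continuous_F c).comp continuous_fst
  have h2 : Continuous fun z : E n × E n => (hamVF n H z).1 :=
    continuous_fst.comp hH.contDiff_hamVF.continuous
  have h3 := hH.smooth.continuous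
  exact ((h3.comp (continuous_fst.prodMk h1)).sub h3).sub
    (Continuous.dotP (h1.sub continuous_snd) h2)

theorem defect_translate (hH : IsTonelliHamiltonian n 3 H) (hF : IsFoliation n φ F u) (c : E n)
    (z : E n × E n) (m : Fin n → ℤ) : defect H F c (z + (intVec m, 0)) = defect H F c z := by
  have h1 := hH.periodic' z m
  simp only [defect, hH.periodic_hamVF z m, h1, Prod.fst_add, Prod.snd_add, hF.F_periodic,
    add_zero, hH.periodic]

/-- Comparison, along an orbit, of the primitive of the leaf of the orbit with the primitive of
another leaf. -/
theorem exists_defect_le (hH : IsTonelliHamiltonian n 3 H) (hφ : IsHamFlow n H φ)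
    (hF : IsFoliation n φ F u) (c z : _) {R B T : ℝ} (hT : 0 < T)
    (hc : ∀ x, ‖F (x, c)‖ ≤ R) (hz : ∀ x, ‖F (x, hF.leaf z)‖ ≤ R)
    (hB : ∀ w ∈ slab n R, ‖hamVF n H w‖ ≤ B) :
    ∃ s ∈ Set.Icc 0 T, T * defect H F c (φ s z) ≤
      n * ‖hF.leaf z - c‖ * (B * T) + 2 * (n * (2 * R)) + |H (0, F (0, c)) - H z| * T := by
  set c' := hF.leaf z with hc'
  have hG : ∀ t, (φ t z).2 = F ((φ t z).1, c') := fun t => hF.flow_mem (hF.snd_eq z) t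
  have hS : ∀ t, φ t z ∈ slab n R := fun t => by
    change ‖(φ t z).2‖ ≤ R
    rw [hG]; exact hz _
  let g : ℝ → ℝ := fun s => primitive n u c' (φ s z).1 - primitive n u c (φ s z).1
  have hg : ∀ s, HasDerivAt g (defect H F c (φ s z) - (H (0, F (0, c)) - H z)) s := by
    intro s
    have h := (hF.hasDerivAt_primitive c' (hφ.2 z s).fst).sub
      (hF.hasDerivAt_primitive c (hφ.2 z s).fst)
    refine h.congr_deriv ?_
    rw [← hG, defect, hφ.energy hH, hF.energy_const hH hφ c 0 (φ s z).1, sub_dotP]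
    ring
  obtain ⟨s, hs, hsl⟩ := exists_hasDerivAt_eq_slope g _ hT
    (fun s _ => (hg s).continuousAt.continuousWithinAt) (fun s _ => hg s)
  refine ⟨s, ⟨hs.1.le, hs.2.le⟩, ?_⟩
  have hfst : ∀ s, HasDerivAt (fun s => (φ s z).1) (hamVF n H (φ s z)).1 s :=
    fun s => (hφ.2 z s).fst
  have hdisp : ‖(φ T z).1 - (φ 0 z).1‖ ≤ B * T := by
    have := (convex_Icc (0 : ℝ) T).norm_image_sub_le_of_norm_hasDerivWithin_le
      (fun s _ => (hfst s).hasDerivWithinAt)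
      (fun s _ => (norm_fst_le _).trans (hB _ (hS s)))
      (Set.left_mem_Icc.mpr hT.le) (Set.right_mem_Icc.mpr hT.le)
    rwa [sub_zero, Real.norm_of_nonneg hT.le] at this
  have e : g T - g 0 = dotP n (c' - c) ((φ T z).1 - (φ 0 z).1) +
      (u c' (φ T z).1 - u c' (φ 0 z).1) - (u c (φ T z).1 - u c (φ 0 z).1) := by
    simp only [g, primitive, dotP_sub, sub_dotP]
    ring
  have h1 := (abs_le.mp (hF.abs_u_sub_le hz (φ 0 z).1 (φ T z).1)).2
  have h2 := (abs_le.mp (hF.abs_u_sub_le hc (φ 0 z).1 (φ T z).1)).1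
  have h3 : dotP n (c' - c) ((φ T z).1 - (φ 0 z).1) ≤ n * ‖c' - c‖ * (B * T) :=
    (le_abs_self _).trans ((abs_dotP_le _ _).trans (by gcongr))
  have h4 : T * (H (0, F (0, c)) - H z) ≤ |H (0, F (0, c)) - H z| * T := by
    rw [mul_comm]; gcongr; exact le_abs_self _
  rw [sub_zero, eq_div_iff hT.ne'] at hsl
  have : T * defect H F c (φ s z) = g T - g 0 + T * (H (0, F (0, c)) - H z) := by
    rw [← hsl]; ring
  rw [this, e]
  linarith

theorem leaf_eq_of_tendsto (hH : IsTonelliHamiltonian n 3 H) (hφ : IsHamFlow n H φ)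
    (hF : IsFoliation n φ F u) {h : ℝ} {z : ℕ → E n × E n} {w : E n × E n} {c : E n}
    (hb : ∀ j, H (z j) ≤ h) (hz : Tendsto z atTop (nhds w))
    (hc : Tendsto (fun j => hF.leaf (z j)) atTop (nhds c)) : hF.leaf w = c := by
  have hHc := hH.smooth.continuous
  obtain ⟨R₁, hR₁, hR⟩ := hF.exists_bound_leaf hH hφ h
  obtain ⟨R₂, hR₂, hRc⟩ := hF.exists_bound_F c
  set R := max R₁ R₂ with hRdef
  have hR0 : 0 ≤ R := hR₁.trans (le_max_left _ _)
  have hFz : ∀ j x, ‖F (x, hF.leaf (z j))‖ ≤ R := fun j x =>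
    ((hR _ (hb j)).2 x).trans (le_max_left _ _)
  have hFc : ∀ x, ‖F (x, c)‖ ≤ R := fun x => (hRc x).trans (le_max_right _ _)
  have hw : H w ≤ h := le_of_tendsto' ((hHc.tendsto w).comp hz) hb
  have hFw : ∀ x, ‖F (x, hF.leaf w)‖ ≤ R := fun x => ((hR w hw).2 x).trans (le_max_left _ _)
  have hmem : ∀ {y : E n × E n}, (∀ x, ‖F (x, hF.leaf y)‖ ≤ R) → ∀ t, φ t y ∈ slab n R := by
    intro y hy t
    change ‖(φ t y).2‖ ≤ R
    rw [hF.flow_mem (hF.snd_eq y) t]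
    exact hy _
  obtain ⟨B, hB0, hB⟩ := hH.periodic_hamVF.exists_bound hH.contDiff_hamVF.continuous R
  obtain ⟨L, M, hLM⟩ := hH.periodic_hamVF.exists_fieldBounds hH.contDiff_hamVF R
  obtain ⟨L', M', hLM'⟩ := hH.periodic'.exists_fieldBounds (hH.smooth.of_le (by norm_num)) R
  have hL0 := hLM.L_nonneg
  have hcd : Tendsto (fun j => ‖hF.leaf (z j) - c‖) atTop (nhds 0) := by
    have := (hc.sub_const c).norm
    rwa [sub_self, norm_zero] at this
  have hzd : Tendsto (fun j => ‖z j - w‖) atTop (nhds 0) := by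
    have := (hz.sub_const w).norm
    rwa [sub_self, norm_zero] at this
  have hα : Tendsto (fun j => |H (0, F (0, c)) - H (z j)|) atTop (nhds 0) := by
    refine squeeze_zero (fun _ => abs_nonneg _) (fun j => ?_)
      (by simpa using hcd.const_mul L')
    obtain ⟨x, hx⟩ := hF.exists_sub_eq (hF.leaf (z j)) c
    rw [hF.energy_const hH hφ c 0 x, ← hF.energy_leaf hH hφ (z j) x, abs_sub_comm]
    refine (hLM'.lip (x, F (x, c)) (hFc x) (x, F (x, hF.leaf (z j))) (hFz j x)).trans ?_
    rw [Prod.mk_sub_mk, sub_self, hx, Prod.norm_mk, norm_zero, max_eq_right (norm_nonneg _)]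
  have hsel : ∀ k : ℕ, ∃ a b : E n × E n, a ∈ slab n R ∧ a.2 = F (a.1, hF.leaf w) ∧
      ‖b - a‖ ≤ 1 / ((k : ℝ) + 1) ∧
      defect H F c b ≤ (2 + 2 * (n * (2 * R))) * (1 / ((k : ℝ) + 1)) := by
    intro k
    set T : ℝ := (k : ℝ) + 1 with hTdef
    have hT : 0 < T := by positivity
    have e1 : ∀ᶠ j in atTop, n * ‖hF.leaf (z j) - c‖ * (B * T) < 1 := by
      have := (hcd.const_mul (n : ℝ)).mul_const (B * T)
      rw [mul_zero, zero_mul] at this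
      exact this.eventually_lt_const one_pos
    have e2 : ∀ᶠ j in atTop, |H (0, F (0, c)) - H (z j)| * T < 1 := by
      have := hα.mul_const T
      rw [zero_mul] at this
      exact this.eventually_lt_const one_pos
    have e3 : ∀ᶠ j in atTop, ‖z j - w‖ * Real.exp (L * T) < 1 / T := by
      have := hzd.mul_const (Real.exp (L * T))
      rw [zero_mul] at this
      exact this.eventually_lt_const (by positivity)
    obtain ⟨j, h1, h2, h3⟩ := (e1.and (e2.and e3)).exists
    obtain ⟨s, hs, hle⟩ := hF.exists_defect_le hH hφ c (z j) hT hFc (hFz j) hB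
    refine ⟨φ s w, φ s (z j), hmem hFw s, hF.flow_mem (hF.snd_eq w) s, ?_, ?_⟩
    · have := hLM.norm_sub_le (hφ.2 (z j)) (hφ.2 w) (hmem (hFz j)) (hmem hFw)
        (t := s) (T := T) (by rw [abs_of_nonneg hs.1]; exact hs.2)
      rw [hφ.1, hφ.1] at this
      exact this.trans h3.le
    · rw [mul_one_div, le_div_iff₀ hT, mul_comm]
      linarith
  choose a b ha haF hab hbd using hsel
  obtain ⟨ζ, hζ, m, s, hs, hlim⟩ := exists_tendsto_translate ha
  have hone : Tendsto (fun k => 1 / ((s k : ℝ) + 1)) atTop (nhds 0) :=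
    tendsto_one_div_add_atTop_nhds_zero_nat.comp hs.tendsto_atTop
  have hlimb : Tendsto (fun k => b (s k) + (intVec (m (s k)), 0)) atTop (nhds ζ) := by
    have h0 : Tendsto (fun k => b (s k) - a (s k)) atTop (nhds 0) :=
      squeeze_zero_norm (fun k => hab (s k)) hone
    have := hlim.add h0
    rw [add_zero] at this
    refine this.congr fun k => ?_
    abel
  have h1 : hF.leaf ζ = c := by
    refine hF.leaf_eq (eq_of_defect_eq_zero hH ?_)
    refine tendsto_nhds_unique (((hF.continuous_defect hH c).tendsto ζ).comp hlimb)
      (squeeze_zero (fun k => defect_nonneg hH _ _) (fun k => ?_)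
        (by rw [← mul_zero]; exact hone.const_mul (2 + 2 * (n * (2 * R)))))
    simp only [Function.comp_apply, hF.defect_translate hH]
    exact hbd (s k)
  have h2 : hF.leaf ζ = hF.leaf w := by
    refine hF.leaf_eq (tendsto_nhds_unique ((continuous_snd.tendsto ζ).comp hlim) ?_)
    refine ((((hF.continuous_F (hF.leaf w)).comp continuous_fst).tendsto ζ).comp hlim).congr
      fun k => ?_
    simp only [Function.comp_apply, Prod.fst_add, Prod.snd_add, add_zero, hF.F_periodic]
    exact (haF _).symm
  rw [← h2, h1]

/-- The leaf parameter is uniformly continuous on slabs. -/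
theorem tendsto_leaf_sub (hH : IsTonelliHamiltonian n 3 H) (hφ : IsHamFlow n H φ)
    (hF : IsFoliation n φ F u) {R : ℝ} {a b : ℕ → E n × E n} (ha : ∀ k, a k ∈ slab n R)
    (hb : ∀ k, b k ∈ slab n R) (hab : Tendsto (fun k => b k - a k) atTop (nhds 0)) :
    Tendsto (fun k => hF.leaf (b k) - hF.leaf (a k)) atTop (nhds 0) := by
  obtain ⟨h, hh⟩ := hH.slab_subset_sublevel R
  obtain ⟨R', -, hR'⟩ := hF.exists_bound_leaf hH hφ h
  refine tendsto_of_subseq_tendsto fun ns hns => ?_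
  obtain ⟨ζ, -, m, s, hs, hlim⟩ := exists_tendsto_translate fun k => ha (ns k)
  have hlimb : Tendsto (fun k => b (ns (s k)) + (intVec (m (s k)), 0)) atTop (nhds ζ) := by
    have := hlim.add (hab.comp (hns.comp hs.tendsto_atTop))
    rw [add_zero] at this
    refine this.congr fun k => ?_
    simp only [Function.comp_apply]
    abel
  have hball : ∀ k, (hF.leaf (a (ns (s k))), hF.leaf (b (ns (s k)))) ∈
      (Metric.closedBall 0 R' ×ˢ Metric.closedBall 0 R' : Set (E n × E n)) := fun k =>
    ⟨by simpa using (hR' _ (hh _ (ha _))).1, by simpa using (hR' _ (hh _ (hb _))).1⟩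
  obtain ⟨⟨c₁, c₂⟩, -, r, hr, hc⟩ := ((isCompact_closedBall (0 : E n) R').prod
    (isCompact_closedBall (0 : E n) R')).tendsto_subseq hball
  have hc₁ := (continuous_fst.tendsto _).comp hc
  have hc₂ := (continuous_snd.tendsto _).comp hc
  refine ⟨fun k => s (r k), ?_⟩
  have e₁ : hF.leaf ζ = c₁ := hF.leaf_eq_of_tendsto hH hφ (h := h)
    (fun k => (hH.periodic' _ _).trans_le (hh _ (ha _))) (hlim.comp hr.tendsto_atTop)
    (hc₁.congr fun k => (hF.leaf_translate _ _).symm)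
  have e₂ : hF.leaf ζ = c₂ := hF.leaf_eq_of_tendsto hH hφ (h := h)
    (fun k => (hH.periodic' _ _).trans_le (hh _ (hb _))) (hlimb.comp hr.tendsto_atTop)
    (hc₂.congr fun k => (hF.leaf_translate _ _).symm)
  have := hc₂.sub hc₁
  rw [← e₁, ← e₂, sub_self] at this
  exact this

end IsFoliation

end

section

/-- Quadratic closeness of a backward orbit to its linearization when the linearized orbit
contracts and the nonlinearity is quadratic. -/
theorem exists_norm_sub_le_sq {W : Type*} [NormedAddCommGroup W] [NormedSpace ℝ W]
    {D M a b : ℝ} (hD : 0 ≤ D) (hM : 0 ≤ M) (ha : 0 ≤ a) (ha1 : a ≤ 1) (hb : 0 ≤ b)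
    (hab : a ^ 2 * b < 1) :
    ∃ C r₀ : ℝ, 0 ≤ C ∧ 0 < r₀ ∧ ∀ (L : ℕ → ℕ → W →L[ℝ] W) (w d : ℕ → W) (N : ℕ) (r : ℝ),
      |r| ≤ r₀ → (∀ k v, L k k v = v) → (∀ k i v, L k (k + i) (L (k + i) (k + i + 1) v) =
        L k (k + (i + 1)) v) →
      (∀ k i, ‖L k (k + i)‖ ≤ D * b ^ i) → (∀ j, L j (j + 1) (w (j + 1)) = w j) →
      (∀ j, ‖w j‖ ≤ D * a ^ j) →
      (∀ j, ‖d (j + 1)‖ ≤ 1 → ‖d j - L j (j + 1) (d (j + 1))‖ ≤ M * ‖d (j + 1)‖ ^ 2) →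
      d N = r • w N → ∀ j ≤ N, ‖d j - r • w j‖ ≤ C * r ^ 2 := by
  set θ := a ^ 2 * b with hθ
  have hθ0 : 0 ≤ θ := by positivity
  set S := (1 - θ)⁻¹ with hS
  have hS0 : 0 ≤ S := by rw [hS, inv_nonneg]; linarith
  have hSθ : S * θ + 1 = S := by
    have : S * (1 - θ) = 1 := inv_mul_cancel₀ (by linarith)
    linarith
  set P := 4 * M * D ^ 3 * S with hP
  have hP0 : 0 ≤ P := by positivity
  refine ⟨P, 1 / (4 * M * D ^ 2 * S + 2 * D + 1), hP0, by positivity,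
    fun L w d N r hr hLid hLadd hLb hLw hw hd hN => ?_⟩
  have hr0 := abs_nonneg r
  rw [le_div_iff₀ (by positivity)] at hr
  have hr1 : |r| * (4 * M * D ^ 2 * S) ≤ 1 := by
    refine le_trans (mul_le_mul_of_nonneg_left ?_ hr0) hr
    linarith
  have hr2 : |r| * (2 * D) ≤ 1 := by
    refine le_trans (mul_le_mul_of_nonneg_left ?_ hr0) hr
    have : 0 ≤ 4 * M * D ^ 2 * S := by positivity
    linarith
  have hapow : ∀ j, a ^ j ≤ 1 := fun j => pow_le_one₀ ha ha1
  have main : ∀ m j, j ≤ N → N ≤ j + m → ‖d j‖ ≤ 2 * D * |r| * a ^ j ∧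
      ‖d j - r • w j‖ ≤ P * r ^ 2 * a ^ j := by
    intro m
    induction m with
    | zero =>
      intro j h1 h2
      obtain rfl : j = N := by omega
      rw [hN, sub_self, norm_zero, norm_smul, Real.norm_eq_abs]
      refine ⟨?_, by positivity⟩
      have := mul_le_mul_of_nonneg_left (hw j) hr0
      have h3 : 0 ≤ |r| * (D * a ^ j) := by positivity
      linarith
    | succ m ih =>
      intro k h1 h2
      by_cases hk : N ≤ k + m
      · exact ih k h1 hk
      have hgood : ∀ j, k < j → j ≤ N → ‖d j‖ ≤ 2 * D * |r| * a ^ j := fun j h3 h4 =>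
        (ih j h4 (by omega)).1
      have hinner : ∀ l i, k + i + l = N → ‖L k (k + i) (d (k + i) - r • w (k + i))‖ ≤
          P * r ^ 2 * (a ^ 2) ^ k * θ ^ i := by
        intro l
        induction l with
        | zero =>
          intro i h3
          rw [add_zero] at h3
          rw [h3, hN, sub_self, map_zero, norm_zero]
          positivity
        | succ l ihl =>
          intro i h3
          have h4 := ihl (i + 1) (by omega)
          have h5 := hgood (k + i + 1) (by omega) (by omega)
          have h6 : ‖d (k + i + 1)‖ ≤ 1 := h5.trans (by
            have := mul_le_of_le_one_right (show 0 ≤ 2 * D * |r| by positivity)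
              (hapow (k + i + 1))
            linarith)
          have h7 := hd (k + i) h6
          set q := d (k + i) - L (k + i) (k + i + 1) (d (k + i + 1)) with hq
          have h8 : ‖q‖ ≤ 4 * M * D ^ 2 * r ^ 2 * (a ^ 2) ^ (k + i) := by
            refine h7.trans ?_
            calc M * ‖d (k + i + 1)‖ ^ 2 ≤ M * (2 * D * |r| * a ^ (k + i + 1)) ^ 2 := by gcongr
              _ = 4 * M * D ^ 2 * r ^ 2 * (a ^ 2) ^ (k + i) * a ^ 2 := by
                rw [← sq_abs r]; ring
              _ ≤ 4 * M * D ^ 2 * r ^ 2 * (a ^ 2) ^ (k + i) :=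
                mul_le_of_le_one_right (by positivity) (hapow 2)
          have h9 : L k (k + i) (d (k + i) - r • w (k + i)) =
              L k (k + (i + 1)) (d (k + (i + 1)) - r • w (k + (i + 1))) + L k (k + i) q := by
            have h10 : d (k + i) - r • w (k + i) =
                L (k + i) (k + i + 1) (d (k + i + 1) - r • w (k + i + 1)) + q := by
              rw [map_sub, map_smul, hLw, hq]
              abel
            rw [h10, map_add, hLadd]
            rfl
          rw [h9]
          refine (norm_add_le _ _).trans ?_
          have h10 : ‖L k (k + i) q‖ ≤ D * b ^ i * (4 * M * D ^ 2 * r ^ 2 * (a ^ 2) ^ (k + i)) :=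
            ((L k (k + i)).le_opNorm q).trans (by gcongr; exact hLb k i)
          refine (add_le_add h4 h10).trans_eq ?_
          have h11 : θ ^ i = (a ^ 2) ^ i * b ^ i := by rw [hθ, mul_pow]
          calc _ = 4 * M * D ^ 3 * r ^ 2 * (a ^ 2) ^ k * θ ^ i * (S * θ + 1) := by
                rw [hP, pow_succ θ, pow_add (a ^ 2)]
                linear_combination (-4 * M * D ^ 3 * r ^ 2 * (a ^ 2) ^ k) * h11
            _ = _ := by rw [hSθ, hP]; ring
      have he := hinner (N - k) 0 (by omega)
      simp only [add_zero, hLid, pow_zero, mul_one] at he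
      have he' : ‖d k - r • w k‖ ≤ P * r ^ 2 * a ^ k := by
        refine he.trans ?_
        rw [← pow_mul, mul_comm 2 k, pow_mul, sq (a ^ k), ← mul_assoc]
        exact mul_le_of_le_one_right (by positivity) (hapow k)
      refine ⟨?_, he'⟩
      have h3 : ‖d k‖ ≤ ‖r • w k‖ + ‖d k - r • w k‖ := by
        simpa using norm_add_le (r • w k) (d k - r • w k)
      rw [norm_smul, Real.norm_eq_abs] at h3
      have h4 := mul_le_mul_of_nonneg_left (hw k) hr0
      have h5 : P * r ^ 2 * a ^ k ≤ D * |r| * a ^ k := by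
        refine mul_le_mul_of_nonneg_right ?_ (by positivity)
        rw [hP, ← sq_abs r]
        calc _ = D * |r| * (|r| * (4 * M * D ^ 2 * S)) := by ring
          _ ≤ D * |r| * 1 := by gcongr
          _ = _ := mul_one _
      linarith
  intro j hj
  refine ((main N j hj (by omega)).2).trans ?_
  exact mul_le_of_le_one_right (by positivity) (hapow j)

variable {n : ℕ} {H : E n × E n → ℝ} {φ : ℝ → E n × E n → E n × E n}
  {F : E n × E n → E n} {u : E n → E n → ℝ}

/-- A leaf is tangent to second order to every sufficiently contracted direction. -/
theorem IsFoliation.exists_tangent (hH : IsTonelliHamiltonian n 3 H) (hφ : IsHamFlow n H φ)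
    (hF : IsFoliation n φ F u) {ζ w : E n × E n} {σ D a b : ℝ} (hD : 0 ≤ D) (ha : 0 ≤ a)
    (ha1 : a < 1) (hb : 0 ≤ b) (hab : a ^ 2 * b < 1)
    (hw : ∀ j : ℕ, ‖fderiv ℝ (φ (σ * j)) ζ w‖ ≤ D * a ^ j)
    (hg : ∀ z, H z ≤ H ζ → ∀ j : ℕ, ‖fderiv ℝ (φ (-(σ * j))) z‖ ≤ D * b ^ j) :
    ∃ C r₀ : ℝ, 0 ≤ C ∧ 0 < r₀ ∧ ∀ r, |r| ≤ r₀ →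
      ‖F (ζ.1 + r • w.1, hF.leaf ζ) - (ζ.2 + r • w.2)‖ ≤ C * r ^ 2 := by
  obtain ⟨M, hM0, hM⟩ := hφ.exists_expansion hH (H ζ) |σ|
  obtain ⟨C, r₀, hC0, hr₀, hsh⟩ := exists_norm_sub_le_sq (W := E n × E n) hD hM0 ha ha1.le hb hab
  obtain ⟨K, hK0, hK⟩ := hF.lipschitz_F (hF.leaf ζ)
  obtain ⟨R, hR0, hR⟩ := hH.sublevel_subset_slab (H ζ)
  refine ⟨(K + 1) * C, min r₀ (1 / (D + 1)), by positivity, by positivity, fun r hr => ?_⟩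
  have hr1 : |r| * D ≤ 1 := by
    have := hr.trans (min_le_right _ _)
    rw [le_div_iff₀ (by positivity)] at this
    nlinarith [abs_nonneg r]
  replace hr := hr.trans (min_le_left _ _)
  set p : ℕ → E n × E n := fun N => φ (σ * N) ζ with hp
  set w' : ℕ → E n × E n := fun N => fderiv ℝ (φ (σ * N)) ζ w with hw'
  set q : ℕ → E n × E n := fun N => p N + r • w' N with hq
  have hHp : ∀ N, H (p N) = H ζ := fun N => hφ.energy hH _ _
  have hpS : ∀ N, p N ∈ slab n (R + 1) := fun N =>
    le_trans (show ‖(p N).2‖ ≤ R from hR (p N) (hHp N).le) (by linarith)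
  have hq1 : ∀ N, ‖r • w' N‖ ≤ a ^ N := fun N => by
    rw [norm_smul, Real.norm_eq_abs]
    calc |r| * ‖w' N‖ ≤ |r| * (D * a ^ N) := by gcongr; exact hw N
      _ = |r| * D * a ^ N := by ring
      _ ≤ 1 * a ^ N := by gcongr
      _ = _ := one_mul _
  have hqS : ∀ N, q N ∈ slab n (R + 1) := fun N => by
    change ‖(p N).2 + (r • w' N).2‖ ≤ R + 1
    exact (norm_add_le _ _).trans (add_le_add (hR (p N) (hHp N).le)
      ((norm_snd_le _).trans ((hq1 N).trans (pow_le_one₀ ha ha1.le))))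
  have hleaf : Tendsto (fun N => hF.leaf (q N)) atTop (nhds (hF.leaf ζ)) := by
    have h1 : Tendsto (fun N => q N - p N) atTop (nhds 0) := by
      refine squeeze_zero_norm (fun N => ?_) (tendsto_pow_atTop_nhds_zero_of_lt_one ha ha1)
      rw [hq, add_sub_cancel_left]
      exact hq1 N
    have h2 := hF.tendsto_leaf_sub hH hφ hpS hqS h1
    have h3 : ∀ N, hF.leaf (p N) = hF.leaf ζ := fun N => hF.leaf_flow _ _
    simp only [h3] at h2
    have h4 := h2.add_const (hF.leaf ζ)
    simpa using h4
  set y : ℕ → E n × E n := fun N => φ (-(σ * N)) (q N) with hy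
  have hclose : ∀ N, ‖y N - (ζ + r • w)‖ ≤ C * r ^ 2 := by
    intro N
    have key := hsh (fun k j => fderiv ℝ (φ (σ * k - σ * j)) (p j)) w'
      (fun j => φ (σ * j - σ * N) (q N) - p j) N r hr
      (fun k v => by simp only [sub_self, hφ.fderiv_zero]; rfl)
      (fun k i v => by
        have h1 := hφ.fderiv_add hH (σ * k - σ * ↑(k + i)) (σ * ↑(k + i) - σ * ↑(k + i + 1))
          (p (k + i + 1))
        have h2 : φ (σ * ↑(k + i) - σ * ↑(k + i + 1)) (p (k + i + 1)) = p (k + i) := by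
          rw [hp]
          simp only
          rw [← hφ.add hH]; congr 1; ring
        rw [h2, sub_add_sub_cancel] at h1
        exact (congrArg (fun A => A v) h1).symm)
      (fun k i => by
        have h1 := hg (p (k + i)) (hHp _).le i
        have h2 : σ * k - σ * ↑(k + i) = -(σ * i) := by push_cast; ring
        simp only [h2]
        exact h1)
      (fun j => by
        have h1 := hφ.fderiv_add hH (σ * j - σ * ↑(j + 1)) (σ * ↑(j + 1)) ζ
        rw [sub_add_cancel] at h1
        exact (congrArg (fun A => A w) h1).symm)
      hw
      (fun j hj => by
        have h1 : σ * j - σ * ↑(j + 1) = -σ := by push_cast; ring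
        have h2 := ((hM (p (j + 1)) (hHp _).le (-σ) (abs_neg σ).le).2.2 _ hj).2
        have h3 : φ (-σ) (p (j + 1)) = p j := by
          rw [hp]
          simp only
          rw [← hφ.add hH]; congr 1; push_cast; ring
        have h4 : φ (-σ) (φ (σ * ↑(j + 1) - σ * N) (q N)) = φ (σ * j - σ * N) (q N) := by
          rw [← hφ.add hH]; congr 1; push_cast; ring
        rw [add_sub_cancel, h3, h4] at h2
        simp only [h1]
        exact h2)
      (by simp [hφ.1, hq]) 0 (Nat.zero_le _)
    simp only [Nat.cast_zero, mul_zero, zero_sub, hp, hw', hφ.1, hφ.fderiv_zero] at key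
    rw [hy, ← sub_sub]
    exact key
  obtain ⟨h', hh'⟩ := hH.slab_subset_sublevel (n := n) (R + 1)
  obtain ⟨z, hz, s, hs, hlim⟩ := (isCompact_closedBall (ζ + r • w) (C * r ^ 2)).tendsto_subseq
    (x := y) (fun N => by rw [mem_closedBall_iff_norm]; exact hclose N)
  rw [mem_closedBall_iff_norm] at hz
  have hzl : hF.leaf z = hF.leaf ζ := by
    refine hF.leaf_eq_of_tendsto hH hφ (h := h') (fun j => ?_) hlim ?_
    · simp only [Function.comp_apply, hy, hφ.energy hH]
      exact hh' _ (hqS _)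
    · refine (hleaf.comp hs.tendsto_atTop).congr fun j => ?_
      simp only [Function.comp_apply, hy, hF.leaf_flow]
  have hz2 := hF.snd_eq z
  rw [hzl] at hz2
  have h1 := hK z.1 (ζ.1 + r • w.1)
  have h2 : ‖ζ.1 + r • w.1 - z.1‖ ≤ C * r ^ 2 := by
    rw [norm_sub_rev]; exact (norm_fst_le (z - (ζ + r • w))).trans hz
  have h3 : ‖z.2 - (ζ.2 + r • w.2)‖ ≤ C * r ^ 2 := (norm_snd_le (z - (ζ + r • w))).trans hz
  calc _ = ‖(F (ζ.1 + r • w.1, hF.leaf ζ) - F (z.1, hF.leaf ζ)) +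
        (z.2 - (ζ.2 + r • w.2))‖ := by rw [hz2]; congr 1; abel
    _ ≤ K * (C * r ^ 2) + C * r ^ 2 := (norm_add_le _ _).trans
        (add_le_add (h1.trans (by gcongr)) h3)
    _ = _ := by ring

end

section

/-- The error of the trapezoidal rule along a segment. -/
theorem abs_trapezoid_le {V : Type*} [NormedAddCommGroup V] [NormedSpace ℝ V] {g : V → ℝ}
    {S : Set V} {L M : ℝ} (hS : Convex ℝ S) (hg : Differentiable ℝ g)
    (hB : FieldBounds (fderiv ℝ g) (fderiv ℝ (fderiv ℝ g)) S L M) {a b : V} (ha : a ∈ S)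
    (hb : b ∈ S) :
    |g b - g a - (fderiv ℝ g a (b - a) + fderiv ℝ g b (b - a)) / 2| ≤ 2 * M * ‖b - a‖ ^ 3 := by
  set v := b - a with hv
  have hM0 := hB.M_nonneg
  have hl : ∀ s : ℝ, HasDerivAt (fun s : ℝ => a + s • v) v s := fun s => by
    simpa using ((hasDerivAt_id s).smul_const v).const_add a
  let e : ℝ → ℝ := fun s => g (a + s • v) - s * fderiv ℝ g a v -
    s ^ 2 * ((fderiv ℝ g b v - fderiv ℝ g a v) / 2)
  have he : ∀ s : ℝ, HasDerivAt e (fderiv ℝ g (a + s • v) v - 1 * fderiv ℝ g a v -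
      (2 * s) * ((fderiv ℝ g b v - fderiv ℝ g a v) / 2)) s := fun s => by
    have h1 := (hg (a + s • v)).hasFDerivAt.comp_hasDerivAt s (hl s)
    have h2 := (hasDerivAt_id s).mul_const (fderiv ℝ g a v)
    have h3 := (hasDerivAt_pow 2 s).mul_const ((fderiv ℝ g b v - fderiv ℝ g a v) / 2)
    refine ((h1.sub h2).sub h3).congr_deriv ?_
    norm_num
  have hbd : ∀ s ∈ Set.Icc (0 : ℝ) 1, ‖fderiv ℝ g (a + s • v) v - 1 * fderiv ℝ g a v -
      (2 * s) * ((fderiv ℝ g b v - fderiv ℝ g a v) / 2)‖ ≤ 2 * M * ‖v‖ ^ 3 := by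
    intro s hs
    have hmem : a + s • v ∈ S := hS.add_smul_sub_mem ha hb hs
    have h1 := hB.quad a ha _ hmem
    have h2 := hB.quad a ha b hb
    rw [add_sub_cancel_left, norm_smul, Real.norm_of_nonneg hs.1] at h1
    rw [← hv] at h2
    set P := fderiv ℝ g (a + s • v) - fderiv ℝ g a - fderiv ℝ (fderiv ℝ g) a (s • v) with hP
    set Q := fderiv ℝ g b - fderiv ℝ g a - fderiv ℝ (fderiv ℝ g) a v with hQ
    have e1 : fderiv ℝ g (a + s • v) v - 1 * fderiv ℝ g a v -
        (2 * s) * ((fderiv ℝ g b v - fderiv ℝ g a v) / 2) = P v - s * Q v := by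
      simp only [hP, hQ, _root_.sub_apply, map_smul, _root_.smul_apply, smul_eq_mul]
      ring
    have hP1 : ‖P v‖ ≤ M * ‖v‖ ^ 3 := by
      refine (P.le_opNorm v).trans ?_
      calc ‖P‖ * ‖v‖ ≤ M * (1 * ‖v‖) ^ 2 * ‖v‖ := by
            gcongr
            refine h1.trans ?_
            have := hs.2
            have := hs.1
            gcongr
        _ = _ := by ring
    have hQ1 : ‖Q v‖ ≤ M * ‖v‖ ^ 3 := by
      refine (Q.le_opNorm v).trans ?_
      calc ‖Q‖ * ‖v‖ ≤ M * ‖v‖ ^ 2 * ‖v‖ := by gcongr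
        _ = _ := by ring
    rw [e1]
    refine (norm_sub_le _ _).trans ?_
    rw [norm_mul, Real.norm_of_nonneg hs.1]
    have := mul_le_mul hs.2 hQ1 (norm_nonneg _) zero_le_one
    linarith
  have := (convex_Icc (0 : ℝ) 1).norm_image_sub_le_of_norm_hasDerivWithin_le
    (fun s _ => (he s).hasDerivWithinAt) hbd (x := 0) (y := 1) (by simp) (by simp)
  have e2 : e 1 - e 0 = g b - g a - (fderiv ℝ g a v + fderiv ℝ g b v) / 2 := by
    simp only [e, one_smul, zero_smul, add_zero, hv, add_sub_cancel]
    ring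
  rwa [e2, sub_zero, norm_one, mul_one, Real.norm_eq_abs] at this

variable {n : ℕ} {H : E n × E n → ℝ} {φ : ℝ → E n × E n → E n × E n}
  {F : E n × E n → E n} {u : E n → E n → ℝ}

namespace IsFoliation

/-- A one-sided second order expansion of the primitive of a leaf in a direction `w` transported
by the flow; the loss is governed by the size of the transported vector. -/
theorem exists_le_primitive_sub (hH : IsTonelliHamiltonian n 3 H) (hφ : IsHamFlow n H φ)
    (hF : IsFoliation n φ F u) (c : E n) (w : E n × E n) :
    ∃ C₁, 0 ≤ C₁ ∧ ∀ T, 0 ≤ T → ∃ C, 0 ≤ C ∧ ∀ x t, 0 ≤ t → t * ‖w‖ ≤ 1 →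
      t ^ 2 * dotP n w.1 w.2 / 2 - C₁ * (t * ‖fderiv ℝ (φ T) (x, F (x, c)) w‖ + C * t ^ 2) ^ 2 -
        C * t ^ 3 ≤
      primitive n u c (x + t • w.1) - primitive n u c x - dotP n (F (x, c)) (t • w.1) := by
  obtain ⟨Q, hQ0, hQ⟩ := hF.primitive_quad c
  obtain ⟨R, hR0, hR⟩ := hF.exists_bound_F c
  obtain ⟨h, hh⟩ := hH.slab_subset_sublevel (R + 1)
  obtain ⟨R', hR'0, hR'⟩ := hH.sublevel_subset_slab h
  obtain ⟨L, M, hLM⟩ := hH.periodic_hamVF.exists_fieldBounds hH.contDiff_hamVF R'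
  obtain ⟨L', M', hLM'⟩ := hH.periodic'.fderiv.exists_fieldBounds
    (hH.smooth.fderiv_right (m := 2) (by norm_num)) R'
  have hL0 := hLM.L_nonneg
  have hM0 := hLM'.M_nonneg
  refine ⟨Q + n, by positivity, fun T hT => ?_⟩
  obtain ⟨A, hA0, hA⟩ := hφ.exists_expansion hH h T
  set G := 2 * M' * (‖w‖ * Real.exp (L * T)) ^ 3 * T with hG
  have hG0 : 0 ≤ G := by positivity
  refine ⟨A * ‖w‖ ^ 2 + G, by positivity, fun x t ht htw => ?_⟩
  set b : E n × E n := (x, F (x, c)) with hb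
  have hbS : b ∈ slab n (R + 1) := (hR x).trans (by linarith)
  have htw' : ‖t • w‖ ≤ 1 := by rwa [norm_smul, Real.norm_of_nonneg ht]
  have hzS : b + t • w ∈ slab n (R + 1) := by
    change ‖F (x, c) + (t • w).2‖ ≤ R + 1
    exact (norm_add_le _ _).trans (add_le_add (hR x) ((norm_snd_le _).trans htw'))
  have hb' : ∀ θ, φ θ b ∈ slab n R' := fun θ =>
    hR' _ ((hφ.energy hH θ b).trans_le (hh _ hbS))
  have hz' : ∀ θ, φ θ (b + t • w) ∈ slab n R' := fun θ =>
    hR' _ ((hφ.energy hH θ _).trans_le (hh _ hzS))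
  have hbG : ∀ θ, (φ θ b).2 = F ((φ θ b).1, c) := fun θ => hF.flow_mem rfl θ
  set z : E n × E n := b + t • w with hz
  have hd : ∀ θ, |θ| ≤ T → ‖φ θ z - φ θ b‖ ≤ t * (‖w‖ * Real.exp (L * T)) := by
    intro θ hθ
    have := hLM.norm_sub_le (hφ.2 z) (hφ.2 b) hz' hb' hθ
    rwa [hφ.1, hφ.1, hz, add_sub_cancel_left, norm_smul, Real.norm_of_nonneg ht, mul_assoc] at this
  let g₁ : ℝ → ℝ := fun s => primitive n u c (φ s z).1 - primitive n u c (φ s b).1 -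
    dotP n (φ s b).2 ((φ s z).1 - (φ s b).1)
  let g₂ : ℝ → ℝ := fun s => dotP n ((φ s z).1 - (φ s b).1) ((φ s z).2 - (φ s b).2)
  have hf1 : ∀ y θ, HasDerivAt (fun s => (φ s y).1) (hamVF n H (φ θ y)).1 θ :=
    fun y θ => (hφ.2 y θ).fst
  have hf2 : ∀ y θ, HasDerivAt (fun s => (φ s y).2) (hamVF n H (φ θ y)).2 θ :=
    fun y θ => (hφ.2 y θ).snd
  have hg1 : ∀ θ, HasDerivAt g₁ (dotP n (F ((φ θ z).1, c) - (φ θ b).2) (hamVF n H (φ θ z)).1 -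
      dotP n (hamVF n H (φ θ b)).2 ((φ θ z).1 - (φ θ b).1)) θ := fun θ =>
    hF.hasDerivAt_defect c (hf1 b θ) (hf1 z θ) (hf2 b θ) (hbG θ)
  have hg2 : ∀ θ, HasDerivAt g₂
      (dotP n ((φ θ z).1 - (φ θ b).1) ((hamVF n H (φ θ z)).2 - (hamVF n H (φ θ b)).2) +
       dotP n ((hamVF n H (φ θ z)).1 - (hamVF n H (φ θ b)).1) ((φ θ z).2 - (φ θ b).2)) θ :=
    fun θ => HasDerivAt.dotP ((hf1 z θ).sub (hf1 b θ)) ((hf2 z θ).sub (hf2 b θ))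
  have hg : ∀ θ, HasDerivAt (fun s => g₁ s - g₂ s / 2) _ θ := fun θ =>
    (hg1 θ).sub ((hg2 θ).div_const 2)
  have hle : ∀ θ ∈ interior (Set.Icc 0 T), deriv (fun s => g₁ s - g₂ s / 2) θ ≤
      2 * M' * (t * (‖w‖ * Real.exp (L * T))) ^ 3 := by
    intro θ hθ
    have hθ' := interior_subset hθ
    rw [(hg θ).deriv]
    have h1 := (abs_le.mp (abs_trapezoid_le (convex_slab R') hH.differentiable hLM'
      (hb' θ) (hz' θ))).1
    have h2 : 2 * M' * ‖φ θ z - φ θ b‖ ^ 3 ≤ 2 * M' * (t * (‖w‖ * Real.exp (L * T))) ^ 3 := by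
      gcongr
      exact hd θ (by rw [abs_of_nonneg hθ'.1]; exact hθ'.2)
    have h3 := hH.le_of_convex (φ θ z).1 (φ θ z).2 (F ((φ θ z).1, c))
    have h4 : H ((φ θ z).1, F ((φ θ z).1, c)) = H (φ θ b) := by
      rw [hF.energy_const hH hφ c _ (φ θ b).1, ← hbG]
    rw [h4] at h3
    simp only [Prod.mk.eta] at h3
    rw [hH.fderiv_apply, hH.fderiv_apply] at h1
    refine le_trans ?_ h2
    generalize φ θ z = Z at *
    generalize φ θ b = B at *
    simp only [Prod.fst_sub, Prod.snd_sub, dotP_sub, sub_dotP] at h1 h3 ⊢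
    simp only [dotP_comm (hamVF n H Z).1, dotP_comm (hamVF n H B).1,
      dotP_comm (hamVF n H B).2] at h1 h3 ⊢
    linarith
  have hmain := (convex_Icc (0 : ℝ) T).image_sub_le_mul_sub_of_deriv_le
    (fun θ _ => (hg θ).continuousAt.continuousWithinAt)
    (fun θ _ => (hg θ).differentiableAt.differentiableWithinAt) hle 0
    (Set.left_mem_Icc.mpr hT) T (Set.right_mem_Icc.mpr hT) hT
  have hDT : ‖φ T z - φ T b‖ ≤ t * ‖fderiv ℝ (φ T) b w‖ + (A * ‖w‖ ^ 2 + G) * t ^ 2 := by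
    have h1 := ((hA b (hh _ hbS) T (abs_of_nonneg hT).le).2.2 _ htw').2
    rw [map_smul, norm_smul, Real.norm_of_nonneg ht] at h1
    have h2 := norm_add_le (φ T z - φ T b - t • fderiv ℝ (φ T) b w) (t • fderiv ℝ (φ T) b w)
    rw [sub_add_cancel, norm_smul, Real.norm_of_nonneg ht] at h2
    nlinarith [mul_nonneg hG0 (sq_nonneg t)]
  have hlo : -(Q * ‖φ T z - φ T b‖ ^ 2) ≤ g₁ T := by
    have h1 := (abs_le.mp (hQ (φ T b).1 ((φ T z).1 - (φ T b).1))).1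
    rw [add_sub_cancel, ← hbG] at h1
    have h2 : Q * ‖(φ T z).1 - (φ T b).1‖ ^ 2 ≤ Q * ‖φ T z - φ T b‖ ^ 2 := by
      gcongr
      exact norm_fst_le (φ T z - φ T b)
    simp only [g₁]
    linarith
  have hhi : g₂ T ≤ n * ‖φ T z - φ T b‖ ^ 2 := by
    refine (le_abs_self _).trans ((abs_dotP_le _ _).trans ?_)
    rw [sq, ← mul_assoc]
    have h1 := norm_fst_le (φ T z - φ T b)
    have h2 := norm_snd_le (φ T z - φ T b)
    rw [Prod.fst_sub] at h1
    rw [Prod.snd_sub] at h2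
    gcongr
  have e1 : g₁ 0 = primitive n u c (x + t • w.1) - primitive n u c x -
      dotP n (F (x, c)) (t • w.1) := by
    simp [g₁, hφ.1, hz, hb]
  have e2 : g₂ 0 = t ^ 2 * dotP n w.1 w.2 := by
    simp only [g₂, hφ.1, hz, hb, Prod.fst_add, Prod.snd_add, Prod.smul_fst, Prod.smul_snd,
      add_sub_cancel_left, dotP_smul, smul_dotP]
    ring
  have hsq : (Q + n) * ‖φ T z - φ T b‖ ^ 2 ≤
      (Q + n) * (t * ‖fderiv ℝ (φ T) b w‖ + (A * ‖w‖ ^ 2 + G) * t ^ 2) ^ 2 := by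
    gcongr
  have hGt : 2 * M' * (t * (‖w‖ * Real.exp (L * T))) ^ 3 * (T - 0) = G * t ^ 3 := by
    rw [hG]; ring
  have hpos : 0 ≤ A * ‖w‖ ^ 2 * t ^ 3 := by positivity
  have hpos2 : 0 ≤ n * ‖φ T z - φ T b‖ ^ 2 := by positivity
  rw [hGt] at hmain
  rw [e1, e2] at hmain
  linarith

end IsFoliation

end

section

variable {n : ℕ} {H : E n × E n → ℝ} {φ : ℝ → E n × E n → E n × E n}
  {F : E n × E n → E n} {u : E n → E n → ℝ}

namespace IsFoliation

theorem primitive_le_of_tangent (hF : IsFoliation n φ F u) {c : E n} {ζ w : E n × E n}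
    {C r₀ : ℝ} (hC : 0 ≤ C)
    (hw : ∀ r, |r| ≤ r₀ → ‖F (ζ.1 + r • w.1, c) - (ζ.2 + r • w.2)‖ ≤ C * r ^ 2)
    {t : ℝ} (ht : 0 ≤ t) (htr : t ≤ r₀) :
    primitive n u c (ζ.1 + t • w.1) ≤ primitive n u c ζ.1 + t * dotP n ζ.2 w.1 +
      t ^ 2 * dotP n w.2 w.1 / 2 + n * C * ‖w.1‖ * t ^ 3 := by
  have hl : ∀ s : ℝ, HasDerivAt (fun s : ℝ => ζ.1 + s • w.1) w.1 s := fun s => by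
    simpa using ((hasDerivAt_id s).smul_const w.1).const_add ζ.1
  let e : ℝ → ℝ := fun s => primitive n u c (ζ.1 + s • w.1) - s * dotP n ζ.2 w.1 -
    s ^ 2 * (dotP n w.2 w.1 / 2)
  have he : ∀ s : ℝ, HasDerivAt e (dotP n (F (ζ.1 + s • w.1, c) - (ζ.2 + s • w.2)) w.1) s := by
    intro s
    have h1 := hF.hasDerivAt_primitive c (hl s)
    have h2 := (hasDerivAt_id s).mul_const (dotP n ζ.2 w.1)
    have h3 := (hasDerivAt_pow 2 s).mul_const (dotP n w.2 w.1 / 2)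
    refine ((h1.sub h2).sub h3).congr_deriv ?_
    rw [sub_dotP, add_dotP, smul_dotP]
    norm_num
    ring
  have hle : ∀ s ∈ interior (Set.Icc 0 t), deriv e s ≤ n * C * ‖w.1‖ * t ^ 2 := by
    intro s hs
    have hs' := interior_subset hs
    rw [(he s).deriv]
    refine (le_abs_self _).trans ((abs_dotP_le _ _).trans ?_)
    have h1 := hw s (by rw [abs_of_nonneg hs'.1]; exact hs'.2.trans htr)
    have h2 : s ^ 2 ≤ t ^ 2 := pow_le_pow_left₀ hs'.1 hs'.2 2
    calc _ ≤ n * (C * t ^ 2) * ‖w.1‖ := by gcongr; exact h1.trans (by gcongr)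
      _ = _ := by ring
  have := (convex_Icc (0 : ℝ) t).image_sub_le_mul_sub_of_deriv_le
    (fun θ _ => (he θ).continuousAt.continuousWithinAt)
    (fun θ _ => (he θ).differentiableAt.differentiableWithinAt) hle 0
    (Set.left_mem_Icc.mpr ht) t (Set.right_mem_Icc.mpr ht) ht
  simp only [e, zero_smul, add_zero] at this
  linarith

theorem omega0_le (hH : IsTonelliHamiltonian n 3 H) (hφ : IsHamFlow n H φ)
    (hF : IsFoliation n φ F u) {c : E n} {ζ w v : E n × E n} (hζ : ζ.2 = F (ζ.1, c))
    {C r₀ : ℝ} (hC : 0 ≤ C) (hr₀ : 0 < r₀)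
    (hw : ∀ r, |r| ≤ r₀ → ‖F (ζ.1 + r • w.1, c) - (ζ.2 + r • w.2)‖ ≤ C * r ^ 2)
    (hv : ∀ r, |r| ≤ r₀ → ‖F (ζ.1 + r • v.1, c) - (ζ.2 + r • v.2)‖ ≤ C * r ^ 2) :
    ∃ C₁ C₂, ∀ T, 0 ≤ T → ∀ σ, |σ| ≤ 1 →
      -(σ * omega0 n w v) ≤ C₂ * σ ^ 2 + C₁ * ‖fderiv ℝ (φ T) ζ w‖ ^ 2 := by
  obtain ⟨C₁, hC₁, hlow⟩ := hF.exists_le_primitive_sub hH hφ c w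
  obtain ⟨Q, hQ0, hQ⟩ := hF.primitive_quad c
  refine ⟨C₁, 2 * Q * ‖v.1‖ ^ 2, fun T hT σ hσ => ?_⟩
  obtain ⟨A, hA0, hA⟩ := hlow T hT
  set K := 2 * (n * C * ‖w.1‖) + n * C * ‖v.1‖ with hK
  let b : ℝ → E n × E n := fun t => (ζ.1 + (σ * t) • v.1, F (ζ.1 + (σ * t) • v.1, c))
  let a : ℝ → ℝ := fun t => ‖fderiv ℝ (φ T) (b t) w‖
  have hb : Continuous b := by
    have h1 : Continuous fun t : ℝ => ζ.1 + (σ * t) • v.1 := by fun_prop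
    exact h1.prodMk ((hF.continuous_F c).comp h1)
  have ha : Continuous a :=
    (((hφ.continuous_fderiv hH T).comp hb).clm_apply continuous_const).norm
  have hb0 : b 0 = ζ := by
    simp only [b, mul_zero, zero_smul, add_zero, ← hζ]
  have key : ∀ t, 0 < t → t ≤ r₀ → t * ‖w‖ ≤ 1 →
      -(σ * omega0 n w v) ≤ 2 * Q * ‖v.1‖ ^ 2 * σ ^ 2 + C₁ * (a t + A * t) ^ 2 + (A + K) * t := by
    intro t ht htr htw
    set s := σ * t with hs
    have hst : |s| ≤ t := by
      rw [hs, abs_mul, abs_of_pos ht]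
      exact mul_le_of_le_one_left ht.le hσ
    have hs2 : s ^ 2 ≤ t ^ 2 := sq_le_sq' (neg_le_of_abs_le hst) (le_of_abs_le hst)
    have i1 := hA (ζ.1 + s • v.1) t ht.le htw
    have i2 : -(n * C * ‖w.1‖ * t ^ 3) ≤
        dotP n (F (ζ.1 + s • v.1, c) - (ζ.2 + s • v.2)) (t • w.1) := by
      refine neg_le_of_abs_le ((abs_dotP_le _ _).trans ?_)
      rw [norm_smul, Real.norm_of_nonneg ht.le]
      calc _ ≤ n * (C * t ^ 2) * (t * ‖w.1‖) := by
            gcongr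
            exact (hv s (hst.trans htr)).trans (by gcongr)
        _ = _ := by ring
    have i3 := (abs_le.mp (hQ ζ.1 (s • v.1))).1
    rw [← hζ] at i3
    have i4 := (abs_le.mp (hQ (ζ.1 + t • w.1) (s • v.1))).2
    have i5 : dotP n (F (ζ.1 + t • w.1, c) - (ζ.2 + t • w.2)) (s • v.1) ≤
        n * C * ‖v.1‖ * t ^ 3 := by
      refine (le_abs_self _).trans ((abs_dotP_le _ _).trans ?_)
      rw [norm_smul, Real.norm_eq_abs]
      calc _ ≤ n * (C * t ^ 2) * (t * ‖v.1‖) := by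
            gcongr
            exact hw t (by rwa [abs_of_pos ht])
        _ = _ := by ring
    have i6 := hF.primitive_le_of_tangent hC hw ht.le htr
    have e1 : ζ.1 + s • v.1 + t • w.1 = ζ.1 + t • w.1 + s • v.1 := by abel
    have e2 : ‖s • v.1‖ ^ 2 = σ ^ 2 * t ^ 2 * ‖v.1‖ ^ 2 := by
      rw [norm_smul, mul_pow, Real.norm_eq_abs, sq_abs, hs, mul_pow]
    have e3 : a t = ‖fderiv ℝ (φ T) (ζ.1 + s • v.1, F (ζ.1 + s • v.1, c)) w‖ := rfl
    rw [e1, ← e3] at i1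
    rw [e2] at i3 i4
    have hfin : -(σ * omega0 n w v) * t ^ 2 ≤ (2 * Q * ‖v.1‖ ^ 2 * σ ^ 2 +
        C₁ * (a t + A * t) ^ 2 + (A + K) * t) * t ^ 2 := by
      simp only [sub_dotP, add_dotP, smul_dotP, dotP_smul] at i1 i2 i3 i4 i5 i6
      have e4 : -(σ * omega0 n w v) * t ^ 2 = s * t * (dotP n v.2 w.1 - dotP n w.2 v.1) := by
        simp only [omega0, dotP_comm w.1]
        rw [hs]; ring
      have e5 : (2 * Q * ‖v.1‖ ^ 2 * σ ^ 2 + C₁ * (a t + A * t) ^ 2 + (A + K) * t) * t ^ 2 =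
          2 * (Q * (σ ^ 2 * t ^ 2 * ‖v.1‖ ^ 2)) + C₁ * (t * a t + A * t ^ 2) ^ 2 + A * t ^ 3 +
          2 * (n * C * ‖w.1‖ * t ^ 3) + n * C * ‖v.1‖ * t ^ 3 := by
        rw [hK]; ring
      rw [e4, e5]
      rw [dotP_comm w.1] at i1
      linarith
    exact le_of_mul_le_mul_right hfin (by positivity)
  have hlim : Tendsto (fun t => 2 * Q * ‖v.1‖ ^ 2 * σ ^ 2 + C₁ * (a t + A * t) ^ 2 + (A + K) * t)
      (nhdsWithin 0 (Set.Ioi 0))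
      (nhds (2 * Q * ‖v.1‖ ^ 2 * σ ^ 2 + C₁ * ‖fderiv ℝ (φ T) ζ w‖ ^ 2)) := by
    have hc : Continuous fun t =>
        2 * Q * ‖v.1‖ ^ 2 * σ ^ 2 + C₁ * (a t + A * t) ^ 2 + (A + K) * t := by
      fun_prop
    have := (hc.tendsto 0).mono_left (nhdsWithin_le_nhds (s := Set.Ioi 0))
    simpa only [a, hb0, mul_zero, add_zero] using this
  refine ge_of_tendsto hlim ?_
  have h1 : ∀ᶠ t : ℝ in nhdsWithin 0 (Set.Ioi 0), t ≤ r₀ :=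
    (eventually_le_nhds hr₀).filter_mono nhdsWithin_le_nhds
  have h2 : ∀ᶠ t : ℝ in nhdsWithin 0 (Set.Ioi 0), t * ‖w‖ ≤ 1 := by
    have hc : Continuous fun t : ℝ => t * ‖w‖ := by fun_prop
    have := hc.tendsto 0
    rw [zero_mul] at this
    exact (this.eventually_le_const one_pos).filter_mono nhdsWithin_le_nhds
  filter_upwards [h1, h2, self_mem_nhdsWithin] with t h1 h2 h3
  exact key t h3 h1 h2

/-- A contracted tangent direction of a leaf is symplectically orthogonal to every tangent
direction. -/
theorem omega0_eq_zero (hH : IsTonelliHamiltonian n 3 H) (hφ : IsHamFlow n H φ)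
    (hF : IsFoliation n φ F u) {c : E n} {ζ w v : E n × E n} (hζ : ζ.2 = F (ζ.1, c))
    {C r₀ : ℝ} (hC : 0 ≤ C) (hr₀ : 0 < r₀)
    (hw : ∀ r, |r| ≤ r₀ → ‖F (ζ.1 + r • w.1, c) - (ζ.2 + r • w.2)‖ ≤ C * r ^ 2)
    (hv : ∀ r, |r| ≤ r₀ → ‖F (ζ.1 + r • v.1, c) - (ζ.2 + r • v.2)‖ ≤ C * r ^ 2)
    {T : ℕ → ℝ} (hT : ∀ j, 0 ≤ T j)
    (hlim : Tendsto (fun j => ‖fderiv ℝ (φ (T j)) ζ w‖) atTop (nhds 0)) :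
    omega0 n w v = 0 := by
  obtain ⟨C₁, C₂, hle⟩ := hF.omega0_le hH hφ hζ hC hr₀ hw hv
  set Ω := omega0 n w v
  have h1 : ∀ σ, |σ| ≤ 1 → -(σ * Ω) ≤ C₂ * σ ^ 2 := by
    intro σ hσ
    have h2 := ((hlim.pow 2).const_mul C₁).const_add (C₂ * σ ^ 2)
    rw [zero_pow two_ne_zero, mul_zero, add_zero] at h2
    exact ge_of_tendsto' h2 fun j => hle (T j) (hT j) σ hσ
  have h2 : ∀ σ, 0 < σ → σ ≤ 1 → |Ω| ≤ C₂ * σ := by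
    intro σ h3 h4
    have h5 := h1 σ (by rwa [abs_of_pos h3])
    have h6 := h1 (-σ) (by rwa [abs_neg, abs_of_pos h3])
    refine le_of_mul_le_mul_left ?_ h3
    rw [← abs_of_pos h3, ← abs_mul, abs_le, abs_of_pos h3]
    constructor <;> nlinarith
  have h3 : |Ω| ≤ 0 := by
    have hc : Continuous fun σ : ℝ => C₂ * σ := by fun_prop
    have := (hc.tendsto 0).mono_left (nhdsWithin_le_nhds (s := Set.Ioi 0))
    rw [mul_zero] at this
    refine ge_of_tendsto this ?_
    have h4 : ∀ᶠ t : ℝ in nhdsWithin 0 (Set.Ioi 0), t ≤ 1 :=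
      (eventually_le_nhds one_pos).filter_mono nhdsWithin_le_nhds
    filter_upwards [h4, self_mem_nhdsWithin] with σ h5 h6
    exact h2 σ h6 h5
  exact abs_nonpos_iff.mp h3

end IsFoliation

end

section GrowthRates

variable {n : ℕ} {H : E n × E n → ℝ} {φ : ℝ → E n × E n → E n × E n}

namespace IsHamFlow

theorem norm_fderiv_neg_le (hH : IsTonelliHamiltonian n 3 H) (hφ : IsHamFlow n H φ) (t : ℝ)
    (z : E n × E n) : ‖fderiv ℝ (φ (-t)) z‖ ≤
      ‖sharp n‖ * ‖omegaL n‖ * ‖fderiv ℝ (φ t) (φ (-t) z)‖ := by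
  refine ContinuousLinearMap.opNorm_le_bound _ (by positivity) fun w => ?_
  have hinv := hφ.fderiv_neg_apply hH (-t) z w
  rw [neg_neg] at hinv
  have hw : fderiv ℝ (φ (-t)) z w =
      sharp n (((omegaL n).flip w).comp (fderiv ℝ (φ t) (φ (-t) z))) := by
    refine omega0_nondeg fun v => ?_
    rw [omega0_sharp, ContinuousLinearMap.comp_apply, ContinuousLinearMap.flip_apply,
      omegaL_apply, ← hφ.omega0_fderiv hH t (φ (-t) z) v, hinv]
  rw [hw]
  calc _ ≤ ‖sharp n‖ * ‖((omegaL n).flip w).comp (fderiv ℝ (φ t) (φ (-t) z))‖ :=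
        (sharp n).le_opNorm _
    _ ≤ ‖sharp n‖ * (‖(omegaL n).flip w‖ * ‖fderiv ℝ (φ t) (φ (-t) z)‖) := by
        gcongr
        exact ContinuousLinearMap.opNorm_comp_le _ _
    _ ≤ ‖sharp n‖ * ((‖(omegaL n).flip‖ * ‖w‖) * ‖fderiv ℝ (φ t) (φ (-t) z)‖) := by
        gcongr
        exact ContinuousLinearMap.le_opNorm _ _
    _ = _ := by
        rw [ContinuousLinearMap.opNorm_flip]
        ring

theorem fderiv_sharp (hH : IsTonelliHamiltonian n 3 H) (hφ : IsHamFlow n H φ) (t : ℝ)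
    (z : E n × E n) (η : (E n × E n) →L[ℝ] ℝ) :
    fderiv ℝ (φ t) z (sharp n η) = sharp n (η.comp (fderiv ℝ (φ (-t)) (φ t z))) := by
  refine omega0_nondeg fun v => ?_
  have hz : φ (-t) (φ t z) = z := by rw [← hφ.add hH, neg_add_cancel, hφ.1]
  rw [omega0_sharp, ContinuousLinearMap.comp_apply, ← omega0_sharp η]
  have := hφ.fderiv_neg_apply hH (-t) (φ t z) v
  rw [neg_neg, hz] at this
  have h1 := hφ.omega0_fderiv hH t z (fderiv ℝ (φ (-t)) (φ t z) v) (sharp n η)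
  rwa [this] at h1

/-- The sublevels of the energy are compact modulo translations. -/
theorem exists_tendsto_fderiv (hH : IsTonelliHamiltonian n 3 H) (hφ : IsHamFlow n H φ) {h : ℝ}
    (z : ℕ → E n × E n) (hz : ∀ N, H (z N) ≤ h) :
    ∃ ζ, H ζ ≤ h ∧ ∃ s : ℕ → ℕ, StrictMono s ∧ ∀ t r : ℝ,
      Tendsto (fun N => fderiv ℝ (φ t) (φ r (z (s N)))) atTop
        (nhds (fderiv ℝ (φ t) (φ r ζ))) := by
  obtain ⟨R, -, hR⟩ := hH.sublevel_subset_slab h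
  obtain ⟨ζ, -, m, s, hs, hlim⟩ := exists_tendsto_translate fun N => hR _ (hz N)
  refine ⟨ζ, ?_, s, hs, fun t r => ?_⟩
  · refine le_of_tendsto' ((hH.smooth.continuous.tendsto ζ).comp hlim) fun N => ?_
    rw [Function.comp_apply, hH.periodic']
    exact hz _
  · have h1 := (((hφ.continuous_fderiv hH t).comp (hφ.continuous hH r)).tendsto ζ).comp hlim
    refine h1.congr fun N => ?_
    simp only [Function.comp_apply, hφ.translate hH]
    exact hφ.periodic_fderiv hH t _ _

theorem exists_exp_bound (hH : IsTonelliHamiltonian n 3 H) (hφ : IsHamFlow n H φ) (h : ℝ) :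
    ∃ a, ∀ z, H z ≤ h → ∀ i : ℕ, ‖fderiv ℝ (φ i) z‖ ≤ Real.exp (a * i) := by
  obtain ⟨C, -, hC⟩ := hφ.exists_expansion hH h 1
  refine ⟨Real.log (max C 1), fun z hz i => ?_⟩
  rw [mul_comm, Real.exp_nat_mul, Real.exp_log (by positivity)]
  induction i with
  | zero =>
    rw [Nat.cast_zero, hφ.fderiv_zero, pow_zero]
    exact ContinuousLinearMap.norm_id_le
  | succ i ih =>
    rw [Nat.cast_succ, add_comm, hφ.fderiv_add hH, pow_succ']
    refine (ContinuousLinearMap.opNorm_comp_le _ _).trans ?_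
    have h1 := (hC (φ i z) ((hφ.energy hH i z).trans_le hz) 1 (by simp)).2.1
    gcongr
    exact h1.trans (le_max_left _ _)

/-- Exponential bounds at integer times extend to all times. -/
theorem exists_bound_of_nat (hH : IsTonelliHamiltonian n 3 H) (hφ : IsHamFlow n H φ) {h ε : ℝ}
    (hε : 0 ≤ ε) (hb : ∃ C, ∀ z, H z ≤ h → ∀ i : ℕ, ‖fderiv ℝ (φ i) z‖ ≤ C * Real.exp (ε * i)) :
    ∃ C, 0 < C ∧ ∀ z, H z ≤ h → ∀ t, 0 ≤ t → ‖fderiv ℝ (φ t) z‖ ≤ C * Real.exp (ε * t) ∧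
      ‖fderiv ℝ (φ (-t)) z‖ ≤ C * Real.exp (ε * t) := by
  obtain ⟨C, hC⟩ := hb
  obtain ⟨C₁, hC₁0, hC₁⟩ := hφ.exists_expansion hH h 1
  have hpos : ∀ z, H z ≤ h → ∀ t, 0 ≤ t →
      ‖fderiv ℝ (φ t) z‖ ≤ C₁ * |C| * Real.exp (ε * t) := by
    intro z hz t ht
    have hfl := Nat.floor_le ht
    have hlt := Nat.lt_floor_add_one t
    have hsplit : t = (t - ⌊t⌋₊) + ⌊t⌋₊ := by ring
    have h1 := (hC₁ (φ ⌊t⌋₊ z) ((hφ.energy hH _ z).trans_le hz) (t - ⌊t⌋₊)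
      (by rw [abs_le]; constructor <;> linarith)).2.1
    have h2 := hC z hz ⌊t⌋₊
    conv_lhs => rw [hsplit, hφ.fderiv_add hH]
    calc _ ≤ _ := ContinuousLinearMap.opNorm_comp_le _ _
      _ ≤ C₁ * (|C| * Real.exp (ε * t)) := by
        gcongr
        refine h2.trans ?_
        gcongr
        exact le_abs_self C
      _ = _ := by ring
  refine ⟨max (max (C₁ * |C|) (‖sharp n‖ * ‖omegaL n‖ * (C₁ * |C|))) 1, by positivity,
    fun z hz t ht => ⟨(hpos z hz t ht).trans ?_, (hφ.norm_fderiv_neg_le hH t z).trans ?_⟩⟩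
  · gcongr
    exact (le_max_left _ _).trans (le_max_left _ _)
  · have h1 := hpos (φ (-t) z) ((hφ.energy hH _ z).trans_le hz) t ht
    calc _ ≤ ‖sharp n‖ * ‖omegaL n‖ * (C₁ * |C| * Real.exp (ε * t)) := by gcongr
      _ = ‖sharp n‖ * ‖omegaL n‖ * (C₁ * |C|) * Real.exp (ε * t) := by ring
      _ ≤ _ := by
        gcongr
        exact (le_max_right _ _).trans (le_max_left _ _)

end IsHamFlow

namespace IsFoliation

variable {F : E n × E n → E n} {u : E n → E n → ℝ}

/-- A covector contracted in the future annihilates every vector contracted in the past. -/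
theorem pairing_eq_zero (hH : IsTonelliHamiltonian n 3 H) (hφ : IsHamFlow n H φ)
    (hF : IsFoliation n φ F u) {ζ v : E n × E n} {η : (E n × E n) →L[ℝ] ℝ} {τ D a b : ℝ}
    (hτ : 0 ≤ τ) (hD : 0 ≤ D) (ha : 0 ≤ a) (ha1 : a < 1) (hb : 0 ≤ b) (hab : a ^ 2 * b < 1)
    (hη : ∀ j : ℕ, ‖η.comp (fderiv ℝ (φ (-(τ * j))) (φ (τ * j) ζ))‖ ≤ D * a ^ j)
    (hv : ∀ j : ℕ, ‖fderiv ℝ (φ (-(τ * j))) ζ v‖ ≤ D * a ^ j)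
    (hg : ∀ z, H z ≤ H ζ → ∀ j : ℕ, ‖fderiv ℝ (φ (τ * j)) z‖ ≤ D * b ^ j) : η v = 0 := by
  have hw : ∀ j : ℕ, ‖fderiv ℝ (φ (τ * j)) ζ (sharp n η)‖ ≤ ‖sharp n‖ * D * a ^ j := by
    intro j
    rw [hφ.fderiv_sharp hH, mul_assoc]
    exact ((sharp n).le_opNorm _).trans (mul_le_mul_of_nonneg_left (hη j) (norm_nonneg _))
  have hg' : ∀ z, H z ≤ H ζ → ∀ j : ℕ,
      ‖fderiv ℝ (φ (-(τ * j))) z‖ ≤ ‖sharp n‖ * ‖omegaL n‖ * D * b ^ j := by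
    intro z hz j
    rw [mul_assoc _ D]
    exact (hφ.norm_fderiv_neg_le hH _ z).trans (mul_le_mul_of_nonneg_left
      (hg _ ((hφ.energy hH _ z).trans_le hz) j) (by positivity))
  set D' := max (‖sharp n‖ * D) (‖sharp n‖ * ‖omegaL n‖ * D) with hD'
  obtain ⟨C₁, r₁, hC₁, hr₁, h₁⟩ := hF.exists_tangent hH hφ (ζ := ζ) (w := sharp n η) (σ := τ)
    (D := D') (by positivity) ha ha1 hb hab
    (fun j => (hw j).trans (by gcongr; exact le_max_left _ _))
    (fun z hz j => (hg' z hz j).trans (by gcongr; exact le_max_right _ _))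
  obtain ⟨C₂, r₂, hC₂, hr₂, h₂⟩ := hF.exists_tangent hH hφ (ζ := ζ) (w := v) (σ := -τ)
    hD ha ha1 hb hab (fun j => by rw [neg_mul]; exact hv j)
    (fun z hz j => by rw [neg_mul, neg_neg]; exact hg z hz j)
  have h0 := hF.omega0_eq_zero hH hφ (hF.snd_eq ζ) (w := sharp n η) (v := v)
    (C := max C₁ C₂) (r₀ := min r₁ r₂) (by positivity) (lt_min hr₁ hr₂)
    (fun r hr => (h₁ r (hr.trans (min_le_left _ _))).trans (by gcongr; exact le_max_left _ _))
    (fun r hr => (h₂ r (hr.trans (min_le_right _ _))).trans (by gcongr; exact le_max_right _ _))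
    (T := fun j => τ * j) (fun j => by positivity)
    (squeeze_zero (fun _ => norm_nonneg _) hw (by
      simpa using (tendsto_pow_atTop_nhds_zero_of_lt_one ha ha1).const_mul (‖sharp n‖ * D)))
  rw [← omega0_sharp η, omega0_swap, h0, neg_zero]

/-- The derivative cocycle has subexponential growth, uniformly on energy sublevels. -/
theorem exists_subexponential_bound (hH : IsTonelliHamiltonian n 3 H) (hφ : IsHamFlow n H φ)
    (hF : IsFoliation n φ F u) (h : ℝ) {ε : ℝ} (hε : 0 < ε) :
    ∃ C, ∀ z, H z ≤ h → ∀ i : ℕ, ‖fderiv ℝ (φ i) z‖ ≤ C * Real.exp (ε * i) := by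
  by_contra hcon
  set P : Set ℝ := {a | ∃ C, ∀ z, H z ≤ h → ∀ i : ℕ,
    ‖fderiv ℝ (φ i) z‖ ≤ C * Real.exp (a * i)} with hP
  have hup : ∀ a ∈ P, ∀ b, a ≤ b → b ∈ P := by
    rintro a ⟨C, hC⟩ b hab
    refine ⟨|C|, fun z hz i => (hC z hz i).trans ?_⟩
    gcongr
    exact le_abs_self C
  have hne : P.Nonempty := by
    obtain ⟨a, ha⟩ := hφ.exists_exp_bound hH h
    exact ⟨a, 1, fun z hz i => by rw [one_mul]; exact ha z hz i⟩
  have hlb : ∀ a ∈ P, ε ≤ a := fun a ha => by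
    by_contra hlt
    exact hcon (hup a ha ε (not_le.mp hlt).le)
  set Λ := sInf P with hΛdef
  have hΛ : 0 < Λ := hε.trans_le (le_csInf hne hlb)
  have hPΛ : ∀ δ > 0, Λ + δ ∈ P := fun δ hδ => by
    obtain ⟨a, ha, hlt⟩ := exists_lt_of_csInf_lt hne (show sInf P < Λ + δ by linarith)
    exact hup a ha _ hlt.le
  have hPΛ' : ∀ δ > 0, Λ - δ ∉ P := fun δ hδ hmem => by
    have := csInf_le ⟨ε, hlb⟩ hmem
    linarith
  obtain ⟨τ, hτ, ζ, hζ, η, v, D, hne0, hη⟩ := exists_contracting_pair_of_growth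
    (T := fun (i : ℤ) => φ i) (A := fun (i : ℤ) z => fderiv ℝ (φ i) z) (S := {z | H z ≤ h})
    (fun z => by rw [Int.cast_zero]; exact hφ.1 z)
    (fun i j z => by rw [Int.cast_add]; exact hφ.add hH _ _ z)
    (fun i z hz => (hφ.energy hH _ z).trans_le hz)
    (fun z => by rw [Int.cast_zero]; exact hφ.fderiv_zero z)
    (fun i j z => by rw [Int.cast_add]; exact hφ.fderiv_add hH _ _ z)
    (fun z hz => by
      obtain ⟨ζ, hζ, s, hs, hlim⟩ := hφ.exists_tendsto_fderiv hH z hz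
      exact ⟨ζ, hζ, s, hs, fun i j => hlim i j⟩)
    hΛ (show 3 * Λ / 4 < Λ by linarith)
    (fun δ hδ => by
      obtain ⟨C, hC⟩ := hPΛ δ hδ
      exact ⟨C, fun z hz i => by rw [Int.cast_natCast]; exact hC z hz i⟩)
    (fun δ hδ => by
      rintro ⟨C, hC⟩
      exact hPΛ' δ hδ ⟨C, fun z hz i => by
        have := hC z hz i
        rwa [Int.cast_natCast] at this⟩)
  obtain ⟨C, hC⟩ := hPΛ (Λ / 4) (by linarith)
  have hτ0 : (0 : ℝ) < τ := by exact_mod_cast hτ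
  have hexp : ∀ (x : ℝ) (i : ℕ), Real.exp x ^ i = Real.exp (x * i) := fun x i => by
    rw [← Real.exp_nat_mul, mul_comm]
  refine hne0 (hF.pairing_eq_zero hH hφ (ζ := ζ) (τ := τ) (D := max |C| |D|)
    (a := Real.exp (-(3 * Λ / 4 * τ))) (b := Real.exp ((Λ + Λ / 4) * τ)) hτ0.le (by positivity)
    (Real.exp_nonneg _) (by rw [Real.exp_lt_one_iff]; nlinarith) (Real.exp_nonneg _) ?_ ?_ ?_ ?_)
  · rw [hexp, ← Real.exp_add, Real.exp_lt_one_iff]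
    push_cast
    nlinarith [mul_pos hΛ hτ0]
  · intro j
    have := (hη j).1
    push_cast at this
    rw [hexp]
    refine this.trans ?_
    gcongr
    exact (le_abs_self D).trans (le_max_right _ _)
  · intro j
    have := (hη j).2
    push_cast at this
    rw [hexp]
    refine this.trans ?_
    gcongr
    exact (le_abs_self D).trans (le_max_right _ _)
  · intro z hz j
    have := hC z (hz.trans hζ) (τ * j)
    push_cast at this
    rw [hexp, mul_assoc _ (τ : ℝ)]
    refine this.trans ?_
    gcongr
    exact (le_abs_self C).trans (le_max_left _ _)

end IsFoliation

theorem tendsto_one_div_mul_of_abs_le {f : ℝ → ℝ}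
    (hf : ∀ ε > 0, ∃ K, ∀ t, 0 ≤ t → |f t| ≤ ε * t + K) :
    Tendsto (fun t => (1 / t) * f t) atTop (nhds 0) := by
  rw [Metric.tendsto_atTop]
  intro ε hε
  obtain ⟨K, hK⟩ := hf (ε / 2) (by linarith)
  refine ⟨2 * |K| / ε + 1, fun t ht => ?_⟩
  have h0 : 0 ≤ 2 * |K| / ε := by positivity
  have htp : 0 < t := by linarith
  have h1 : 2 * |K| / ε < t := by linarith
  rw [div_lt_iff₀ hε] at h1
  have h2 := hK t htp.le
  have h3 := le_abs_self K
  rw [dist_zero_right, Real.norm_eq_abs, abs_mul, abs_of_pos (one_div_pos.mpr htp),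
    one_div_mul_eq_div, div_lt_iff₀ htp]
  linarith

theorem abs_log_norm_le {V : Type*} [NormedAddCommGroup V] [NormedSpace ℝ V] {A B : V →L[ℝ] V}
    {w : V} (hw : w ≠ 0) (hBA : B (A w) = w) {C x : ℝ} (hC : 0 < C)
    (hA : ‖A‖ ≤ C * Real.exp x) (hB : ‖B‖ ≤ C * Real.exp x) :
    |Real.log ‖A w‖| ≤ x + (|Real.log C| + |Real.log ‖w‖|) := by
  have hw0 : 0 < ‖w‖ := norm_pos_iff.mpr hw
  have hAw : 0 < ‖A w‖ := norm_pos_iff.mpr fun h => hw (by rw [← hBA, h, map_zero])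
  have hlog : ∀ y, 0 < y → Real.log (C * Real.exp x * y) = Real.log C + x + Real.log y :=
    fun y hy => by
      rw [Real.log_mul (by positivity) hy.ne', Real.log_mul hC.ne' (Real.exp_ne_zero _),
        Real.log_exp]
  have h1 := Real.log_le_log hAw (A.le_of_opNorm_le hA w)
  have h2 := Real.log_le_log hw0
    ((congrArg norm hBA).symm.le.trans (B.le_of_opNorm_le hB (A w)))
  rw [hlog _ hw0] at h1
  rw [hlog _ hAw] at h2
  rw [abs_le]
  constructor <;>
  linarith [le_abs_self (Real.log C), neg_abs_le (Real.log C), le_abs_self (Real.log ‖w‖),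
    neg_abs_le (Real.log ‖w‖)]

theorem C0Integrable.tendsto_log_fderiv (hH : IsTonelliHamiltonian n 3 H)
    (hφ : IsHamFlow n H φ) (hint : C0Integrable n H φ) (ζ : E n × E n) {w : E n × E n}
    (hw : w ≠ 0) :
    Tendsto (fun t : ℝ => (1 / t) * Real.log ‖fderiv ℝ (φ t) ζ w‖) atTop (nhds 0) ∧
      Tendsto (fun t : ℝ => (1 / t) * Real.log ‖fderiv ℝ (φ (-t)) ζ w‖) atTop (nhds 0) := by
  obtain ⟨F, u, hF⟩ := hint.exists_foliation
  have hbd : ∀ ε > 0, ∃ C, 0 < C ∧ ∀ z, H z ≤ H ζ → ∀ t, 0 ≤ t →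
      ‖fderiv ℝ (φ t) z‖ ≤ C * Real.exp (ε * t) ∧
      ‖fderiv ℝ (φ (-t)) z‖ ≤ C * Real.exp (ε * t) := fun ε hε =>
    hφ.exists_bound_of_nat hH hε.le (hF.exists_subexponential_bound hH hφ (H ζ) hε)
  constructor
  · refine tendsto_one_div_mul_of_abs_le fun ε hε => ?_
    obtain ⟨C, hC, hb⟩ := hbd ε hε
    exact ⟨_, fun t ht => abs_log_norm_le hw (hφ.fderiv_neg_apply hH t ζ w) hC
      (hb ζ le_rfl t ht).1 (hb _ (hφ.energy hH t ζ).le t ht).2⟩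
  · refine tendsto_one_div_mul_of_abs_le fun ε hε => ?_
    obtain ⟨C, hC, hb⟩ := hbd ε hε
    refine ⟨_, fun t ht => abs_log_norm_le hw (B := fderiv ℝ (φ t) (φ (-t) ζ)) ?_ hC
      (hb ζ le_rfl t ht).2 (hb _ (hφ.energy hH (-t) ζ).le t ht).1⟩
    have := hφ.fderiv_neg_apply hH (-t) ζ w
    rwa [neg_neg] at this

end GrowthRates

/-- For a `C³` Tonelli Hamiltonian on `T*𝕋ⁿ` that is `C⁰` integrable,
every invariant compactly supported Borel probability measure has all its Lyapunov
exponents equal to zero: for a.e. point, every nonzero tangent vector grows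
subexponentially under the derivative cocycle, in the future and in the past. -/
theorem zero_lyapunov_exponents (n : ℕ) (hn : 1 ≤ n)
    (H : E n × E n → ℝ) (hH : IsTonelliHamiltonian n 3 H)
    (φ : ℝ → E n × E n → E n × E n) (hφ : IsHamFlow n H φ)
    (hint : C0Integrable n H φ)
    -- the flow descended to `T*𝕋ⁿ`
    (Φ : ℝ → Torus n × E n → Torus n × E n)
    (hΦcont : ∀ t : ℝ, Continuous (Φ t))
    (hΦcomm : ∀ (t : ℝ) (z : E n × E n), Φ t (projT n z) = projT n (φ t z))
    -- an invariant compactly supported Borel probability measure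
    (μ : Measure (Torus n × E n)) (hμprob : IsProbabilityMeasure μ)
    (hμinv : ∀ t : ℝ, μ.map (Φ t) = μ)
    (hμcpt : ∃ K : Set (Torus n × E n), IsCompact K ∧ μ Kᶜ = 0) :
    ∀ᵐ ζt ∂μ, ∀ ζ : E n × E n, projT n ζ = ζt →
      ∀ w : E n × E n, w ≠ 0 →
        Tendsto (fun t : ℝ => (1 / t) * Real.log ‖fderiv ℝ (φ t) ζ w‖)
          atTop (nhds 0) ∧
        Tendsto (fun t : ℝ => (1 / t) * Real.log ‖fderiv ℝ (φ (-t)) ζ w‖)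
          atTop (nhds 0) :=
  Filter.Eventually.of_forall fun _ ζ _ _ hw => hint.tendsto_log_fderiv hH hφ ζ hw

end
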